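/- There exists a universal radius R < ∞ with the following property. Let u : B_R × [0,∞) → ℝ (B_R ⊂ ℝ³ the open ball of radius R) be a smooth solution of the graphical mean curvature flow equation in de Sitter space with u ≥ 0, satisfying the spacelike condition e^{−2u}|Du|² < 1, and whose mean curvature satisfies 0 ≤ H ≤ Λ for some constant Λ < ∞. Then lim_{λ→∞} u(0,λ) = ∞, and the rescaled functions u^λ(x,s) := u(e^{−u(0,λ)} x, s + λ) − u(0,λ) converge to the function (x,s) ↦ 3s in C^∞_loc(ℝ³ × ℝ) as λ → ∞; that is, for every compact K ⊂ ℝ³ × ℝ and every order k, u^λ is defined on K for all sufficiently large λ and all partial derivatives of u^λ − 3s up to order k tend to 0 uniformly on K. -/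

import Mathlib

/- Common definitions: spacelike graphs in de Sitter space ℝ³ × ℝ with metric
   g = e^{2t}(dx₁² + dx₂² + dx₃²) − dt², in graph coordinates. -/

noncomputable section

open Real Filter

/-- Spatial tslice ℝ³, modeled as `Fin 3 → ℝ`. -/
abbrev V3 : Type := Fin 3 → ℝ

/-- First spatial partial derivative `∂_i f`. -/
def pd (f : V3 → ℝ) (x : V3) (i : Fin 3) : ℝ :=
  fderiv ℝ f x (Pi.single i 1)

/-- Second spatial partial derivative `∂_i ∂_j f`. -/
def pd2 (f : V3 → ℝ) (x : V3) (i j : Fin 3) : ℝ :=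
  pd (fun y => pd f y j) x i

/-- Kronecker delta `δ_{ij}`. -/
def kd (i j : Fin 3) : ℝ := if i = j then (1 : ℝ) else 0

/-- `w = 1 − e^{−2u} |Du|²`. -/
def wfun (u : V3 → ℝ) (x : V3) : ℝ :=
  1 - exp (-2 * u x) * ∑ i, (pd u x i) ^ 2

/-- The spacelike condition `e^{−2u} |Du|² < 1` for the graph of `u`. -/
def Spacelike (u : V3 → ℝ) (x : V3) : Prop :=
  exp (-2 * u x) * ∑ i, (pd u x i) ^ 2 < 1

/-- The gradient function `v = w^{−1/2}`. -/
def gradFun (u : V3 → ℝ) (x : V3) : ℝ := (Real.sqrt (wfun u x))⁻¹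

/-- Induced metric `h_{ij} = e^{2u} δ_{ij} − u_i u_j`. -/
def hmet (u : V3 → ℝ) (x : V3) (i j : Fin 3) : ℝ :=
  exp (2 * u x) * kd i j - pd u x i * pd u x j

/-- Inverse induced metric `h^{ij} = e^{−2u} (δ_{ij} + e^{−2u} u_i u_j / w)`. -/
def hInv (u : V3 → ℝ) (x : V3) (i j : Fin 3) : ℝ :=
  exp (-2 * u x) * (kd i j + exp (-2 * u x) * pd u x i * pd u x j / wfun u x)

/-- Second fundamental form `a_{ij} = v (u_{ij} + e^{2u} δ_{ij} − 2 u_i u_j)`. -/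
def sff (u : V3 → ℝ) (x : V3) (i j : Fin 3) : ℝ :=
  gradFun u x * (pd2 u x i j + exp (2 * u x) * kd i j - 2 * pd u x i * pd u x j)

/-- Mean curvature `H = h^{ij} a_{ij}`. -/
def mcH (u : V3 → ℝ) (x : V3) : ℝ := ∑ i, ∑ j, hInv u x i j * sff u x i j

/-- Squared norm of the second fundamental form `|A|² = h^{ik} h^{jl} a_{ij} a_{kl}`. -/
def normA2 (u : V3 → ℝ) (x : V3) : ℝ :=
  ∑ i, ∑ j, ∑ k, ∑ l, hInv u x i k * hInv u x j l * sff u x i j * sff u x k l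

/-- Intrinsic inner product of gradients `⟨∇_M f, ∇_M φ⟩ = h^{ij} ∂_i f ∂_j φ`. -/
def gradPair (u f φ : V3 → ℝ) (x : V3) : ℝ :=
  ∑ i, ∑ j, hInv u x i j * pd f x i * pd φ x j

/-- Squared intrinsic gradient `|∇_M f|² = h^{ij} ∂_i f ∂_j f`. -/
def gradSq (u f : V3 → ℝ) (x : V3) : ℝ := gradPair u f f x

/-- Determinant of the induced metric. -/
def detH (u : V3 → ℝ) (x : V3) : ℝ := Matrix.det (Matrix.of fun i j => hmet u x i j)

/-- Laplace–Beltrami operator of the induced metric: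
`Δ_M f = (det h)^{−1/2} ∂_i ((det h)^{1/2} h^{ij} ∂_j f)`. -/
def lapM (u f : V3 → ℝ) (x : V3) : ℝ :=
  (Real.sqrt (detH u x))⁻¹ *
    ∑ i, pd (fun y => Real.sqrt (detH u y) * ∑ j, hInv u y i j * pd f y j) x i

/-- Time tslice of a time-dependent family. -/
def tslice (u : V3 → ℝ → ℝ) (s : ℝ) : V3 → ℝ := fun x => u x s

/-- The graphical mean curvature flow equation
`∂_s u = h^{ij} (u_{ij} + e^{2u} δ_{ij} − 2 u_i u_j)` at the point `(x, s)`. -/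
def FlowEq (u : V3 → ℝ → ℝ) (x : V3) (s : ℝ) : Prop :=
  deriv (fun r => u x r) s =
    ∑ i, ∑ j, hInv (tslice u s) x i j *
      (pd2 (tslice u s) x i j + exp (2 * u x s) * kd i j
        - 2 * pd (tslice u s) x i * pd (tslice u s) x j)

/-- Heat operator along normal trajectories:
`(∂_s − Δ) Q = ∂_s Q + H v e^{−2u} u_k ∂_k Q − Δ_M Q`. -/
def heatOp (u : V3 → ℝ → ℝ) (Q : V3 → ℝ → ℝ) (x : V3) (s : ℝ) : ℝ :=
  deriv (fun r => Q x r) s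
    + mcH (tslice u s) x * gradFun (tslice u s) x * exp (-2 * u x s) *
        (∑ k, pd (tslice u s) x k * pd (fun y => Q y s) x k)
    - lapM (tslice u s) (fun y => Q y s) x

/-- Components `P^k = h^{kj} u_j` (minus the components of `∂_t^⊤`). -/
def Pvec (u : V3 → ℝ) (x : V3) (k : Fin 3) : ℝ := ∑ j, hInv u x k j * pd u x j

/-- `A(∂_t^⊤, ∂_t^⊤) = a_{kl} P^k P^l`. -/
def Att (u : V3 → ℝ) (x : V3) : ℝ :=
  ∑ k, ∑ l, sff u x k l * Pvec u x k * Pvec u x l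

/-- `|A(·, ∂_t^⊤)|² = h^{mn} a_{mk} P^k a_{nl} P^l`. -/
def At2 (u : V3 → ℝ) (x : V3) : ℝ :=
  ∑ m, ∑ n, hInv u x m n * (∑ k, sff u x m k * Pvec u x k) *
    (∑ l, sff u x n l * Pvec u x l)

end



open Real Filter Topology
open scoped ContDiff

noncomputable section

lemma two_le_inf : (2 : WithTop ℕ∞) ≤ ∞ :=
  WithTop.coe_le_coe.2 (le_top : (2 : ℕ∞) ≤ ⊤)

/-- space-time -/
abbrev E4 : Type := V3 × ℝ

/-- total extension by zero -/
def ext0 {U : Set E4} (f : U → ℝ) : E4 → ℝ := Function.extend Subtype.val f 0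

lemma ext0_apply {U : Set E4} (f : U → ℝ) (z : U) : ext0 f z.1 = f z :=
  Subtype.val_injective.extend_apply f 0 z

lemma ext0_apply' {U : Set E4} (f : U → ℝ) (z : E4) (hz : z ∈ U) : ext0 f z = f ⟨z, hz⟩ :=
  ext0_apply f ⟨z, hz⟩

/-- the algebra of smooth functions on `U` -/
def SA (U : Set E4) : Subalgebra ℝ (U → ℝ) where
  carrier := {f | ContDiffOn ℝ ∞ (ext0 f) U}
  mul_mem' := by
    intro f g hf hg
    refine (hf.mul hg).congr ?_
    intro z hz
    simp [ext0_apply' _ z hz]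
  add_mem' := by
    intro f g hf hg
    refine (hf.add hg).congr ?_
    intro z hz
    simp [ext0_apply' _ z hz]
  algebraMap_mem' := by
    intro r
    refine (contDiffOn_const (c := r)).congr ?_
    intro z hz
    simp [ext0_apply' _ z hz]

/-- functions in the algebra -/
abbrev S (U : Set E4) : Type := SA U

/-- the evaluation at a point -/
def ev {U : Set E4} (z : U) : S U →ₐ[ℝ] ℝ where
  toFun f := f.1 z
  map_one' := rfl
  map_mul' _ _ := rfl
  map_zero' := rfl
  map_add' _ _ := rfl
  commutes' _ := rfl

/-- extension of an element -/
def fx {U : Set E4} (f : S U) : E4 → ℝ := ext0 f.1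

lemma fx_apply {U : Set E4} (f : S U) (z : U) : fx f z.1 = ev z f := ext0_apply _ _

lemma fx_apply' {U : Set E4} (f : S U) (z : E4) (hz : z ∈ U) : fx f z = ev ⟨z, hz⟩ f :=
  ext0_apply' _ _ _

lemma fx_smooth {U : Set E4} (f : S U) : ContDiffOn ℝ ∞ (fx f) U := f.2

lemma S_ext {U : Set E4} {f g : S U} (h : ∀ z, ev z f = ev z g) : f = g :=
  Subtype.ext (funext h)

/-- make an element from a smooth function -/
def mkS {U : Set E4} (g : E4 → ℝ) (hg : ContDiffOn ℝ ∞ g U) : S U :=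
  ⟨fun z => g z.1, hg.congr (fun z hz => by rw [ext0_apply' _ z hz])⟩

lemma ev_mkS {U : Set E4} (g : E4 → ℝ) (hg : ContDiffOn ℝ ∞ g U) (z : U) :
    ev z (mkS g hg) = g z.1 := rfl

lemma fx_cda {U : Set E4} (hU : IsOpen U) (f : S U) (z : U) : ContDiffAt ℝ ∞ (fx f) z.1 :=
  (fx_smooth f).contDiffAt (hU.mem_nhds z.2)

lemma fx_diff {U : Set E4} (hU : IsOpen U) (f : S U) (z : U) :
    DifferentiableAt ℝ (fx f) z.1 :=
  (fx_cda hU f z).differentiableAt (by simp)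

lemma fderiv_smooth {U : Set E4} (hU : IsOpen U) {g : E4 → ℝ} (hg : ContDiffOn ℝ ∞ g U) (a : E4) :
    ContDiffOn ℝ ∞ (fun z => fderiv ℝ g z a) U :=
  (hg.fderiv_of_isOpen hU (by simp)).clm_apply contDiffOn_const

/-- an open set bundled -/
abbrev OP := TopologicalSpace.Opens E4

variable {U : Set E4} (hU : IsOpen U)

lemma eqOn_fderiv (hU : IsOpen U) {f g : E4 → ℝ} (h : Set.EqOn f g U) (z : U) :
    fderiv ℝ f z.1 = fderiv ℝ g z.1 :=
  Filter.EventuallyEq.fderiv_eq (h.eventuallyEq_of_mem (hU.mem_nhds z.2))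

/-- directional derivative -/
def dS (hU : IsOpen U) (a : E4) : Derivation ℝ (S U) (S U) :=
  Derivation.mk'
    { toFun := fun f => mkS (fun z => fderiv ℝ (fx f) z a) (fderiv_smooth hU (fx_smooth f) a)
      map_add' := by
        intro f g
        apply S_ext
        intro z
        rw [map_add, ev_mkS, ev_mkS, ev_mkS]
        have : Set.EqOn (fx (f+g)) (fx f + fx g) U := by
          intro y hy
          simp [fx_apply' _ y hy]
        rw [eqOn_fderiv hU this, fderiv_add (fx_diff hU f z) (fx_diff hU g z)]
        simp
      map_smul' := by
        intro c f
        apply S_ext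
        intro z
        rw [ev_mkS, map_smul, RingHom.id_apply, ev_mkS]
        have : Set.EqOn (fx (c • f)) (c • fx f) U := by
          intro y hy
          simp [fx_apply' _ y hy]
        rw [eqOn_fderiv hU this, fderiv_const_smul (fx_diff hU f z)]
        simp }
    (by
      intro f g
      apply S_ext
      intro z
      have : Set.EqOn (fx (f * g)) (fun y => fx f y * fx g y) U := by
        intro y hy
        simp [fx_apply' _ y hy]
      simp only [LinearMap.coe_mk, AddHom.coe_mk, smul_eq_mul, map_add, map_mul]
      rw [ev_mkS, ev_mkS, ev_mkS, eqOn_fderiv hU this, fderiv_fun_mul (fx_diff hU f z) (fx_diff hU g z)]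
      simp [fx_apply])

lemma ev_dS (a : E4) (f : S U) (z : U) : ev z (dS hU a f) = fderiv ℝ (fx f) z.1 a := rfl

lemma ev_dS_mkS (a : E4) (g : E4 → ℝ) (hg : ContDiffOn ℝ ∞ g U) (z : U) :
    ev z (dS hU a (mkS g hg)) = fderiv ℝ g z.1 a := by
  rw [ev_dS]
  congr 1
  apply eqOn_fderiv hU
  intro y hy
  rw [fx_apply' _ y hy, ev_mkS]

lemma dS_comm (a b : E4) (f : S U) : dS hU a (dS hU b f) = dS hU b (dS hU a f) := by
  apply S_ext
  intro z
  have h1 : ∀ a b : E4, ev z (dS hU a (dS hU b f)) = fderiv ℝ (fderiv ℝ (fx f)) z.1 a b := by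
    intro a b
    rw [ev_dS]
    have : Set.EqOn (fx (dS hU b f)) (fun y => fderiv ℝ (fx f) y b) U := by
      intro y hy
      rw [fx_apply' _ y hy, ev_dS]
    rw [eqOn_fderiv hU this]
    have hd : DifferentiableAt ℝ (fderiv ℝ (fx f)) z.1 :=
      ((fx_cda hU f z).fderiv_right (m := ∞) (by simp)).differentiableAt (by simp)
    rw [fderiv_clm_apply hd (differentiableAt_const b)]
    simp
  rw [h1, h1]
  exact ((fx_cda hU f z).isSymmSndFDerivAt (by simpa using two_le_inf)).eq a b

/-- exponential -/
def expS (f : S U) : S U := mkS (fun z => Real.exp (fx f z)) (fx_smooth f).exp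

lemma ev_expS (f : S U) (z : U) : ev z (expS f) = Real.exp (ev z f) := by
  rw [expS, ev_mkS, fx_apply]

lemma dS_expS (a : E4) (f : S U) : dS hU a (expS f) = expS f * dS hU a f := by
  apply S_ext
  intro z
  rw [expS, ev_dS_mkS, map_mul, ev_mkS, ev_dS, fderiv_exp (fx_diff hU f z)]
  simp

/-- logarithm -/
def logS (f : S U) (hf : ∀ z, 0 < ev z f) : S U :=
  mkS (fun z => Real.log (fx f z)) ((fx_smooth f).log (fun z hz => by
    rw [fx_apply' _ z hz]; exact (hf _).ne'))

lemma ev_logS (f : S U) (hf : ∀ z, 0 < ev z f) (z : U) :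
    ev z (logS f hf) = Real.log (ev z f) := by
  rw [logS, ev_mkS, fx_apply]

lemma expS_logS (f : S U) (hf : ∀ z, 0 < ev z f) : expS (logS f hf) = f := by
  apply S_ext
  intro z
  rw [ev_expS, ev_logS, Real.exp_log (hf z)]

lemma expS_add (f g : S U) : expS (f + g) = expS f * expS g := by
  apply S_ext
  intro z
  simp [ev_expS, Real.exp_add]

lemma expS_zero : expS (0 : S U) = 1 := by
  apply S_ext
  intro z
  simp [ev_expS]

lemma expS_neg_mul (f : S U) : expS (-f) * expS f = 1 := by
  rw [← expS_add]; simp [expS_zero]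

/-- spatial coordinate -/
def xS (i : Fin 3) : S U := mkS (fun z => z.1 i) (by fun_prop)
/-- time coordinate -/
def sS : S U := mkS (fun z => z.2) (by fun_prop)

/-- spatial directions -/
def bx (i : Fin 3) : E4 := (Pi.single i 1, 0)
/-- time direction -/
def bt : E4 := (0, 1)

lemma ev_xS (i : Fin 3) (z : U) : ev z (xS i) = z.1.1 i := rfl
lemma ev_sS (z : U) : ev z sS = z.1.2 := rfl

lemma dS_xS (a : E4) (i : Fin 3) : dS hU a (xS i) = algebraMap ℝ (S U) (a.1 i) := by
  apply S_ext
  intro z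
  rw [xS, ev_dS_mkS, AlgHom.commutes]
  have : HasFDerivAt (fun z : E4 => z.1 i)
      ((ContinuousLinearMap.proj i).comp (ContinuousLinearMap.fst ℝ V3 ℝ)) z.1 :=
    ((ContinuousLinearMap.proj i).comp (ContinuousLinearMap.fst ℝ V3 ℝ)).hasFDerivAt
  rw [this.fderiv]
  simp

lemma dS_sS (a : E4) : dS hU a sS = algebraMap ℝ (S U) a.2 := by
  apply S_ext
  intro z
  rw [sS, ev_dS_mkS, AlgHom.commutes]
  have : HasFDerivAt (fun z : E4 => z.2) (ContinuousLinearMap.snd ℝ V3 ℝ) z.1 :=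
    (ContinuousLinearMap.snd ℝ V3 ℝ).hasFDerivAt
  rw [this.fderiv]
  simp

end


open Real Filter Topology
open scoped ContDiff

noncomputable section

variable {U : Set E4} (hU : IsOpen U)

/-- first touching time -/
lemma touch (G : E4 → ℝ) (K : Set V3) (hK : IsCompact K) (s0 : ℝ)
    (hG : ContinuousOn G (K ×ˢ Set.Ici s0))
    (h0 : ∀ x ∈ K, G (x, s0) < 0)
    (hno : ∀ x ∈ K, ∀ s, s0 < s → G (x, s) = 0 →
      (∀ y ∈ K, ∀ s', s0 ≤ s' → s' ≤ s → G (y, s') ≤ 0) → False) :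
    ∀ x ∈ K, ∀ s, s0 ≤ s → G (x, s) < 0 := by
  intro x1 hx1 s1 hs1
  by_contra hcon
  push Not at hcon
  set C : Set E4 := (K ×ˢ Set.Icc s0 s1) ∩ G ⁻¹' Set.Ici 0 with hC
  have hKc : IsCompact (K ×ˢ Set.Icc s0 s1) := hK.prod isCompact_Icc
  have hGc : ContinuousOn G (K ×ˢ Set.Icc s0 s1) :=
    hG.mono (Set.prod_mono le_rfl Set.Icc_subset_Ici_self)
  have hCc : IsCompact C := by
    apply hKc.of_isClosed_subset _ Set.inter_subset_left
    exact hGc.preimage_isClosed_of_isClosed hKc.isClosed isClosed_Ici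
  have hne : C.Nonempty := ⟨(x1, s1), ⟨⟨hx1, ⟨hs1, le_rfl⟩⟩, hcon⟩⟩
  obtain ⟨⟨x, s⟩, hxs, hmin⟩ := hCc.exists_isMinOn hne continuous_snd.continuousOn
  obtain ⟨⟨hxK, hs0, hs1'⟩, hGxs⟩ := hxs
  simp only at hxK hs0 hs1'
  have hGxs' : 0 ≤ G (x, s) := hGxs
  have hlt : ∀ y ∈ K, ∀ s', s0 ≤ s' → s' < s → G (y, s') < 0 := by
    intro y hy s' h1 h2
    by_contra h3
    push Not at h3
    have : s ≤ s' := hmin (show (y, s') ∈ C from ⟨⟨hy, ⟨h1, (h2.le.trans hs1')⟩⟩, h3⟩)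
    linarith
  have hss : s0 < s := by
    rcases hs0.lt_or_eq with h | h
    · exact h
    · exfalso
      have := h0 x hxK
      rw [h] at this
      linarith
  have hle : ∀ y ∈ K, G (y, s) ≤ 0 := by
    intro y hy
    have hcont : ContinuousWithinAt (fun t => G (y, t)) (Set.Icc s0 s) s := by
      have h1 : ContinuousOn (fun t => G (y, t)) (Set.Icc s0 s) := by
        apply hG.comp (by fun_prop)
        intro t ht
        exact ⟨hy, ht.1⟩
      exact h1 s ⟨hss.le, le_rfl⟩
    have h2 : ContinuousWithinAt (fun t => G (y, t)) (Set.Ico s0 s) s :=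
      hcont.mono Set.Ico_subset_Icc_self
    have h3 : (𝓝[Set.Ico s0 s] s).NeBot := by
      rw [← mem_closure_iff_nhdsWithin_neBot, closure_Ico hss.ne]
      exact ⟨hss.le, le_rfl⟩
    apply le_of_tendsto h2
    filter_upwards [self_mem_nhdsWithin] with t ht
    exact (hlt y hy t ht.1 ht.2).le
  refine hno x hxK s hss (le_antisymm (hle x hxK) hGxs') ?_
  intro y hy s' h1 h2
  rcases h2.lt_or_eq with h | h
  · exact (hlt y hy s' h1 h).le
  · rw [h]; exact hle y hy

/-- second derivative test -/
lemma second_test (φ : ℝ → ℝ) (hφ : ContDiffAt ℝ 2 φ 0) (hmax : IsLocalMax φ 0) :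
    deriv (deriv φ) 0 ≤ 0 := by
  by_contra h
  push Not at h
  have h1 : deriv φ 0 = 0 := hmax.deriv_eq_zero
  have h2 : IsLocalMin φ 0 := isLocalMin_of_deriv_deriv_pos h h1 hφ.continuousAt
  have h3 : φ =ᶠ[𝓝 0] fun _ => φ 0 := by
    filter_upwards [hmax, h2] with t h4 h5
    exact le_antisymm h4 h5
  have h4 : deriv φ =ᶠ[𝓝 0] deriv (fun _ => φ 0) := h3.deriv
  have h5 := h4.deriv_eq
  simp at h5
  linarith

lemma continuousOn_fx (g : S U) : ContinuousOn (fx g) U := (fx_smooth g).continuousOn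

lemma bx_sum (ξ : V3) : (ξ, (0:ℝ)) = ∑ i, ξ i • bx i := by
  ext j
  · simp [bx, Prod.fst_sum, Finset.sum_apply, Pi.single_apply]
  · simp [bx, Prod.snd_sum]

lemma touch_conditions (g : S U) (z : U) (hz : ev z g = 0)
    (hx : ∀ᶠ y in 𝓝 z.1.1, fx g (y, z.1.2) ≤ 0)
    (ht : ∀ᶠ s in 𝓝[<] z.1.2, fx g (z.1.1, s) ≤ 0) :
    (∀ i, ev z (dS hU (bx i) g) = 0) ∧ 0 ≤ ev z (dS hU bt g) ∧
      ∀ ξ : V3, ∑ i, ∑ j, ξ i * ξ j * ev z (dS hU (bx i) (dS hU (bx j) g)) ≤ 0 := by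
  have hz' : fx g z.1 = 0 := by rw [fx_apply, hz]
  -- along a line
  have hline : ∀ ξ : V3, IsLocalMax (fun t : ℝ => fx g (z.1 + t • (ξ, (0:ℝ)))) 0 := by
    intro ξ
    have hc : Tendsto (fun t : ℝ => z.1.1 + t • ξ) (𝓝 0) (𝓝 z.1.1) := by
      have : Continuous (fun t : ℝ => z.1.1 + t • ξ) := by fun_prop
      have := this.tendsto 0
      simpa using this
    filter_upwards [hc.eventually hx] with t h
    have e1 : z.1 + t • (ξ, (0:ℝ)) = (z.1.1 + t • ξ, z.1.2) := by
      ext <;> simp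
    rw [e1]
    simpa [hz'] using h
  have hnear : ∀ a : E4, ∀ᶠ t in 𝓝 (0:ℝ), z.1 + t • a ∈ U := by
    intro a
    have : Continuous (fun t : ℝ => z.1 + t • a) := by fun_prop
    have h := this.tendsto 0
    simp only [zero_smul, add_zero] at h
    exact h.eventually (hU.mem_nhds z.2)
  have hder : ∀ (f : S U) (a : E4) (t : ℝ) (ht : z.1 + t • a ∈ U),
      HasDerivAt (fun t : ℝ => fx f (z.1 + t • a)) (fderiv ℝ (fx f) (z.1 + t • a) a) t := by
    intro f a t ht
    have h1 := (fx_diff hU f ⟨_, ht⟩).hasFDerivAt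
    have h2 : HasDerivAt (fun t : ℝ => z.1 + t • a) a t := by
      simpa using ((hasDerivAt_id t).smul_const a).const_add z.1
    exact h1.comp_hasDerivAt t h2
  have hd : ∀ (f : S U) (a : E4), deriv (fun t : ℝ => fx f (z.1 + t • a)) 0 = ev z (dS hU a f) := by
    intro f a
    have := (hder f a 0 (by simpa using z.2)).deriv
    rw [this, ev_dS]; simp
  refine ⟨?_, ?_, ?_⟩
  · intro i
    have := (hline (Pi.single i 1)).deriv_eq_zero
    rw [hd] at this
    exact this
  · have h1 := (hder g bt 0 (by simpa using z.2))
    have h2 : HasDerivAt (fun t : ℝ => fx g (z.1 + t • bt)) (ev z (dS hU bt g)) 0 := by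
      simpa [ev_dS] using h1
    have h3 := h2.hasDerivWithinAt (s := Set.Iio 0)
    rw [hasDerivWithinAt_iff_tendsto_slope' (by simp)] at h3
    refine ge_of_tendsto h3 ?_
    have hc : Tendsto (fun t : ℝ => z.1.2 + t) (𝓝[<] 0) (𝓝[<] z.1.2) := by
      apply tendsto_nhdsWithin_iff.2
      constructor
      · have : Continuous (fun t : ℝ => z.1.2 + t) := by fun_prop
        have := this.tendsto 0
        rw [add_zero] at this
        exact this.mono_left nhdsWithin_le_nhds
      · filter_upwards [self_mem_nhdsWithin] with t ht
        simpa using ht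
    filter_upwards [hc.eventually ht, self_mem_nhdsWithin] with t h4 h5
    have e1 : z.1 + t • bt = (z.1.1, z.1.2 + t) := by
      ext <;> simp [bt]
    rw [slope_def_field]
    simp only [zero_smul, add_zero, hz', sub_zero]
    rw [e1]
    exact div_nonneg_of_nonpos h4 (le_of_lt h5)
  · intro ξ
    have h1 := second_test _ ?_ (hline ξ)
    · have h2 : deriv (fun t : ℝ => fx g (z.1 + t • (ξ, (0:ℝ)))) =ᶠ[𝓝 0]
          fun t => fx (dS hU (ξ, (0:ℝ)) g) (z.1 + t • (ξ, (0:ℝ))) := by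
        filter_upwards [hnear (ξ, (0:ℝ))] with t ht
        rw [(hder g _ t ht).deriv, fx_apply' _ _ ht, ev_dS]
      rw [h2.deriv_eq, hd] at h1
      have hlin : ∀ (f : S U), dS hU (ξ, (0:ℝ)) f = ∑ i, ξ i • dS hU (bx i) f := by
        intro f
        apply S_ext
        intro y
        rw [ev_dS, map_sum, bx_sum, map_sum]
        simp [ev_dS]
      rw [hlin, hlin, map_sum] at h1
      refine le_trans (le_of_eq ?_) h1
      apply Finset.sum_congr rfl
      intro i _
      rw [map_sum, map_smul, map_sum]
      rw [smul_eq_mul, Finset.mul_sum]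
      apply Finset.sum_congr rfl
      intro j _
      rw [Derivation.map_smul, map_smul, smul_eq_mul]
      ring
    · have := fx_cda hU g z
      have h3 : ContDiffAt ℝ ∞ (fun t : ℝ => fx g (z.1 + t • (ξ, (0:ℝ)))) 0 := by
        apply ContDiffAt.comp (g := fx g)
        · simpa using this
        · fun_prop
      exact h3.of_le two_le_inf

/-- Euclidean square distance -/
def sqd (y x : V3) : ℝ := ∑ i, (x i - y i) ^ 2

lemma sqd_cont (y : V3) : Continuous (sqd y) := by unfold sqd; fun_prop

lemma sqd_compact (y : V3) (r : ℝ) : IsCompact {x | sqd y x ≤ r} := by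
  apply Metric.isCompact_of_isClosed_isBounded
  · exact isClosed_le (sqd_cont y) continuous_const
  · rw [isBounded_iff_forall_norm_le]
    refine ⟨‖y‖ + (|r| + 1), fun x hx => ?_⟩
    have h1 : ‖x - y‖ ≤ |r| + 1 := by
      rw [pi_norm_le_iff_of_nonneg (by positivity)]
      intro i
      have h2 : (x i - y i)^2 ≤ r := by
        refine le_trans ?_ hx
        exact Finset.single_le_sum (f := fun i => (x i - y i)^2) (fun _ _ => sq_nonneg _) (Finset.mem_univ i)
      rw [Real.norm_eq_abs]
      have h3 : |x i - y i|^2 ≤ |r| := by rw [sq_abs]; exact h2.trans (le_abs_self r)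
      simp only [Pi.sub_apply]
      nlinarith [abs_nonneg (x i - y i), abs_nonneg r]
    calc ‖x‖ = ‖(x - y) + y‖ := by simp
      _ ≤ ‖x - y‖ + ‖y‖ := norm_add_le _ _
      _ ≤ _ := by linarith

/-- the conditions at a touching point -/
def TouchC (g : S U) (z : U) : Prop :=
  (∀ i, ev z (dS hU (bx i) g) = 0) ∧ 0 ≤ ev z (dS hU bt g) ∧
      ∀ ξ : V3, ∑ i, ∑ j, ξ i * ξ j * ev z (dS hU (bx i) (dS hU (bx j) g)) ≤ 0

/-- the maximum principle on a cylinder -/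
lemma maxP (g : S U) (y : V3) (r s0 : ℝ)
    (hcyl : ∀ x s, sqd y x ≤ r → s0 ≤ s → (x, s) ∈ U)
    (h0 : ∀ z : U, sqd y z.1.1 ≤ r → z.1.2 = s0 → ev z g < 0)
    (hb : ∀ z : U, sqd y z.1.1 = r → s0 ≤ z.1.2 → ev z g < 0)
    (hi : ∀ z : U, sqd y z.1.1 < r → s0 < z.1.2 → ev z g = 0 → TouchC hU g z → False) :
    ∀ z : U, sqd y z.1.1 ≤ r → s0 ≤ z.1.2 → ev z g < 0 := by
  have key := touch (fx g) {x | sqd y x ≤ r} (sqd_compact y r) s0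
    ((continuousOn_fx g).mono (fun p hp => hcyl p.1 p.2 hp.1 hp.2))
    (fun x hx => by
      rw [fx_apply' _ _ (hcyl x s0 hx le_rfl)]
      exact h0 _ hx rfl)
    (fun x hx s hs hG hall => by
      have hm := hcyl x s hx hs.le
      rw [fx_apply' _ _ hm] at hG
      rcases (show sqd y x ≤ r from hx).lt_or_eq with h | h
      · refine hi ⟨_, hm⟩ h hs hG (touch_conditions hU g ⟨_, hm⟩ hG ?_ ?_)
        · have : ∀ᶠ x' in 𝓝 x, sqd y x' < r :=
            (sqd_cont y).continuousAt.eventually (gt_mem_nhds h)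
          filter_upwards [this] with x' hx'
          exact hall x' hx'.le s hs.le le_rfl
        · filter_upwards [Ioo_mem_nhdsLT hs] with t ht
          exact hall x hx t ht.1.le ht.2.le
      · have := hb ⟨_, hm⟩ h hs.le
        linarith)
  intro z hz hs
  have := key z.1.1 hz z.1.2 hs
  rwa [Prod.mk.eta, fx_apply] at this

/-- boundedness on compact slices -/
lemma slice_bdd (g : S U) (y : V3) (r s0 : ℝ) (hcyl : ∀ x, sqd y x ≤ r → (x, s0) ∈ U) :
    ∃ C, 0 < C ∧ ∀ z : U, sqd y z.1.1 ≤ r → z.1.2 = s0 → |ev z g| ≤ C := by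
  have hc : ContinuousOn (fun x => fx g (x, s0)) {x | sqd y x ≤ r} :=
    (continuousOn_fx g).comp (by fun_prop) (fun x hx => hcyl x hx)
  obtain ⟨C, hC⟩ := (sqd_compact y r).exists_bound_of_continuousOn hc
  refine ⟨|C| + 1, by positivity, fun z hz hs => ?_⟩
  have := hC z.1.1 hz
  rw [← hs, Prod.mk.eta, fx_apply, Real.norm_eq_abs] at this
  linarith [le_abs_self C]

end


open Real Filter Topology
open scoped ContDiff

noncomputable section

section alg
variable {A : Type*} [CommRing A] [Algebra ℝ A]

/-- Kronecker delta in a ring -/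
def kA (A : Type*) [CommRing A] (i j : Fin 3) : A := if i = j then 1 else 0

variable (d : Fin 3 → Derivation ℝ A A) (dt : Derivation ℝ A A)

/-- parabolic operator -/
def PP (h : Fin 3 → Fin 3 → A) (f : A) : A := dt f - ∑ i, ∑ j, h i j * d i (d j f)

/-- quadratic form of gradients -/
def hp (h : Fin 3 → Fin 3 → A) (f g : A) : A := ∑ i, ∑ j, h i j * d i f * d j g

/-- the coefficients -/
def aa (τ W : A) (i j : Fin 3) : A := kA A i j + W * d i τ * d j τ

/-- the coefficients -/
def hh (τ W : A) (i j : Fin 3) : A := τ ^ 2 * aa d τ W i j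

/-- squared gradient -/
def qq (τ : A) : A := ∑ k, d k τ ^ 2

lemma hh_symm (τ W : A) (i j : Fin 3) : hh d τ W i j = hh d τ W j i := by
  unfold hh aa kA
  by_cases h : i = j
  · subst h; ring
  · rw [if_neg h, if_neg (Ne.symm h)]; ring

lemma PP_mul (h : Fin 3 → Fin 3 → A) (hs : ∀ i j, h i j = h j i) (f g : A) :
    PP d dt h (f * g) = f * PP d dt h g + g * PP d dt h f - 2 * hp d h f g := by
  simp only [PP, hp, Fin.sum_univ_three, Derivation.leibniz, map_add, smul_eq_mul]
  rw [hs 1 0, hs 2 0, hs 2 1]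
  ring

lemma PP_add (h : Fin 3 → Fin 3 → A) (f g : A) :
    PP d dt h (f + g) = PP d dt h f + PP d dt h g := by
  simp only [PP, Fin.sum_univ_three, map_add]
  ring

lemma PP_sub (h : Fin 3 → Fin 3 → A) (f g : A) :
    PP d dt h (f - g) = PP d dt h f - PP d dt h g := by
  simp only [PP, Fin.sum_univ_three, map_sub]
  ring

lemma PP_const (h : Fin 3 → Fin 3 → A) (c : ℝ) :
    PP d dt h (algebraMap ℝ A c) = 0 := by
  simp only [PP, Derivation.map_algebraMap, map_zero, mul_zero, Finset.sum_const_zero, sub_zero]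

lemma PP_smul (h : Fin 3 → Fin 3 → A) (c : ℝ) (f : A) :
    PP d dt h (c • f) = c • PP d dt h f := by
  simp only [PP, Fin.sum_univ_three, Derivation.map_smul, smul_sub, smul_add, mul_smul_comm]

lemma PP_sum {ι : Type*} (s : Finset ι) (h : Fin 3 → Fin 3 → A) (f : ι → A) :
    PP d dt h (∑ i ∈ s, f i) = ∑ i ∈ s, PP d dt h (f i) := by
  classical
  induction s using Finset.induction_on with
  | empty => simp [PP]
  | insert a s ha ih => rw [Finset.sum_insert ha, Finset.sum_insert ha, PP_add, ih]

/-- a spatially constant function -/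
lemma PP_time (h : Fin 3 → Fin 3 → A) (f : A) (hf : ∀ i, d i f = 0) :
    PP d dt h f = dt f := by
  simp only [PP, hf, map_zero, mul_zero, Finset.sum_const_zero, sub_zero]

lemma hp_time (h : Fin 3 → Fin 3 → A) (f g : A) (hf : ∀ i, d i f = 0) :
    hp d h f g = 0 := by
  simp [hp, hf]

lemma PP_exp (h : Fin 3 → Fin 3 → A) (Y m : A) (h1 : ∀ i, d i Y = Y * d i m)
    (h2 : dt Y = Y * dt m) : PP d dt h Y = Y * (PP d dt h m - hp d h m m) := by
  simp only [PP, hp, Fin.sum_univ_three, h1, h2, Derivation.leibniz, smul_eq_mul]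
  ring

lemma hp_tau (τ W : A) (hW : W * (1 - qq d τ) = 1) :
    hp d (hh d τ W) τ τ = τ ^ 2 * (W - 1) := by
  have h1 : hp d (hh d τ W) τ τ = τ ^ 2 * (qq d τ + W * qq d τ ^ 2) := by
    simp only [hp, hh, aa, kA, qq, Fin.sum_univ_three]
    simp
    ring
  rw [h1]
  have : W * qq d τ = W - 1 := by linear_combination -hW
  linear_combination τ ^ 2 * (1 + qq d τ) * this

lemma PP_sq_x (τ W : A) (hW : W * (1 - qq d τ) = 1) (x : Fin 3 → A) (y : V3)
    (hx : ∀ i j, d i (x j) = kA A i j) (hxt : ∀ j, dt (x j) = 0) :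
    PP d dt (hh d τ W) (∑ i, (x i - algebraMap ℝ A (y i)) ^ 2) = -2 * τ ^ 2 * (2 + W) := by
  have h1 : PP d dt (hh d τ W) (∑ i, (x i - algebraMap ℝ A (y i)) ^ 2)
     = -2 * τ ^ 2 * (3 + W * qq d τ) := by
    simp only [PP, hh, aa, qq, Fin.sum_univ_three, pow_two, Derivation.leibniz, map_add, map_sub,
      hx, hxt, smul_eq_mul, Derivation.map_algebraMap]
    simp only [kA]
    simp
    ring
  rw [h1]
  linear_combination -2 * τ^2 * (-hW)

lemma PP_eta (τ W : A) (hW : W * (1 - qq d τ) = 1) (x : Fin 3 → A) (y : V3)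
    (hx : ∀ i j, d i (x j) = kA A i j) (hxt : ∀ j, dt (x j) = 0)
    (hτ : PP d dt (hh d τ W) τ = -3 * τ) :
    PP d dt (hh d τ W) (τ ^ 2 - ∑ i, (x i - algebraMap ℝ A (y i)) ^ 2) = 0 := by
  rw [PP_sub, PP_sq_x d dt τ W hW x y hx hxt, pow_two, PP_mul d dt _ (hh_symm d τ W), hτ,
    hp_tau d τ W hW]
  ring

/-- vector b -/
def bb (τ : A) (i : Fin 3) : A := ∑ k, d k τ * d i (d k τ)

/-- Hessian norm Q -/
def QQ (τ W : A) : A := ∑ i, ∑ j, ∑ k, aa d τ W i j * d i (d k τ) * d j (d k τ)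

/-- trace -/
def trA (τ W : A) : A := ∑ i, ∑ j, aa d τ W i j * d i (d j τ)

/-- a(b,b) -/
def abb (τ W : A) : A := ∑ i, ∑ j, aa d τ W i j * bb d τ i * bb d τ j

lemma sum_dh (hc : ∀ i j f, d i (d j f) = d j (d i f)) (τ W : A) (hWd : ∀ i, d i W = 2 * W ^ 2 * bb d τ i) :
    ∑ k, d k τ * ∑ i, ∑ j, d k (hh d τ W i j) * d i (d j τ)
      = 2 * qq d τ * τ * trA d τ W + 2 * τ ^ 2 * W * abb d τ W := by
  have h1 : ∀ k i j, d k (hh d τ W i j) = 2 * τ * d k τ * aa d τ W i j +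
      τ ^ 2 * (2 * W ^ 2 * bb d τ k * d i τ * d j τ + W * (d k (d i τ) * d j τ + d i τ * d k (d j τ))) := by
    intro k i j
    have : d k (kA A i j) = 0 := by unfold kA; split <;> simp
    simp only [hh, aa, Derivation.leibniz, pow_two, map_add, this, hWd, smul_eq_mul]
    ring
  simp only [h1]
  simp only [aa, qq, trA, abb, bb, Fin.sum_univ_three, hc 1 0 τ, hc 2 0 τ, hc 2 1 τ]
  simp only [kA]
  simp only [Fin.isValue, ↓reduceIte, zero_ne_one, one_ne_zero, Fin.reduceEq]
  generalize d 0 (d 0 τ) = t00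
  generalize d 0 (d 1 τ) = t01
  generalize d 0 (d 2 τ) = t02
  generalize d 1 (d 1 τ) = t11
  generalize d 1 (d 2 τ) = t12
  generalize d 2 (d 2 τ) = t22
  generalize d 0 τ = p0
  generalize d 1 τ = p1
  generalize d 2 τ = p2
  ring

lemma PP_l (hc : ∀ i j f, d i (d j f) = d j (d i f))
    (hct : ∀ i f, dt (d i f) = d i (dt f)) (τ W l : A)
    (hτ : PP d dt (hh d τ W) τ = -3 * τ)
    (hWd : ∀ i, d i W = 2 * W ^ 2 * bb d τ i)
    (hl : ∀ i, d i l = W * bb d τ i) (hlt : dt l = W * ∑ k, d k τ * dt (d k τ)) :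
    PP d dt (hh d τ W) l =
      W * (2 * qq d τ * τ * trA d τ W - 3 * qq d τ - τ ^ 2 * QQ d τ W) := by
  have e1 : dt τ = (∑ i, ∑ j, hh d τ W i j * d i (d j τ)) - 3 * τ := by
    have := hτ
    unfold PP at this
    linear_combination this
  have e2 : ∀ k, dt (d k τ) = (∑ i, ∑ j, d k (hh d τ W i j) * d i (d j τ)) +
      (∑ i, ∑ j, hh d τ W i j * d k (d i (d j τ))) - 3 * d k τ := by
    intro k
    rw [hct, e1]
    have : d k (3:A) = 0 := by
      have := Derivation.map_natCast (d k) 3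
      exact_mod_cast this
    simp only [map_sub, map_sum, Derivation.leibniz, smul_eq_mul, this, Finset.sum_add_distrib]
    have : ∀ i j, d i (d j τ) * d k (hh d τ W i j) = d k (hh d τ W i j) * d i (d j τ) :=
      fun i j => mul_comm _ _
    simp only [this]
    ring
  have e3 : dt l = W * (2 * qq d τ * τ * trA d τ W + 2 * τ ^ 2 * W * abb d τ W) +
      W * (∑ k, d k τ * ∑ i, ∑ j, hh d τ W i j * d k (d i (d j τ))) - 3 * W * qq d τ := by
    rw [hlt, ← sum_dh d hc τ W hWd]
    simp only [e2, qq, Fin.sum_univ_three]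
    ring
  have e4 : ∀ i j, d i (d j l) = 2 * W ^ 2 * bb d τ i * bb d τ j +
      W * (∑ k, d i (d k τ) * d j (d k τ) + ∑ k, d k τ * d k (d i (d j τ))) := by
    intro i j
    have : ∀ k, d k (d i (d j τ)) = d i (d j (d k τ)) := by
      intro k
      rw [hc k i, hc k j]
    rw [hl, Derivation.leibniz, hWd]
    simp only [this]
    simp only [bb, Fin.sum_univ_three, map_add, Derivation.leibniz, smul_eq_mul]
    ring
  have e5 : ∑ i, ∑ j, hh d τ W i j * d i (d j l) = 2 * W ^ 2 * τ ^ 2 * abb d τ W +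
      W * τ ^ 2 * QQ d τ W + W * (∑ k, d k τ * ∑ i, ∑ j, hh d τ W i j * d k (d i (d j τ))) := by
    simp only [e4]
    simp only [abb, QQ, hh, Fin.sum_univ_three]
    ring
  unfold PP
  rw [e3, e5]
  ring

lemma hp_l (τ W l : A) (hl : ∀ i, d i l = W * bb d τ i) :
    hp d (hh d τ W) l l = τ ^ 2 * W ^ 2 * abb d τ W := by
  simp only [hp, hl, abb, hh, Fin.sum_univ_three]
  ring

end alg

end


open Real Filter Topology
open scoped ContDiff

noncomputable section

section linalg
open Matrix

lemma linalg (p : V3) (t : Matrix (Fin 3) (Fin 3) ℝ) (ht : tᵀ = t) (v τ : ℝ) (hv0 : 0 < v)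
    (hv : v ^ 2 * (1 - p ⬝ᵥ p) = 1) :
    ∃ N : Matrix (Fin 3) (Fin 3) ℝ, Nᵀ = N ∧
      N.trace = 3 - τ * ((1 + v ^ 2 • vecMulVec p p) * t).trace ∧
      (N * N).trace = 3 - 2 * τ * ((1 + v ^ 2 • vecMulVec p p) * t).trace +
        τ ^ 2 * ((1 + v ^ 2 • vecMulVec p p) * t * ((1 + v ^ 2 • vecMulVec p p) * t)).trace ∧
      v ^ 2 * ((N *ᵥ p) ⬝ᵥ (N *ᵥ p)) =
        (p - (τ * v ^ 2) • (t *ᵥ p)) ⬝ᵥ ((1 + v ^ 2 • vecMulVec p p) *ᵥ (p - (τ * v ^ 2) • (t *ᵥ p))) := by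
  set P := vecMulVec p p with hP
  set κ := v ^ 2 / (1 + v) with hκ
  have hPt : Pᵀ = P := by
    ext i j; simp [hP, vecMulVec_apply, mul_comm]
  have hPP : P * P = (p ⬝ᵥ p) • P := by
    rw [hP, vecMulVec_mul_vecMulVec]
    ext i j; simp [vecMulVec_apply]; ring
  have hPp : P *ᵥ p = (p ⬝ᵥ p) • p := by
    ext i; simp [hP, mulVec, dotProduct, vecMulVec_apply, Fin.sum_univ_three]; ring
  set L := (1 : Matrix (Fin 3) (Fin 3) ℝ) + κ • P with hL
  have hLt : Lᵀ = L := by simp [hL, hPt]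
  have h1v : (1 + v) ≠ 0 := by positivity
  have hq : p ⬝ᵥ p = 1 - 1 / v ^ 2 := by field_simp; linarith
  have hLL : L * L = 1 + v ^ 2 • P := by
    have : L * L = 1 + (2 * κ + κ ^ 2 * (p ⬝ᵥ p)) • P := by
      rw [hL]; simp only [add_mul, mul_add, one_mul, mul_one, smul_mul_assoc, mul_smul_comm, hPP, smul_smul]
      module
    rw [this]
    congr 2
    rw [hq, hκ]; field_simp; ring
  have hLp : L *ᵥ p = v • p := by
    rw [hL, add_mulVec, one_mulVec, smul_mulVec, hPp, smul_smul]
    have : κ * (p ⬝ᵥ p) = v - 1 := by rw [hq, hκ]; field_simp; ring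
    rw [this]; module
  refine ⟨1 - τ • (L * t * L), ?_, ?_, ?_, ?_⟩
  · simp [transpose_mul, hLt, ht, mul_assoc]
  · rw [trace_sub, trace_smul, mul_assoc, trace_mul_comm, mul_assoc, hLL, trace_mul_comm t]
    simp
  · have e : (L * t * L) * (L * t * L) = L * (t * ((L * L) * t * L)) := by noncomm_ring
    have e1 : ((L * t * L) * (L * t * L)).trace = (((1 + v ^ 2 • P) * t) * ((1 + v ^ 2 • P) * t)).trace := by
      rw [e, trace_mul_comm, ← hLL]
      have : t * (L * L * t * L) * L = t * ((L * L) * t * (L * L)) := by noncomm_ring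
      rw [this, trace_mul_comm t]
      congr 1; noncomm_ring
    have e2 : (L * t * L).trace = ((1 + v ^ 2 • P) * t).trace := by
      rw [mul_assoc, trace_mul_comm, mul_assoc, hLL, trace_mul_comm t]
    rw [← e1, ← e2]
    have : (1 - τ • (L * t * L)) * (1 - τ • (L * t * L)) = 1 - (2 * τ) • (L * t * L) +
      (τ ^ 2) • ((L * t * L) * (L * t * L)) := by
      simp only [sub_mul, mul_sub, one_mul, mul_one, smul_mul_assoc, mul_smul_comm]
      module
    rw [this, trace_add, trace_sub, trace_smul, trace_smul]
    simp
  · set y := p - (τ * v ^ 2) • (t *ᵥ p) with hy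
    have hN : v • ((1 - τ • (L * t * L)) *ᵥ p) = L *ᵥ y := by
      rw [sub_mulVec, one_mulVec, smul_mulVec, ← mulVec_mulVec, hLp, hy, mulVec_sub, hLp,
        mulVec_smul, mulVec_smul, ← mulVec_mulVec]
      module
    have : v ^ 2 * (((1 - τ • (L * t * L)) *ᵥ p) ⬝ᵥ ((1 - τ • (L * t * L)) *ᵥ p)) =
       (v • ((1 - τ • (L * t * L)) *ᵥ p)) ⬝ᵥ (v • ((1 - τ • (L * t * L)) *ᵥ p)) := by
      simp; ring
    rw [this, hN, ← hLL, ← mulVec_mulVec, dotProduct_mulVec y L, ← mulVec_transpose, hLt]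

/-- the first matrix inequality -/
lemma matineq1 (N : Matrix (Fin 3) (Fin 3) ℝ) (hN : Nᵀ = N) :
    N.trace ^ 2 ≤ 3 * (N * N).trace := by
  have h10 : N 1 0 = N 0 1 := congrFun (congrFun hN 0) 1
  have h20 : N 2 0 = N 0 2 := congrFun (congrFun hN 0) 2
  have h21 : N 2 1 = N 1 2 := congrFun (congrFun hN 1) 2
  simp only [trace, diag_apply, mul_apply, Fin.sum_univ_three, h10, h20, h21]
  nlinarith [sq_nonneg (N 0 0 - N 1 1), sq_nonneg (N 0 0 - N 2 2), sq_nonneg (N 1 1 - N 2 2),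
    sq_nonneg (N 0 1), sq_nonneg (N 0 2), sq_nonneg (N 1 2)]

lemma matineq_core (N00 N01 N02 N11 N12 N22 n0 n1 n2 x0 x1 x2 s t : ℝ)
    (r0 : N00 * n0 + N01 * n1 + N02 * n2 = x0)
    (r1 : N01 * n0 + N11 * n1 + N12 * n2 = x1)
    (r2 : N02 * n0 + N12 * n1 + N22 * n2 = x2)
    (hs' : n0 * x0 + n1 * x1 + n2 * x2 = s) (hn' : n0 * n0 + n1 * n1 + n2 * n2 = 1)
    (ht' : N00 + N11 + N22 = t) :
    2 * (x0 * x0 + x1 * x1 + x2 * x2) - s ^ 2 + (t - s) ^ 2 / 2 ≤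
      N00 ^ 2 + N11 ^ 2 + N22 ^ 2 + 2 * (N01 ^ 2 + N02 ^ 2 + N12 ^ 2) := by
  obtain ⟨c, hc⟩ : ∃ c, c = (t - s) / 2 := ⟨_, rfl⟩
  obtain ⟨e, he⟩ : ∃ e, e = s + c := ⟨_, rfl⟩
  have A : N00 * n0 * x0 + N11 * n1 * x1 + N22 * n2 * x2 + N01 * (n0 * x1 + n1 * x0)
     + N02 * (n0 * x2 + n2 * x0) + N12 * (n1 * x2 + n2 * x1) = x0 * x0 + x1 * x1 + x2 * x2 := by
    linear_combination x0 * r0 + x1 * r1 + x2 * r2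
  have B : N00 * n0 * n0 + N11 * n1 * n1 + N22 * n2 * n2 + 2 * N01 * (n0 * n1)
     + 2 * N02 * (n0 * n2) + 2 * N12 * (n1 * n2) = s := by
    linear_combination n0 * r0 + n1 * r1 + n2 * r2 + hs'
  have pos : 0 ≤ (N00 - 2 * n0 * x0 + e * n0 * n0 - c) ^ 2 + (N11 - 2 * n1 * x1 + e * n1 * n1 - c) ^ 2
    + (N22 - 2 * n2 * x2 + e * n2 * n2 - c) ^ 2 + 2 * ((N01 - n0 * x1 - x0 * n1 + e * n0 * n1) ^ 2 +
    (N02 - n0 * x2 - x0 * n2 + e * n0 * n2) ^ 2 + (N12 - n1 * x2 - x1 * n2 + e * n1 * n2) ^ 2) := by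
    positivity
  have exp' : (N00 - 2 * n0 * x0 + e * n0 * n0 - c) ^ 2 + (N11 - 2 * n1 * x1 + e * n1 * n1 - c) ^ 2
    + (N22 - 2 * n2 * x2 + e * n2 * n2 - c) ^ 2 + 2 * ((N01 - n0 * x1 - x0 * n1 + e * n0 * n1) ^ 2 +
    (N02 - n0 * x2 - x0 * n2 + e * n0 * n2) ^ 2 + (N12 - n1 * x2 - x1 * n2 + e * n1 * n2) ^ 2)
    = (N00 ^ 2 + N11 ^ 2 + N22 ^ 2 + 2 * (N01 ^ 2 + N02 ^ 2 + N12 ^ 2))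
     + 2 * (n0 * n0 + n1 * n1 + n2 * n2) * (x0 * x0 + x1 * x1 + x2 * x2)
     + 2 * (n0 * x0 + n1 * x1 + n2 * x2) ^ 2 + e ^ 2 * (n0 * n0 + n1 * n1 + n2 * n2) ^ 2 + 3 * c ^ 2
     - 4 * (N00 * n0 * x0 + N11 * n1 * x1 + N22 * n2 * x2 + N01 * (n0 * x1 + n1 * x0)
     + N02 * (n0 * x2 + n2 * x0) + N12 * (n1 * x2 + n2 * x1))
     + 2 * e * (N00 * n0 * n0 + N11 * n1 * n1 + N22 * n2 * n2 + 2 * N01 * (n0 * n1)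
     + 2 * N02 * (n0 * n2) + 2 * N12 * (n1 * n2)) - 2 * c * (N00 + N11 + N22)
     - 4 * e * (n0 * n0 + n1 * n1 + n2 * n2) * (n0 * x0 + n1 * x1 + n2 * x2)
     + 4 * c * (n0 * x0 + n1 * x1 + n2 * x2) - 2 * c * e * (n0 * n0 + n1 * n1 + n2 * n2) := by
    ring
  rw [exp', A, B, hn', hs', ht'] at pos
  subst he hc
  linear_combination pos

lemma matineq_unit (N : Matrix (Fin 3) (Fin 3) ℝ) (hN : Nᵀ = N) (n : V3) (hn : n ⬝ᵥ n = 1) :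
    2 * ((N *ᵥ n) ⬝ᵥ (N *ᵥ n)) - (n ⬝ᵥ (N *ᵥ n)) ^ 2 + (N.trace - n ⬝ᵥ (N *ᵥ n)) ^ 2 / 2 ≤ (N * N).trace := by
  have h10 : N 1 0 = N 0 1 := congrFun (congrFun hN 0) 1
  have h20 : N 2 0 = N 0 2 := congrFun (congrFun hN 0) 2
  have h21 : N 2 1 = N 1 2 := congrFun (congrFun hN 1) 2
  set r := N *ᵥ n with hr
  set s := n ⬝ᵥ r with hs
  set t := N.trace with htr
  have r0 : N 0 0 * n 0 + N 0 1 * n 1 + N 0 2 * n 2 = r 0 := by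
    rw [hr]; simp [mulVec, dotProduct, Fin.sum_univ_three]
  have r1 : N 0 1 * n 0 + N 1 1 * n 1 + N 1 2 * n 2 = r 1 := by
    rw [hr]; simp [mulVec, dotProduct, Fin.sum_univ_three, h10]
  have r2 : N 0 2 * n 0 + N 1 2 * n 1 + N 2 2 * n 2 = r 2 := by
    rw [hr]; simp [mulVec, dotProduct, Fin.sum_univ_three, h20, h21]
  have hs' : n 0 * r 0 + n 1 * r 1 + n 2 * r 2 = s := by
    rw [hs]; simp [dotProduct, Fin.sum_univ_three]
  have hn' : n 0 * n 0 + n 1 * n 1 + n 2 * n 2 = 1 := by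
    rw [← hn]; simp [dotProduct, Fin.sum_univ_three]
  have ht' : N 0 0 + N 1 1 + N 2 2 = t := by
    rw [htr]; simp [trace, Fin.sum_univ_three]
  have hrr : r ⬝ᵥ r = r 0 * r 0 + r 1 * r 1 + r 2 * r 2 := by
    simp [dotProduct, Fin.sum_univ_three]
  have hNN : (N * N).trace = N 0 0 ^ 2 + N 1 1 ^ 2 + N 2 2 ^ 2 + 2 * (N 0 1 ^ 2 + N 0 2 ^ 2 + N 1 2 ^ 2) := by
    simp only [trace, diag_apply, mul_apply, Fin.sum_univ_three, h10, h20, h21]; ring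
  rw [hrr, hNN]
  exact matineq_core _ _ _ _ _ _ _ _ _ _ _ _ s t r0 r1 r2 hs' hn' ht'

lemma matineq2 (N : Matrix (Fin 3) (Fin 3) ℝ) (hN : Nᵀ = N) (p : V3) (hp : p ⬝ᵥ p ≤ 1)
    (ε : ℝ) (h0 : 0 ≤ ε) (h1 : ε ≤ 1 / 4) :
    (1 + ε) * ((N *ᵥ p) ⬝ᵥ (N *ᵥ p)) ≤ (N * N).trace + 2 * ε * N.trace ^ 2 := by
  have hNN0 : 0 ≤ (N * N).trace := by
    have := matineq1 N hN; nlinarith [sq_nonneg N.trace]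
  have hpp : 0 ≤ p ⬝ᵥ p := by
    simp [dotProduct, Fin.sum_univ_three]; nlinarith [sq_nonneg (p 0), sq_nonneg (p 1), sq_nonneg (p 2)]
  rcases hpp.eq_or_lt with h | h
  · have : p = 0 := dotProduct_self_eq_zero.1 h.symm
    subst this
    simp
    positivity
  · set q := p ⬝ᵥ p with hq
    set c := Real.sqrt q with hc
    have hcpos : 0 < c := Real.sqrt_pos.2 h
    have hcq : c ^ 2 = q := Real.sq_sqrt h.le
    set n := c⁻¹ • p with hn
    have hpn : p = c • n := by rw [hn, smul_smul, mul_inv_cancel₀ hcpos.ne', one_smul]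
    have hnn : n ⬝ᵥ n = 1 := by
      rw [hn]; simp; rw [← hq, ← hcq]; field_simp
    have key := matineq_unit N hN n hnn
    have e1 : (N *ᵥ p) ⬝ᵥ (N *ᵥ p) = q * ((N *ᵥ n) ⬝ᵥ (N *ᵥ n)) := by
      rw [hpn, mulVec_smul]; simp; rw [← hcq]; ring
    rw [e1]
    have cs : (n ⬝ᵥ (N *ᵥ n)) ^ 2 ≤ (N *ᵥ n) ⬝ᵥ (N *ᵥ n) := by
      set r := N *ᵥ n
      have hnn' : n 0 * n 0 + n 1 * n 1 + n 2 * n 2 = 1 := by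
        rw [← hnn]; simp [dotProduct, Fin.sum_univ_three]
      simp only [dotProduct, Fin.sum_univ_three]
      have : 0 ≤ (n 0 * r 1 - n 1 * r 0) ^ 2 + (n 0 * r 2 - n 2 * r 0) ^ 2 + (n 1 * r 2 - n 2 * r 1) ^ 2 := by positivity
      linear_combination this + (r 0 * r 0 + r 1 * r 1 + r 2 * r 2) * hnn'
    set X := (N *ᵥ n) ⬝ᵥ (N *ᵥ n)
    set s := n ⬝ᵥ (N *ᵥ n)
    have hX : 0 ≤ X := le_trans (sq_nonneg _) cs
    have : q * X ≤ X := by nlinarith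
    have h2 : ε * s ^ 2 ≤ ε * (2 * N.trace ^ 2 + 2 * (N.trace - s) ^ 2) :=
      mul_le_mul_of_nonneg_left (by nlinarith [sq_nonneg (2 * N.trace - s)]) h0
    nlinarith [sq_nonneg (N.trace - s)]

end linalg

end


open Real Filter Topology
open scoped ContDiff

noncomputable section

/-- the domain -/
def UU : Set E4 := {p | (∑ i, p.1 i ^ 2) < 100 ∧ 0 < p.2}

lemma hUU : IsOpen UU := by
  apply IsOpen.inter
  · exact isOpen_lt (f := fun p : E4 => ∑ i, p.1 i ^ 2) (by fun_prop) continuous_const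
  · exact isOpen_lt continuous_const continuous_snd

/-- spatial derivations -/
abbrev DD : Fin 3 → Derivation ℝ (S UU) (S UU) := fun i => dS hUU (bx i)
/-- time derivation -/
abbrev DT : Derivation ℝ (S UU) (S UU) := dS hUU bt

/-- the data of a flow -/
structure DFlow (Λ : ℝ) where
  /-- exp(-u) -/
  τ : S UU
  /-- log of the gradient function -/
  l : S UU
  τpos : ∀ z, 0 < ev z τ
  τle : ∀ z, ev z τ ≤ 1
  hW : expS l ^ 2 * (1 - qq DD τ) = 1
  hP : PP DD DT (hh DD τ (expS l ^ 2)) τ = -3 * τ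
  hH0 : ∀ z, 0 ≤ ev z (3 - τ * trA DD τ (expS l ^ 2))
  hHΛ : ∀ z, ev z (expS l) * ev z (3 - τ * trA DD τ (expS l ^ 2)) ≤ Λ

lemma DD_comm (i j : Fin 3) (f : S UU) : DD i (DD j f) = DD j (DD i f) := dS_comm hUU _ _ f
lemma DT_comm (i : Fin 3) (f : S UU) : DT (DD i f) = DD i (DT f) := dS_comm hUU _ _ f

lemma DD_xS (i j : Fin 3) : DD i (xS j) = kA (S UU) i j := by
  rw [dS_xS]
  unfold bx kA
  by_cases h : i = j
  · subst h; simp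
  · simp [h]

lemma DT_xS (j : Fin 3) : DT (xS j) = 0 := by
  rw [dS_xS]; simp [bt]

lemma DD_sS (i : Fin 3) : DD i sS = 0 := by
  rw [dS_sS]; simp [bx]

lemma DT_sS : DT sS = 1 := by
  rw [dS_sS]; simp [bt]

/-- time exponential -/
def eS (c : ℝ) : S UU := expS (c • sS)

lemma ev_eS (c : ℝ) (z : UU) : ev z (eS c) = Real.exp (c * z.1.2) := by
  rw [eS, ev_expS, map_smul, ev_sS, smul_eq_mul]

lemma DD_eS (c : ℝ) (i : Fin 3) : DD i (eS c) = 0 := by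
  rw [eS, dS_expS, Derivation.map_smul, DD_sS]; simp

lemma DT_eS (c : ℝ) : DT (eS c) = c • eS c := by
  rw [eS, dS_expS, Derivation.map_smul, DT_sS]; simp

/-- constants -/
abbrev cS (c : ℝ) : S UU := algebraMap ℝ (S UU) c

lemma ev_cS (c : ℝ) (z : UU) : ev z (cS c) = c := AlgHom.commutes _ _

/-- squared distance -/
def sqS (y : V3) : S UU := ∑ i, (xS i - algebraMap ℝ (S UU) (y i)) ^ 2

lemma ev_sqS (y : V3) (z : UU) : ev z (sqS y) = sqd y z.1.1 := by
  simp [sqS, sqd, ev_xS]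

lemma sqd_mem {y x : V3} {s : ℝ} (hy : ∑ i, y i ^ 2 ≤ 16) (h : sqd y x ≤ 25) (hs : 0 < s) :
    ((x, s) : E4) ∈ UU := by
  refine ⟨?_, hs⟩
  unfold sqd at h
  simp only [Fin.sum_univ_three] at *
  nlinarith [sq_nonneg (4 * (x 0 - y 0) - 5 * y 0), sq_nonneg (4 * (x 1 - y 1) - 5 * y 1),
    sq_nonneg (4 * (x 2 - y 2) - 5 * y 2)]

namespace DFlow
variable {Λ : ℝ} (F : DFlow Λ)

/-- gradient function -/
def v : S UU := expS F.l
/-- square -/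
def W : S UU := expS F.l ^ 2
/-- parabolic operator -/
def P (f : S UU) : S UU := PP DD DT (hh DD F.τ F.W) f
/-- pairing -/
def hp (f g : S UU) : S UU := _root_.hp DD (hh DD F.τ F.W) f g

lemma vpos (z : UU) : 0 < ev z F.v := by rw [v, ev_expS]; positivity
lemma W_eq : F.W = F.v ^ 2 := rfl
lemma evW (z : UU) : ev z F.W = ev z F.v ^ 2 := by rw [W_eq, map_pow]
lemma hW' : F.W * (1 - qq DD F.τ) = 1 := F.hW
lemma P_τ : F.P F.τ = -3 * F.τ := F.hP

lemma ev_qq (z : UU) : ev z (qq DD F.τ) = ∑ k, ev z (DD k F.τ) ^ 2 := by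
  simp [qq]

lemma evWq (z : UU) : ev z F.v ^ 2 * (1 - ev z (qq DD F.τ)) = 1 := by
  have := congrArg (ev z) F.hW'
  simpa [evW] using this

lemma qq_nonneg (z : UU) : 0 ≤ ev z (qq DD F.τ) := by
  rw [ev_qq]; positivity

lemma one_le_v (z : UU) : 1 ≤ ev z F.v := by
  have h1 := F.evWq z
  have h2 := F.qq_nonneg z
  have h3 := F.vpos z
  by_contra! h
  nlinarith

lemma dW_gen (D : Derivation ℝ (S UU) (S UU)) :
    D F.W = 2 * F.W ^ 2 * ∑ k, DD k F.τ * D (DD k F.τ) := by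
  have h := congrArg D F.hW'
  rw [Derivation.leibniz, map_sub, Derivation.map_one_eq_zero] at h
  have hq : D (qq DD F.τ) = 2 * ∑ k, DD k F.τ * D (DD k F.τ) := by
    simp only [qq, Fin.sum_univ_three, map_add, pow_two, Derivation.leibniz, smul_eq_mul]
    ring
  rw [hq] at h
  simp only [smul_eq_mul] at h
  linear_combination F.W * h - D F.W * F.hW'

lemma dl_gen (D : Derivation ℝ (S UU) (S UU)) (hD : D F.v = F.v * D F.l) :
    D F.l = F.W * ∑ k, DD k F.τ * D (DD k F.τ) := by
  have h := F.dW_gen D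
  have h2 : D F.W = 2 * F.W * D F.l := by
    rw [W_eq, pow_two, Derivation.leibniz, hD]
    simp only [smul_eq_mul]; ring
  have hW := F.hW'
  have h3 : (2:S UU) * D F.l = 2 * (F.W * ∑ k, DD k F.τ * D (DD k F.τ)) := by
    linear_combination (1 - qq DD F.τ) * (h - h2)+ (-2 * D F.l + 2 * F.W * ∑ k, DD k F.τ * D (DD k F.τ)) * hW
  apply S_ext
  intro z
  have := congrArg (ev z) h3
  rw [map_mul, map_mul] at this
  have e2 : ev z (2 : S UU) = 2 := map_ofNat _ _
  rw [e2] at this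
  linarith

lemma dv (a : E4) : dS hUU a F.v = F.v * dS hUU a F.l := dS_expS hUU a F.l

lemma dl (i : Fin 3) : DD i F.l = F.W * bb DD F.τ i := F.dl_gen (DD i) (F.dv _)

lemma P_l : F.P F.l = F.W * (2 * qq DD F.τ * F.τ * trA DD F.τ F.W - 3 * qq DD F.τ
    - F.τ ^ 2 * QQ DD F.τ F.W) :=
  PP_l DD DT DD_comm DT_comm F.τ F.W F.l F.hP (fun i => F.dW_gen (DD i)) F.dl (F.dl_gen DT (F.dv _))

lemma P_v : F.P F.v = F.v * (F.P F.l - F.hp F.l F.l) :=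
  PP_exp DD DT _ _ _ (fun i => F.dv _) (F.dv _)

lemma hs (i j) : hh DD F.τ F.W i j = hh DD F.τ F.W j i := hh_symm _ _ _ _ _

lemma P_mul (f g : S UU) : F.P (f * g) = f * F.P g + g * F.P f - 2 * F.hp f g := PP_mul _ _ _ F.hs _ _
lemma P_add (f g : S UU) : F.P (f + g) = F.P f + F.P g := PP_add _ _ _ _ _
lemma P_sub (f g : S UU) : F.P (f - g) = F.P f - F.P g := PP_sub _ _ _ _ _
lemma P_smul (c : ℝ) (g : S UU) : F.P (c • g) = c • F.P g := PP_smul _ _ _ _ _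
lemma P_cS (c : ℝ) : F.P (cS c) = 0 := PP_const _ _ _ _
lemma P_sum {ι : Type*} (s : Finset ι) (f : ι → S UU) : F.P (∑ i ∈ s, f i) = ∑ i ∈ s, F.P (f i) := PP_sum _ _ _ _ _
lemma P_eS (c : ℝ) : F.P (eS c) = c • eS c := by
  rw [P, PP_time _ _ _ _ (DD_eS c), DT_eS]
lemma hp_eS (c : ℝ) (f : S UU) : F.hp (eS c) f = 0 := hp_time _ _ _ _ (DD_eS c)
lemma P_eS_mul (c : ℝ) (f : S UU) : F.P (eS c * f) = eS c * (F.P f + c • f) := by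
  rw [P_mul, hp_eS, P_eS]
  simp only [Algebra.smul_def]; ring
lemma P_sqS (y : V3) : F.P (sqS y) = -2 * F.τ ^ 2 * (2 + F.W) :=
  PP_sq_x _ _ _ _ F.hW' _ _ DD_xS DT_xS
lemma P_eta (y : V3) : F.P (F.τ ^ 2 - sqS y) = 0 :=
  PP_eta _ _ _ _ F.hW' _ _ DD_xS DT_xS F.hP

lemma ev_aa (z : UU) (i j) : ev z (aa DD F.τ F.W i j) =
    (if i = j then 1 else 0) + ev z F.v ^ 2 * ev z (DD i F.τ) * ev z (DD j F.τ) := by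
  simp only [aa, map_add, map_mul, evW, kA]
  split <;> simp

lemma ev_hh (z : UU) (i j) : ev z (hh DD F.τ F.W i j) = ev z F.τ ^ 2 *
    ((if i = j then 1 else 0) + ev z F.v ^ 2 * ev z (DD i F.τ) * ev z (DD j F.τ)) := by
  rw [hh, map_mul, ev_aa, map_pow]

/-- a negative Hessian gives a negative trace -/
lemma trace_neg (z : UU) (m : Fin 3 → Fin 3 → ℝ) (hm : ∀ ξ : V3, ∑ i, ∑ j, ξ i * ξ j * m i j ≤ 0) :
    ∑ i, ∑ j, ev z (hh DD F.τ F.W i j) * m i j ≤ 0 := by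
  have h0 := hm ![1, 0, 0]
  have h1 := hm ![0, 1, 0]
  have h2 := hm ![0, 0, 1]
  have h3 := hm (fun i => ev z (DD i F.τ))
  simp [Fin.sum_univ_three] at h0 h1 h2
  simp only [Fin.sum_univ_three] at h3
  simp only [ev_hh, Fin.sum_univ_three]
  simp only [Fin.isValue, ↓reduceIte, zero_ne_one, one_ne_zero, Fin.reduceEq]
  have a1 := mul_nonneg (sq_nonneg (ev z F.τ)) (neg_nonneg.2 h0)
  have a2 := mul_nonneg (sq_nonneg (ev z F.τ)) (neg_nonneg.2 h1)
  have a3 := mul_nonneg (sq_nonneg (ev z F.τ)) (neg_nonneg.2 h2)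
  have a4 := mul_nonneg (mul_nonneg (sq_nonneg (ev z F.τ)) (sq_nonneg (ev z F.v))) (neg_nonneg.2 h3)
  nlinarith [a1, a2, a3, a4]

lemma touch_P (g : S UU) (z : UU) (h : TouchC hUU g z) : 0 ≤ ev z (F.P g) := by
  obtain ⟨_, ht, hx⟩ := h
  have := F.trace_neg z _ hx
  have e : ev z (F.P g) = ev z (DT g) - ∑ i, ∑ j, ev z (hh DD F.τ F.W i j) * ev z (DD i (DD j g)) := by
    simp [P, PP]
  rw [e]; linarith

lemma ev_hp (z : UU) (f g : S UU) : ev z (F.hp f g) =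
    ∑ i, ∑ j, ev z (hh DD F.τ F.W i j) * ev z (DD i f) * ev z (DD j g) := by
  simp [hp, _root_.hp]

lemma ev_hp_self (z : UU) (f : S UU) : ev z (F.hp f f) = ev z F.τ ^ 2 *
    ((∑ i, ev z (DD i f) ^ 2) + ev z F.v ^ 2 * (∑ i, ev z (DD i F.τ) * ev z (DD i f)) ^ 2) := by
  rw [ev_hp]
  simp only [ev_hh, Fin.sum_univ_three]
  simp only [Fin.isValue, ↓reduceIte, zero_ne_one, one_ne_zero, Fin.reduceEq]
  ring

lemma hp_nonneg (z : UU) (f : S UU) : 0 ≤ ev z (F.hp f f) := by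
  rw [ev_hp_self]; positivity

lemma hp_symm (f g : S UU) : F.hp f g = F.hp g f := by
  simp only [hp, _root_.hp, Fin.sum_univ_three]
  rw [F.hs 1 0, F.hs 2 0, F.hs 2 1]; ring

end DFlow

end


open Real Filter Topology
open scoped ContDiff

noncomputable section

lemma sqd_self (y : V3) : sqd y y = 0 := by simp [sqd]
lemma sqd_nonneg (y x : V3) : 0 ≤ sqd y x := by unfold sqd; positivity
lemma sqd_zero (x : V3) : sqd 0 x = ∑ i, x i ^ 2 := by simp [sqd]

lemma ev_three (z : UU) : ev z (3 : S UU) = 3 := map_ofNat _ _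

namespace DFlow
variable {Λ : ℝ} (F : DFlow Λ)

lemma upper1 (z : UU) (hz : sqd 0 z.1.1 ≤ 16) (hs : 1 ≤ z.1.2) :
    ev z F.τ ≤ 2 * Real.exp (7 / 4) * Real.exp (-(7 / 4) * z.1.2) := by
  set y := z.1.1
  have hy : ∑ i, y i ^ 2 ≤ 16 := by rwa [sqd_zero] at hz
  set K := 4 * Real.exp (7 / 4)
  have hK : 0 < K := by positivity
  set g : S UU := (F.τ ^ 2 - sqS y) + (2:ℝ) • F.τ - K • eS (-(7 / 4)) with hg
  have evg : ∀ z', ev z' g = ev z' F.τ ^ 2 - sqd y z'.1.1 + 2 * ev z' F.τ - K * Real.exp (-(7 / 4) * z'.1.2) := by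
    intro z'; simp [hg, ev_sqS, ev_eS]
  have Pg : ∀ z', ev z' (F.P g) = - 6 * ev z' F.τ + 7 / 4 * K * Real.exp (-(7 / 4) * z'.1.2) := by
    intro z'
    rw [hg, P_sub, P_add, P_smul, P_smul, P_eta, P_τ, P_eS]
    simp [ev_eS, ev_three]; ring
  have key := maxP hUU g y 4 1 (fun x s hx hs => sqd_mem hy (hx.trans (by norm_num)) (by linarith))
    (fun z' _ h => by
      rw [evg, h]
      have := F.τle z'; have := F.τpos z'; have := sqd_nonneg y z'.1.1
      have : K * Real.exp (-(7 / 4) * 1) = 4 := by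
        simp only [K]; rw [mul_assoc, ← Real.exp_add]; norm_num
      nlinarith)
    (fun z' h _ => by
      rw [evg, h]
      have := F.τle z'; have := F.τpos z'
      have : 0 < K * Real.exp (-(7 / 4) * z'.1.2) := by positivity
      nlinarith)
    (fun z' _ _ h0 ht => by
      have h1 := F.touch_P g z' ht
      rw [Pg] at h1
      rw [evg] at h0
      have := F.τle z'; have := F.τpos z'; have := sqd_nonneg y z'.1.1
      have : 0 < K * Real.exp (-(7 / 4) * z'.1.2) := by positivity
      nlinarith)
    z (by rw [sqd_self]; norm_num) hs
  rw [evg, sqd_self] at key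
  have := F.τpos z
  simp only [K] at key
  nlinarith

lemma upper2 : ∃ C, 0 < C ∧ ∀ z : UU, sqd 0 z.1.1 ≤ 4 → 1 ≤ z.1.2 →
    ev z F.τ ≤ C * Real.exp (-3 * z.1.2) := by
  set A := 2 * Real.exp (7 / 4) with hA
  set K := 6 * A ^ 2 + 3 * Real.exp 3 + 1
  have hK : 0 < K := by positivity
  refine ⟨K, hK, fun z hz hs => ?_⟩
  set y := z.1.1
  have hy : ∑ i, y i ^ 2 ≤ 4 := by rwa [sqd_zero] at hz
  set g : S UU := (F.τ ^ 2 - sqS y) + (2:ℝ) • F.τ - ((2 * K) • eS (-3) - K • eS (-(7 / 2))) with hg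
  have evg : ∀ z', ev z' g = ev z' F.τ ^ 2 - sqd y z'.1.1 + 2 * ev z' F.τ -
      (2 * K * Real.exp (-3 * z'.1.2) - K * Real.exp (-(7 / 2) * z'.1.2)) := by
    intro z'; simp [hg, ev_sqS, ev_eS]
  have Pg : ∀ z', ev z' (F.P g) = - 6 * ev z' F.τ + (6 * K * Real.exp (-3 * z'.1.2)
     - 7 / 2 * K * Real.exp (-(7 / 2) * z'.1.2)) := by
    intro z'
    rw [hg, P_sub, P_add, P_eta, P_sub, P_smul, P_smul, P_smul, P_τ, P_eS, P_eS]
    simp [ev_eS, ev_three]; ring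
  have hle : ∀ s : ℝ, 0 < s → Real.exp (-(7/2) * s) ≤ Real.exp (-3 * s) := fun s hs =>
    Real.exp_le_exp.2 (by linarith)
  have key := maxP hUU g y 4 1 (fun x s hx hs => sqd_mem (hy.trans (by norm_num)) (hx.trans (by norm_num)) (by linarith))
    (fun z' _ h => by
      rw [evg, h]
      have := F.τle z'; have := F.τpos z'; have := sqd_nonneg y z'.1.1
      have h1 := hle 1 one_pos
      have h3 : 3 < K * Real.exp (-3 * 1) := by
        have : Real.exp 3 * Real.exp (-3 * 1) = 1 := by rw [← Real.exp_add]; norm_num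
        have h5 : 0 < Real.exp (-3 * 1) := by positivity
        simp only [K]
        nlinarith [mul_nonneg (sq_nonneg A) h5.le]
      have h6 := mul_le_mul_of_nonneg_left h1 hK.le
      have h7 : ev z' F.τ ^ 2 ≤ 1 := by nlinarith
      rw [mul_assoc 2 K]
      generalize K * Real.exp (-3 * 1) = a at *
      generalize K * Real.exp (-(7 / 2) * 1) = b at *
      linarith)
    (fun z' h hs' => by
      rw [evg, h]
      have := F.τle z'; have := F.τpos z'
      have h1 := mul_le_mul_of_nonneg_left (hle z'.1.2 (by linarith)) hK.le
      have : 0 < K * Real.exp (-3 * z'.1.2) := by positivity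
      nlinarith)
    (fun z' hz' hs' h0 ht => by
      have h1 := F.touch_P g z' ht
      rw [Pg] at h1
      rw [evg] at h0
      have := F.τpos z'; have := sqd_nonneg y z'.1.1
      have h2 := F.upper1 z' (by
        rw [sqd_zero]
        unfold sqd at hz'
        simp only [Fin.sum_univ_three] at *
        nlinarith [sq_nonneg (z'.1.1 0 - 2 * y 0), sq_nonneg (z'.1.1 1 - 2 * y 1), sq_nonneg (z'.1.1 2 - 2 * y 2)]) hs'.le
      have e : Real.exp (-(7 / 2) * z'.1.2) = Real.exp (-(7 / 4) * z'.1.2) ^ 2 := by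
        rw [← Real.exp_nat_mul]; congr 1; push_cast; ring
      have h3 : ev z' F.τ ^ 2 ≤ A ^ 2 * Real.exp (-(7 / 2) * z'.1.2) := by
        rw [e, ← mul_pow]; exact pow_le_pow_left₀ (F.τpos z').le h2 2
      have h4 : 0 < Real.exp (-(7 / 2) * z'.1.2) := by positivity
      have h5 : 6 * A ^ 2 * Real.exp (-(7 / 2) * z'.1.2) < K * Real.exp (-(7 / 2) * z'.1.2) := by
        apply mul_lt_mul_of_pos_right _ h4
        simp only [K]; have := Real.exp_pos 3; linarith
      nlinarith)
    z (by rw [sqd_self]; norm_num) hs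
  rw [evg, sqd_self] at key
  have := F.τpos z
  have : 0 < K * Real.exp (-(7 / 2) * z.1.2) := by positivity
  nlinarith

/-- log of tau -/
def lt : S UU := logS F.τ F.τpos

lemma expS_lt : expS F.lt = F.τ := expS_logS _ _

lemma ev_lt (z : UU) : ev z F.lt = Real.log (ev z F.τ) := ev_logS _ _ _

lemma P_lt : F.P F.lt = F.hp F.lt F.lt - 3 := by
  have h1 : F.P F.τ = F.τ * (F.P F.lt - F.hp F.lt F.lt) := by
    apply PP_exp
    · intro i
      rw [← F.expS_lt, dS_expS, F.expS_lt]
    · rw [← F.expS_lt, dS_expS, F.expS_lt]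
  rw [P_τ] at h1
  apply S_ext
  intro z
  have h2 := congrArg (ev z) h1
  simp only [map_mul, map_sub, map_neg, map_ofNat] at h2 ⊢
  have := F.τpos z
  have h3 : ev z F.τ * (ev z (F.P F.lt) - (ev z (F.hp F.lt F.lt)  - 3)) = 0 := by linarith
  rcases mul_eq_zero.1 h3 with h | h <;> linarith

/-- the scaled function -/
def Fs : S UU := eS 3 * F.τ

lemma ev_Fs (z : UU) : ev z F.Fs = Real.exp (3 * z.1.2) * ev z F.τ := by
  rw [Fs, map_mul, ev_eS]

lemma P_Fs : F.P F.Fs = 0 := by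
  rw [Fs, P_eS_mul, P_τ]
  simp only [Algebra.smul_def, map_ofNat]; ring

lemma Fs_upper : ∃ C, 0 < C ∧ ∀ z : UU, sqd 0 z.1.1 ≤ 4 → 1 ≤ z.1.2 → ev z F.Fs ≤ C := by
  obtain ⟨C, hC, h⟩ := F.upper2
  refine ⟨C, hC, fun z h1 h2 => ?_⟩
  rw [ev_Fs]
  calc _ ≤ Real.exp (3 * z.1.2) * (C * Real.exp (-3 * z.1.2)) := by gcongr; exact h z h1 h2
    _ = C * (Real.exp (3 * z.1.2) * Real.exp (-3 * z.1.2)) := by ring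
    _ = C := by rw [← Real.exp_add]; simp

lemma cyl4 (x : V3) (s : ℝ) (h : sqd 0 x ≤ 4) (hs : 1 ≤ s) : ((x, s) : E4) ∈ UU :=
  sqd_mem (by simp) (h.trans (by norm_num)) (by linarith)

lemma Fs_lower : ∃ c, 0 < c ∧ ∀ z : UU, sqd 0 z.1.1 ≤ 4 → 1 ≤ z.1.2 →
    c * (14 / 5 + ev z F.τ ^ 2 - sqd 0 z.1.1) ≤ ev z F.Fs := by
  obtain ⟨C, hC, hb⟩ := slice_bdd F.lt 0 4 1 (fun x hx => cyl4 x 1 hx le_rfl)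
  set m := Real.exp (-C)
  have hm : 0 < m := by positivity
  refine ⟨m / 8, by positivity, ?_⟩
  intro z hz hs
  set g : S UU := (m / 8) • (cS (14 / 5) + (F.τ ^ 2 - sqS 0)) - F.Fs + (m / 80) • eS (-1) with hg
  have evg : ∀ z', ev z' g = m / 8 * (14 / 5 + ev z' F.τ ^ 2 - sqd 0 z'.1.1) - ev z' F.Fs + m / 80 * Real.exp (- z'.1.2) := by
    intro z'; simp [hg, ev_sqS, ev_eS]; ring
  have Pg : ∀ z', ev z' (F.P g) = - (m / 80 * Real.exp (-z'.1.2)) := by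
    intro z'
    rw [hg, P_add, P_sub, P_smul, P_add, P_smul, P_eta, P_Fs, P_eS, P_cS]
    simp [ev_eS]
  have key := maxP hUU g 0 4 1 (fun x s hx hs => cyl4 x s hx hs)
    (fun z' hz' h => by
      rw [evg]
      have := F.τle z'; have := F.τpos z'; have := sqd_nonneg 0 z'.1.1
      have h1 := hb z' hz' h
      have h2 : m ≤ ev z' F.τ := by
        rw [ev_lt] at h1
        rw [← Real.exp_log (F.τpos z')]
        exact Real.exp_le_exp.2 (abs_le.1 h1).1
      have h3 : ev z' F.τ ≤ ev z' F.Fs := by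
        rw [ev_Fs]
        have : 1 ≤ Real.exp (3 * z'.1.2) := Real.one_le_exp (by linarith)
        nlinarith
      have h4 : Real.exp (-z'.1.2) ≤ 1 := Real.exp_le_one_iff.2 (by linarith)
      have h5 : ev z' F.τ ^ 2 ≤ 1 := by nlinarith
      nlinarith [mul_le_mul_of_nonneg_left h5 hm.le, mul_le_mul_of_nonneg_left h4 hm.le])
    (fun z' h hs' => by
      rw [evg, h]
      have := F.τle z'; have := F.τpos z'
      have h3 : 0 < ev z' F.Fs := by
        rw [ev_Fs]; positivity
      have h4 : Real.exp (-z'.1.2) ≤ 1 := Real.exp_le_one_iff.2 (by linarith)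
      have h5 : ev z' F.τ ^ 2 ≤ 1 := by nlinarith
      nlinarith [mul_le_mul_of_nonneg_left h5 hm.le, mul_le_mul_of_nonneg_left h4 hm.le])
    (fun z' _ _ h0 ht => by
      have h1 := F.touch_P g z' ht
      rw [Pg] at h1
      have : 0 < m / 80 * Real.exp (-z'.1.2) := by positivity
      linarith)
    z hz hs
  rw [evg] at key
  have : 0 < m / 80 * Real.exp (-z.1.2) := by positivity
  linarith

end DFlow

end


open Real Filter Topology
open scoped ContDiff

noncomputable section

section
open Matrix

lemma tr_expand (p : V3) (t : Matrix (Fin 3) (Fin 3) ℝ) (w : ℝ) :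
    ((1 + w • vecMulVec p p) * t).trace =
      ∑ i, ∑ j, ((if i = j then 1 else 0) + w * p i * p j) * t i j := by
  simp only [trace, diag_apply, mul_apply, Fin.sum_univ_three, Matrix.add_apply, Matrix.smul_apply,
    vecMulVec_apply, Matrix.one_apply, smul_eq_mul]
  simp only [Fin.isValue, ↓reduceIte, zero_ne_one, one_ne_zero, Fin.reduceEq]
  ring

lemma tr2_expand (p : V3) (t : Matrix (Fin 3) (Fin 3) ℝ) (ht : tᵀ = t) (w : ℝ) :
    ((1 + w • vecMulVec p p) * t * ((1 + w • vecMulVec p p) * t)).trace =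
      (∑ i, ∑ j, ∑ k, ((if i = j then 1 else 0) + w * p i * p j) * t i k * t j k) +
      w * (∑ i, ∑ j, ((if i = j then 1 else 0) + w * p i * p j) * (∑ k, p k * t i k) * (∑ k, p k * t j k)) := by
  have h10 : t 1 0 = t 0 1 := congrFun (congrFun ht 0) 1
  have h20 : t 2 0 = t 0 2 := congrFun (congrFun ht 0) 2
  have h21 : t 2 1 = t 1 2 := congrFun (congrFun ht 1) 2
  simp only [trace, diag_apply, mul_apply, Fin.sum_univ_three, Matrix.add_apply, Matrix.smul_apply,
    vecMulVec_apply, Matrix.one_apply, smul_eq_mul, h10, h20, h21]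
  simp only [Fin.isValue, ↓reduceIte, zero_ne_one, one_ne_zero, Fin.reduceEq]
  generalize t 0 0 = t00
  generalize t 0 1 = t01
  generalize t 0 2 = t02
  generalize t 1 1 = t11
  generalize t 1 2 = t12
  generalize t 2 2 = t22
  generalize p 0 = p0
  generalize p 1 = p1
  generalize p 2 = p2
  ring

lemma quad_expand (p y : V3) (w : ℝ) :
    y ⬝ᵥ ((1 + w • vecMulVec p p) *ᵥ y) = (∑ i, y i ^ 2) + w * (∑ i, p i * y i) ^ 2 := by
  simp only [mulVec, dotProduct, Fin.sum_univ_three, Matrix.add_apply, Matrix.smul_apply,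
    vecMulVec_apply, Matrix.one_apply, smul_eq_mul]
  simp only [Fin.isValue, ↓reduceIte, zero_ne_one, one_ne_zero, Fin.reduceEq]
  ring

end

namespace DFlow
variable {Λ : ℝ} (F : DFlow Λ)
open Matrix

/-- gradient at a point -/
def pz (z : UU) : V3 := fun i => ev z (DD i F.τ)
/-- Hessian at a point -/
def tz (z : UU) : Matrix (Fin 3) (Fin 3) ℝ := fun i j => ev z (DD i (DD j F.τ))

lemma tz_symm (z : UU) : (F.tz z)ᵀ = F.tz z := by
  ext i j
  simp only [transpose_apply, tz]
  rw [DD_comm]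

lemma ev_trA (z : UU) : ev z (trA DD F.τ F.W) =
    ((1 + (ev z F.v) ^ 2 • vecMulVec (F.pz z) (F.pz z)) * F.tz z).trace := by
  rw [tr_expand]
  simp [trA, ev_aa, pz, tz]

lemma ev_bb (z : UU) (i) : ev z (bb DD F.τ i) = ∑ k, F.pz z k * F.tz z i k := by
  simp [bb, pz, tz]

lemma ev_Q (z : UU) : ev z (QQ DD F.τ F.W) + ev z F.v ^ 2 * ev z (abb DD F.τ F.W) =
    ((1 + (ev z F.v) ^ 2 • vecMulVec (F.pz z) (F.pz z)) * F.tz z *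
     ((1 + (ev z F.v) ^ 2 • vecMulVec (F.pz z) (F.pz z)) * F.tz z)).trace := by
  rw [tr2_expand _ _ (F.tz_symm z)]
  simp only [QQ, abb, map_sum, map_mul, ev_aa, ev_bb]
  rfl

lemma dlt (i : Fin 3) : F.τ * DD i F.lt = DD i F.τ := by
  conv_rhs => rw [← F.expS_lt, dS_expS, F.expS_lt]

/-- the geometric information at a point -/
lemma geom (z : UU) : ∃ N : Matrix (Fin 3) (Fin 3) ℝ, Nᵀ = N ∧
    N.trace = ev z (3 - F.τ * trA DD F.τ F.W) ∧
    ev z (F.P F.l - F.hp F.l F.l) = 2 * N.trace - 3 - ev z F.v ^ 2 * (N * N).trace ∧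
    ev z (F.hp (F.lt - F.l) (F.lt - F.l)) = ev z F.v ^ 2 * ((N *ᵥ F.pz z) ⬝ᵥ (N *ᵥ F.pz z)) ∧
    F.pz z ⬝ᵥ F.pz z ≤ 1 := by
  have hq : F.pz z ⬝ᵥ F.pz z = ev z (qq DD F.τ) := by
    rw [ev_qq]; simp [dotProduct, pz, pow_two]
  have hv := F.evWq z
  rw [← hq] at hv
  obtain ⟨N, h1, h2, h3, h4⟩ := linalg (F.pz z) (F.tz z) (F.tz_symm z) (ev z F.v) (ev z F.τ) (F.vpos z) hv
  rw [← ev_trA] at h2 h3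
  rw [← ev_Q] at h3
  refine ⟨N, h1, ?_, ?_, ?_, ?_⟩
  · rw [h2]; simp [ev_three]
  · have : F.hp F.l F.l = F.τ ^ 2 * F.W ^ 2 * abb DD F.τ F.W := hp_l DD F.τ F.W F.l F.dl
    rw [P_l, this, h2, h3]
    simp only [map_sub, map_mul, map_pow, evW, map_ofNat, ← hq]
    linear_combination (3 - 2 * ev z F.τ * ev z (trA DD F.τ F.W)) * hv
  · rw [h4, quad_expand, ev_hp_self]
    have e : ∀ i, ev z F.τ * ev z (DD i (F.lt - F.l)) =
        (F.pz z - (ev z F.τ * ev z F.v ^ 2) • (F.tz z *ᵥ F.pz z)) i := by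
      intro i
      have h5 := congrArg (ev z) (F.dlt i)
      rw [map_mul] at h5
      rw [map_sub, map_sub, mul_sub, h5, F.dl, map_mul, ev_bb, evW]
      simp [mulVec, dotProduct, pz]
      rw [← mul_assoc]
      congr 1
      exact Finset.sum_congr rfl (fun k _ => by ring)
    simp only [← e]
    simp only [Fin.sum_univ_three, pz]
    ring
  · rw [hq]
    have h5 := F.evWq z
    have := F.vpos z
    by_contra! h
    nlinarith [pow_pos this 2]

lemma P_v_le (z : UU) : ev z (F.P F.v) ≤ -3 * (ev z F.v - 1) := by
  obtain ⟨N, h1, h2, h3, -, -⟩ := F.geom z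
  rw [P_v, map_mul, h3]
  have hN := matineq1 N h1
  have hv := F.one_le_v z
  set v := ev z F.v
  set t := N.trace
  have : v * (v ^ 2 * (N * N).trace) ≥ v * (v ^ 2 * (t ^ 2 / 3)) := by
    have : t ^ 2 / 3 ≤ (N * N).trace := by linarith
    have hv0 : 0 ≤ v := by linarith
    gcongr
  have h5 : v * (2 * t - 3 - v ^ 2 * (t ^ 2 / 3)) * v ≤ 3 - 3 * v ^ 2 := by
    nlinarith [sq_nonneg (v ^ 2 * t - 3)]
  have h6 : v * (2 * t - 3 - v ^ 2 * (t ^ 2 / 3)) ≤ -3 * (v - 1) := by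
    by_contra! h
    nlinarith
  linarith

lemma neg_main (z : UU) (ε : ℝ) (h0 : 0 ≤ ε) (h1 : ε ≤ 1 / 4) (h2 : 2 * ε * Λ ^ 2 ≤ 1)
    (hv : Λ + 1 ≤ ev z F.v) :
    ev z (F.P F.l - F.hp F.l F.l) + (1 + ε) * ev z (F.hp (F.lt - F.l) (F.lt - F.l)) < 0 := by
  obtain ⟨N, g1, g2, g3, g4, g5⟩ := F.geom z
  rw [g3, g4]
  have hN := matineq2 N g1 _ g5 ε h0 h1
  have hH0 := F.hH0 z
  have hHL := F.hHΛ z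
  rw [show expS F.l ^ 2 = F.W from rfl, ← g2] at hH0 hHL
  rw [show expS F.l = F.v from rfl] at hHL
  have hv1 := F.one_le_v z
  set v := ev z F.v
  set t := N.trace
  have a1 : v ^ 2 * ((1 + ε) * ((N *ᵥ F.pz z) ⬝ᵥ (N *ᵥ F.pz z))) ≤ v ^ 2 * ((N * N).trace + 2 * ε * t ^ 2) :=
    mul_le_mul_of_nonneg_left hN (by positivity)
  have a2 : (v * t) ^ 2 ≤ Λ ^ 2 := pow_le_pow_left₀ (by positivity) hHL 2
  have a3 : 2 * ε * (v * t) ^ 2 ≤ 1 := le_trans (mul_le_mul_of_nonneg_left a2 (by positivity)) h2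
  have a4 : t < 1 := by
    by_contra! h
    nlinarith
  nlinarith

/-- the cut-off -/
def eta : S UU := cS (5 / 2) + (F.τ ^ 2 - sqS 0)

lemma ev_eta (z : UU) : ev z F.eta = 5 / 2 + ev z F.τ ^ 2 - sqd 0 z.1.1 := by
  simp [eta, ev_sqS]; ring

lemma P_eta' : F.P F.eta = 0 := by
  rw [eta, P_add, P_cS, P_eta, add_zero]

lemma P_s : F.P sS = 1 := by
  rw [P, PP_time _ _ _ _ DD_sS, DT_sS]

/-- the exponent -/
def mu (ε : ℝ) : S UU := ε • F.l - (1 + ε) • (F.lt + (3:ℝ) • sS)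

lemma ev_mu (ε : ℝ) (z : UU) : ev z (F.mu ε) = ε * ev z F.l - (1 + ε) * Real.log (ev z F.Fs) := by
  rw [ev_Fs, Real.log_mul (by positivity) (F.τpos z).ne', Real.log_exp]
  simp [mu, ev_lt, ev_sS]
  ring

lemma P_mu (ε : ℝ) : F.P (F.mu ε) + F.hp (F.mu ε) (F.mu ε) =
    ε • ((F.P F.l - F.hp F.l F.l) + (1 + ε) • F.hp (F.lt - F.l) (F.lt - F.l)) := by
  have hd : ∀ i, DD i (F.mu ε) = ε • DD i F.l - (1 + ε) • DD i F.lt := by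
    intro i
    rw [mu, map_sub, Derivation.map_smul, Derivation.map_smul, map_add, Derivation.map_smul, DD_sS]
    simp
  have e1 : F.P (F.mu ε) = ε • F.P F.l - (1 + ε) • F.hp F.lt F.lt := by
    rw [mu, P_sub, P_smul, P_smul, P_add, P_lt, P_smul, P_s]
    simp only [Algebra.smul_def, map_ofNat]; ring
  rw [e1]
  simp only [hp, _root_.hp, hd, map_sub, Fin.sum_univ_three, F.hs 1 0, F.hs 2 0, F.hs 2 1,
    Algebra.smul_def, map_add, map_one]
  ring

lemma v_bdd : ∃ V, 1 ≤ V ∧ ∀ z : UU, sqd 0 z.1.1 ≤ 2 → 1 ≤ z.1.2 → ev z F.v ≤ V := by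
  obtain ⟨C1, hC1, hup⟩ := F.Fs_upper
  obtain ⟨c, hc, hlow⟩ := F.Fs_lower
  obtain ⟨ε, hε0, hε1, hε2⟩ : ∃ ε : ℝ, 0 < ε ∧ ε ≤ 1 / 4 ∧ 2 * ε * Λ ^ 2 ≤ 1 := by
    refine ⟨1 / (4 + 2 * Λ ^ 2), by positivity, ?_, ?_⟩
    · gcongr; nlinarith [sq_nonneg Λ]
    · rw [mul_assoc, div_mul_eq_mul_div, ← mul_div_assoc, div_le_one (by positivity)]
      linarith
  obtain ⟨Cb, hCb, hb⟩ := slice_bdd (expS (F.mu ε)) 0 4 1 (fun x hx => cyl4 x 1 hx le_rfl)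
  set c1 := c * (3 / 10)
  have hc1 : 0 < c1 := by positivity
  set L0 := Real.log (|Λ| + 1)
  set M := 4 * Cb + 4 * Real.exp (ε * L0 - (1 + ε) * Real.log c1) with hM
  have hMpos : 0 < M := by positivity
  set g : S UU := F.eta * expS (F.mu ε) - cS M with hg
  have evg : ∀ z', ev z' g = ev z' F.eta * Real.exp (ev z' (F.mu ε)) - M := by
    intro z'; simp [hg, ev_expS]
  have eta_le : ∀ z', ev z' F.eta ≤ 7 / 2 := by
    intro z'; rw [ev_eta]; have := F.τle z'; have := F.τpos z'; have := sqd_nonneg 0 z'.1.1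
    nlinarith
  have key := maxP hUU g 0 4 1 (fun x s hx hs => cyl4 x s hx hs)
    (fun z' hz' h => by
      have h1 := (abs_le.1 (hb z' hz' h)).2
      rw [ev_expS] at h1
      have h2 := eta_le z'
      have h3 := Real.exp_pos (ev z' (F.mu ε))
      rw [evg, hM]
      have : 0 < Real.exp (ε * L0 - (1 + ε) * Real.log c1) := by positivity
      nlinarith)
    (fun z' h hs' => by
      have h2 : ev z' F.eta < 0 := by
        rw [ev_eta, h]; have := F.τle z'; have := F.τpos z'; nlinarith
      rw [evg]
      have h3 := Real.exp_pos (ev z' (F.mu ε))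
      nlinarith)
    (fun z' hz' hs' h0 ht => by
      have h1 := F.touch_P g z' ht
      have hd := ht.1
      rw [evg] at h0
      set Y := Real.exp (ev z' (F.mu ε)) with hY
      have hYpos : 0 < Y := Real.exp_pos _
      have hη : 0 < ev z' F.eta := by
        by_contra! h
        nlinarith
      -- gradient condition
      have hdη : ∀ i, ev z' (DD i F.eta) = - ev z' F.eta * ev z' (DD i (F.mu ε)) := by
        intro i
        have h2 := hd i
        rw [hg, map_sub, Derivation.map_algebraMap, Derivation.leibniz, dS_expS] at h2
        simp only [smul_eq_mul, map_sub, map_add, map_mul, ev_expS, map_zero] at h2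
        rw [← hY] at h2
        have h3 : Y * (ev z' (DD i F.eta) + ev z' F.eta * ev z' (DD i (F.mu ε))) = 0 := by
          linarith
        rcases mul_eq_zero.1 h3 with h | h
        · exact absurd h hYpos.ne'
        · linarith
      have hP : ev z' (F.P g) = ev z' F.eta * Y * ev z' (F.P (F.mu ε) + F.hp (F.mu ε) (F.mu ε)) := by
        have e1 : F.P (expS (F.mu ε)) = expS (F.mu ε) * (F.P (F.mu ε) - F.hp (F.mu ε) (F.mu ε)) :=
          PP_exp _ _ _ _ _ (fun _ => dS_expS _ _ _) (dS_expS _ _ _)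
        have e2 : ev z' (F.hp F.eta (expS (F.mu ε))) = - ev z' F.eta * Y * ev z' (F.hp (F.mu ε) (F.mu ε)) := by
          rw [ev_hp, ev_hp]
          simp only [dS_expS, map_mul, ev_expS, hdη, ← hY, Fin.sum_univ_three]
          ring
        rw [hg, P_sub, P_cS, P_mul, P_eta', e1]
        simp only [map_sub, map_add, map_mul, ev_expS, map_zero, map_ofNat]
        rw [e2, ← hY]
        ring
      have hFs : c1 ≤ ev z' F.Fs := by
        refine le_trans ?_ (hlow z' hz'.le hs'.le)
        rw [ev_eta] at hη
        simp only [c1]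
        gcongr
        linarith
      have hl : L0 ≤ ev z' F.l := by
        have h5 : Real.exp (ε * L0 - (1 + ε) * Real.log c1) ≤ Y := by
          have := eta_le z'
          nlinarith
        rw [hY, Real.exp_le_exp, ev_mu] at h5
        have h6 : Real.log c1 ≤ Real.log (ev z' F.Fs) := Real.log_le_log hc1 hFs
        by_contra! h
        nlinarith
      have hv : Λ + 1 ≤ ev z' F.v := by
        rw [v, ev_expS]
        calc Λ + 1 ≤ |Λ| + 1 := by gcongr; exact le_abs_self _
          _ = Real.exp L0 := (Real.exp_log (by positivity)).symm
          _ ≤ _ := Real.exp_le_exp.2 hl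
      have hneg := F.neg_main z' ε hε0.le hε1 hε2 hv
      rw [hP, P_mu] at h1
      rw [map_smul, map_add, map_smul, smul_eq_mul, smul_eq_mul] at h1
      have : 0 < ev z' F.eta * Y * ε := by positivity
      nlinarith)
  refine ⟨Real.exp ((Real.log (2 * M) + (1 + ε) * Real.log C1) / ε) + 1, ?_, ?_⟩
  · have := Real.exp_pos ((Real.log (2 * M) + (1 + ε) * Real.log C1) / ε); linarith
  intro z hz hs
  have h1 := key z (by linarith) hs
  rw [evg] at h1
  have h2 : 1 / 2 ≤ ev z F.eta := by
    rw [ev_eta]; nlinarith [sq_nonneg (ev z F.τ)]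
  have h3 : Real.exp (ev z (F.mu ε)) ≤ 2 * M := by
    have := Real.exp_pos (ev z (F.mu ε))
    nlinarith
  have h4 : ev z (F.mu ε) ≤ Real.log (2 * M) := by
    rwa [← Real.le_log_iff_exp_le (by positivity)] at h3
  have hFpos : 0 < ev z F.Fs := by rw [ev_Fs]; have := F.τpos z; positivity
  have h5 : Real.log (ev z F.Fs) ≤ Real.log C1 :=
    Real.log_le_log hFpos (hup z (by linarith) hs)
  rw [ev_mu] at h4
  have h6 : ev z F.l ≤ (Real.log (2 * M) + (1 + ε) * Real.log C1) / ε := by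
    rw [le_div_iff₀ hε0]
    nlinarith
  rw [v, ev_expS]
  have := Real.exp_le_exp.2 h6
  linarith

lemma v_decay : ∃ B, 0 < B ∧ ∀ z : UU, sqd 0 z.1.1 ≤ 1 / 4 → 1 ≤ z.1.2 →
    ev z (qq DD F.τ) ≤ B * Real.exp (-2 * z.1.2) := by
  obtain ⟨V, hV1, hV⟩ := F.v_bdd
  obtain ⟨C, hC, hup⟩ := F.upper2
  set M := 4 * V with hM
  set B := 2 * M * C ^ 2 * (2 + V ^ 2) + V * Real.exp 2 with hB
  have hBpos : 0 < B := by positivity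
  refine ⟨2 * B, by positivity, ?_⟩
  intro z hz hs
  set y := z.1.1
  have hnear : ∀ x : V3, sqd y x ≤ 1 / 4 → sqd 0 x ≤ 2 := by
    intro x hx
    rw [sqd_zero] at *
    unfold sqd at hx
    simp only [Fin.sum_univ_three] at *
    nlinarith [sq_nonneg (x 0 - 2 * y 0), sq_nonneg (x 1 - 2 * y 1), sq_nonneg (x 2 - 2 * y 2)]
  set g : S UU := F.v - cS 1 - M • sqS y - B • eS (-2) with hg
  have evg : ∀ z', ev z' g = ev z' F.v - 1 - M * sqd y z'.1.1 - B * Real.exp (-2 * z'.1.2) := by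
    intro z'; simp [hg, ev_sqS, ev_eS]
  have Pg : ∀ z', ev z' (F.P g) = ev z' (F.P F.v) + 2 * M * ev z' F.τ ^ 2 * (2 + ev z' F.v ^ 2)
      + 2 * B * Real.exp (-2 * z'.1.2) := by
    intro z'
    rw [hg, P_sub, P_sub, P_sub, P_smul, P_smul, P_cS, P_sqS, P_eS]
    simp only [map_sub, map_smul, map_mul, map_add, map_neg, map_ofNat, map_pow, evW, ev_eS, smul_eq_mul, map_zero]
    ring
  have key := maxP hUU g y (1 / 4) 1 (fun x s hx hs => cyl4 x s ((hnear x hx).trans (by norm_num)) hs)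
    (fun z' hz' h => by
      rw [evg, h]
      have h1 := hV z' (hnear _ hz') h.ge
      have h2 := sqd_nonneg y z'.1.1
      have h3 : V ≤ B * Real.exp (-2 * 1) := by
        have e1 : Real.exp 2 * Real.exp (-2 * 1) = 1 := by rw [← Real.exp_add]; norm_num
        rw [hB, add_mul, mul_assoc V, e1, mul_one V]
        have : 0 ≤ 2 * M * C ^ 2 * (2 + V ^ 2) * Real.exp (-2 * 1) := by positivity
        exact le_add_of_nonneg_left this
      have : 0 ≤ M * sqd y z'.1.1 := by positivity
      generalize B * Real.exp (-2 * 1) = b at *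
      linarith)
    (fun z' h hs' => by
      rw [evg, h]
      have h1 := hV z' (hnear _ h.le) hs'
      have : 0 < B * Real.exp (-2 * z'.1.2) := by positivity
      rw [hM]; linarith)
    (fun z' hz' hs' h0 ht => by
      have h1 := F.touch_P g z' ht
      rw [Pg] at h1
      rw [evg] at h0
      have h2 := F.P_v_le z'
      have h3 := hV z' (hnear _ hz'.le) hs'.le
      have h4 := hup z' ((hnear _ hz'.le).trans (by norm_num)) hs'.le
      have h5 := F.vpos z'
      have h6 : ev z' F.τ ^ 2 ≤ C ^ 2 * Real.exp (-2 * z'.1.2) := by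
        calc _ ≤ (C * Real.exp (-3 * z'.1.2)) ^ 2 := pow_le_pow_left₀ (F.τpos z').le h4 2
          _ = C ^ 2 * Real.exp (-6 * z'.1.2) := by
            rw [mul_pow, ← Real.exp_nat_mul]; congr 2; push_cast; ring
          _ ≤ _ := by gcongr; linarith
      have h7 : 2 * M * ev z' F.τ ^ 2 * (2 + ev z' F.v ^ 2) ≤
          2 * M * (C ^ 2 * Real.exp (-2 * z'.1.2)) * (2 + V ^ 2) := by gcongr
      have h8 : 0 ≤ M * sqd y z'.1.1 := by have := sqd_nonneg y z'.1.1; positivity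
      have h9 : 0 < V * Real.exp 2 * Real.exp (-2 * z'.1.2) := by positivity
      have h10 : B * Real.exp (-2 * z'.1.2) = 2 * M * (C ^ 2 * Real.exp (-2 * z'.1.2)) * (2 + V ^ 2)
          + V * Real.exp 2 * Real.exp (-2 * z'.1.2) := by rw [hB]; ring
      linarith)
    z (by rw [sqd_self]; norm_num) hs
  rw [evg, sqd_self] at key
  have h1 := F.evWq z
  have h2 := F.one_le_v z
  have h3 := F.qq_nonneg z
  set b := B * Real.exp (-2 * z.1.2)
  have h4 : ev z (qq DD F.τ) ≤ 2 * (ev z F.v - 1) := by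
    by_contra! h
    have h5 : ev z F.v ^ 2 * (1 - ev z (qq DD F.τ)) < ev z F.v ^ 2 * (1 - 2 * (ev z F.v - 1)) := by
      have : 0 < ev z F.v ^ 2 := by positivity
      exact mul_lt_mul_of_pos_left (by linarith) this
    nlinarith [mul_nonneg (sq_nonneg (ev z F.v - 1)) (by linarith : 0 ≤ 2 * ev z F.v + 1)]
  linarith

end DFlow

end


open Real Filter Topology
open scoped ContDiff

noncomputable section

lemma eS_neg_mul (c : ℝ) : eS (-c) * eS c = 1 := by
  apply S_ext
  intro z
  rw [map_mul, ev_eS, ev_eS, ← Real.exp_add]; simp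

/-- scaled derivations -/
def del (i : Fin 3) : Derivation ℝ (S UU) (S UU) := eS (-3) • DD i

lemma del_apply (i : Fin 3) (f : S UU) : del i f = eS (-3) * DD i f := rfl

lemma del_eS (i : Fin 3) (c : ℝ) : del i (eS c) = 0 := by
  rw [del_apply, DD_eS, mul_zero]

lemma del_del (i j : Fin 3) (f : S UU) : del i (del j f) = eS (-3) * eS (-3) * DD i (DD j f) := by
  rw [del_apply j, Derivation.leibniz, del_eS, del_apply]
  simp only [smul_eq_mul]; ring

lemma del_comm (i j : Fin 3) (f : S UU) : del i (del j f) = del j (del i f) := by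
  rw [del_del, del_del, DD_comm]

lemma DT_del (i : Fin 3) (f : S UU) : DT (del i f) = del i (DT f) - 3 * del i f := by
  rw [del_apply, Derivation.leibniz, DT_comm, DT_eS, del_apply]
  simp only [smul_eq_mul, Algebra.smul_def, map_neg, map_ofNat]; ring

namespace DFlow
variable {Λ : ℝ} (F : DFlow Λ)

lemma del_Fs (i : Fin 3) : del i F.Fs = DD i F.τ := by
  rw [Fs, Derivation.leibniz, del_eS, del_apply]
  simp only [smul_eq_mul, mul_zero, add_zero]
  linear_combination DD i F.τ * eS_neg_mul 3

/-- the coefficients -/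
def AA (i j : Fin 3) : S UU := F.Fs ^ 2 * (kA (S UU) i j + F.W * del i F.Fs * del j F.Fs)

lemma hh_AA (i j : Fin 3) : hh DD F.τ F.W i j = eS (-3) * eS (-3) * F.AA i j := by
  rw [AA, del_Fs, del_Fs, hh, aa, Fs]
  have := eS_neg_mul 3
  linear_combination -F.τ ^ 2 * (kA (S UU) i j + F.W * DD i F.τ * DD j F.τ) * (eS (-3) * eS 3 + 1) * this

lemma P_AA (f : S UU) : F.P f = DT f - ∑ i, ∑ j, F.AA i j * del i (del j f) := by
  simp only [P, PP, hh_AA, del_del]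
  congr 1
  refine Finset.sum_congr rfl fun i _ => Finset.sum_congr rfl fun j _ => ?_
  ring

lemma hp_AA (f g : S UU) : F.hp f g = ∑ i, ∑ j, F.AA i j * del i f * del j g := by
  simp only [hp, _root_.hp, hh_AA, del_apply]
  refine Finset.sum_congr rfl fun i _ => Finset.sum_congr rfl fun j _ => ?_
  ring

lemma P_del (i : Fin 3) (f : S UU) : F.P (del i f) =
    del i (F.P f) + (∑ j, ∑ k, del i (F.AA j k) * del j (del k f)) - 3 * del i f := by
  have : ∀ j k, del j (del k (del i f)) = del i (del j (del k f)) := by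
    intro j k
    rw [del_comm k i, del_comm j i]
  rw [P_AA, P_AA, DT_del]
  simp only [this, Fin.sum_univ_three, map_sub, map_add, Derivation.leibniz, smul_eq_mul]
  ring

/-- jets -/
def jet : List (Fin 3) → S UU
  | [] => F.Fs
  | i :: l => del i (jet l)

/-- the right-hand side for jets -/
def Rj (l : List (Fin 3)) : S UU := F.P (F.jet l)

lemma Rj_nil : F.Rj [] = 0 := F.P_Fs

lemma Rj_cons (i : Fin 3) (l : List (Fin 3)) : F.Rj (i :: l) =
    del i (F.Rj l) + (∑ j, ∑ k, del i (F.AA j k) * F.jet (j :: k :: l)) - 3 * F.jet (i :: l) :=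
  F.P_del i _

/-- inverse of F -/
def Fi : S UU := eS (-3) * expS (-F.lt)

lemma Fi_mul : F.Fi * F.Fs = 1 := by
  have h1 := eS_neg_mul 3
  have h2 := expS_neg_mul F.lt
  rw [F.expS_lt] at h2
  rw [Fi, Fs]
  linear_combination h1 + eS (-3) * eS 3 * h2

lemma d_Fi (D : Derivation ℝ (S UU) (S UU)) : D F.Fi = - F.Fi ^ 2 * D F.Fs := by
  have h := congrArg D F.Fi_mul
  rw [Derivation.leibniz, Derivation.map_one_eq_zero] at h
  simp only [smul_eq_mul] at h
  linear_combination F.Fi * h - D F.Fi * F.Fi_mul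

lemma d_W (D : Derivation ℝ (S UU) (S UU)) : D F.W = 2 * F.W ^ 2 * ∑ k, del k F.Fs * D (del k F.Fs) := by
  rw [F.dW_gen D]
  simp only [del_Fs]

/-- polynomial expressions in jets with weight at most `d` and order at most `m` -/
inductive Gen : ℕ → ℕ → S UU → Prop
  | const (c : ℝ) : Gen 0 1 (cS c)
  | F : Gen 0 1 F.Fs
  | Fi : Gen 0 1 F.Fi
  | W : Gen 0 1 F.W
  | jet (i : Fin 3) (l : List (Fin 3)) : Gen l.length (l.length + 1) (F.jet (i :: l))
  | add {d m f g} : Gen d m f → Gen d m g → Gen d m (f + g)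
  | mul {d d' m f g} : Gen d m f → Gen d' m g → Gen (d + d') m (f * g)
  | weaken {d d' m m' f} : Gen d m f → d ≤ d' → m ≤ m' → Gen d' m' f

variable {F}

lemma Gen.one_le {d m : ℕ} {f : S UU} (h : F.Gen d m f) : 1 ≤ m := by
  induction h <;> omega

lemma Gen.mul' {d d' e m : ℕ} {f g : S UU} (hf : F.Gen d m f) (hg : F.Gen d' m g) (h : d + d' ≤ e) :
    F.Gen e m (f * g) := (hf.mul hg).weaken h le_rfl

lemma Gen.zero (d m : ℕ) (hm : 1 ≤ m) : F.Gen d m 0 := by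
  have := (Gen.const (F := F) 0).weaken (Nat.zero_le d) hm
  simpa using this

lemma Gen.sum {ι : Type*} (s : Finset ι) {d m : ℕ} (hm : 1 ≤ m) (f : ι → S UU) (h : ∀ i, F.Gen d m (f i)) :
    F.Gen d m (∑ i ∈ s, f i) := by
  classical
  induction s using Finset.induction_on with
  | empty => simpa using Gen.zero d m hm
  | insert a s ha ih => rw [Finset.sum_insert ha]; exact (h a).add ih

lemma Gen.cmul {d m : ℕ} {f : S UU} (c : ℝ) (hf : F.Gen d m f) : F.Gen d m (cS c * f) := by
  have := ((Gen.const (F := F) c).weaken (le_refl 0) hf.one_le).mul hf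
  simpa using this

lemma Gen.neg {d m : ℕ} {f : S UU} (hf : F.Gen d m f) : F.Gen d m (-f) := by
  have e : cS (-1) * f = -f := by
    apply S_ext; intro z; rw [map_mul, ev_cS, map_neg, neg_one_mul]
  exact e ▸ hf.cmul (-1)

lemma Gen.ofNat_mul {d m : ℕ} {f : S UU} (n : ℕ) [n.AtLeastTwo] (hf : F.Gen d m f) :
    F.Gen d m (OfNat.ofNat n * f) := by
  have e : cS (OfNat.ofNat n) * f = OfNat.ofNat n * f := by
    apply S_ext; intro z; rw [map_mul, ev_cS, map_mul, map_ofNat]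
  exact e ▸ hf.cmul (OfNat.ofNat n)

lemma Gen.del {d m : ℕ} {f : S UU} (h : F.Gen d m f) (i : Fin 3) : F.Gen (d + 1) (m + 1) (_root_.del i f) := by
  have hj : ∀ k, F.Gen 0 2 (_root_.del k F.Fs) := fun k => (Gen.jet k []).weaken le_rfl (by norm_num)
  induction h with
  | const c => rw [Derivation.map_algebraMap]; exact Gen.zero _ _ (by omega)
  | F => exact (hj i).weaken (by omega) le_rfl
  | Fi =>
    rw [d_Fi, pow_two]
    have h1 := Gen.Fi (F := F).weaken (le_refl 0) (show 1 ≤ 2 by norm_num)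
    exact ((h1.mul h1).neg.mul (hj i)).weaken (by omega) le_rfl
  | W =>
    rw [d_W, pow_two]
    have h1 := Gen.W (F := F).weaken (le_refl 0) (show 1 ≤ 2 by norm_num)
    refine ((h1.mul h1).ofNat_mul 2).mul' (d' := 1) ?_ (by omega)
    refine Gen.sum _ (by norm_num) _ fun k => ?_
    exact (hj k).mul' (Gen.jet i [k]) (by simp)
  | jet k l => exact Gen.jet i (k :: l)
  | add _ _ h1 h2 => rw [map_add]; exact h1.add h2
  | mul hf hg h1 h2 =>
    rw [Derivation.leibniz, smul_eq_mul, smul_eq_mul]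
    exact ((hf.weaken le_rfl (by omega)).mul' h2 (by omega)).add
      ((hg.weaken le_rfl (by omega)).mul' h1 (by omega))
  | weaken _ h1 h2 h3 => exact h3.weaken (by omega) (by omega)

lemma Gen.kA (i j : Fin 3) : F.Gen 0 1 (kA (S UU) i j) := by
  unfold _root_.kA
  split
  · have := Gen.const (F := F) 1
    simpa using this
  · exact Gen.zero _ _ le_rfl

lemma Gen.AA (i j : Fin 3) : F.Gen 0 1 (F.AA i j) := by
  rw [DFlow.AA, pow_two]
  have hj : ∀ k, F.Gen 0 1 (_root_.del k F.Fs) := fun k => Gen.jet k []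
  exact (Gen.F.mul Gen.F).mul ((Gen.kA i j).add ((Gen.W.mul (hj i)).mul (hj j)))

lemma Gen.Rj (l : List (Fin 3)) : F.Gen (l.length + 1) (l.length + 1) (F.Rj l) := by
  induction l with
  | nil => rw [Rj_nil]; exact Gen.zero _ _ (by simp)
  | cons i l ih =>
    rw [Rj_cons, sub_eq_add_neg]
    refine (Gen.add (ih.del i) ?_).add ?_
    · refine Gen.sum _ (by omega) _ fun j => Gen.sum _ (by omega) _ fun k => ?_
      refine Gen.mul' (((Gen.AA j k).del i).weaken (le_refl 1) ?_) (Gen.jet j (k :: l)) ?_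
      · simp
      · simp; omega
    · have h3 := ((Gen.jet (F := F) i l).ofNat_mul 3).neg
      exact h3.weaken (by omega) (by omega)

/-- the bound for generated elements -/
lemma Gen.bound {d m : ℕ} {f : S UU} (h : F.Gen d m f) (B0 : ℝ) : ∃ C, 0 ≤ C ∧ ∀ z : UU, ∀ Θ : ℝ, 1 ≤ Θ →
    |ev z F.Fs| ≤ B0 → |ev z F.Fi| ≤ B0 → |ev z F.W| ≤ B0 →
    (∀ i l, l.length + 1 ≤ m → |ev z (F.jet (i :: l))| ≤ Θ ^ l.length) →
    |ev z f| ≤ C * Θ ^ d := by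
  induction h with
  | const c => exact ⟨|c|, abs_nonneg _, fun z Θ _ _ _ _ _ => by simp⟩
  | F => exact ⟨|B0|, abs_nonneg _, fun z Θ _ h _ _ _ => by simpa using h.trans (le_abs_self _)⟩
  | Fi => exact ⟨|B0|, abs_nonneg _, fun z Θ _ _ h _ _ => by simpa using h.trans (le_abs_self _)⟩
  | W => exact ⟨|B0|, abs_nonneg _, fun z Θ _ _ _ h _ => by simpa using h.trans (le_abs_self _)⟩
  | jet i l => exact ⟨1, zero_le_one, fun z Θ _ _ _ _ h => by simpa using h i l le_rfl⟩
  | add _ _ h1 h2 =>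
    obtain ⟨C1, p1, h1⟩ := h1
    obtain ⟨C2, p2, h2⟩ := h2
    refine ⟨C1 + C2, by positivity, fun z Θ hΘ a b c d => ?_⟩
    rw [map_add, add_mul]
    exact (abs_add_le _ _).trans (add_le_add (h1 z Θ hΘ a b c d) (h2 z Θ hΘ a b c d))
  | mul _ _ h1 h2 =>
    obtain ⟨C1, p1, h1⟩ := h1
    obtain ⟨C2, p2, h2⟩ := h2
    refine ⟨C1 * C2, by positivity, fun z Θ hΘ a b c d => ?_⟩
    rw [map_mul, abs_mul, pow_add, mul_mul_mul_comm]
    exact mul_le_mul (h1 z Θ hΘ a b c d) (h2 z Θ hΘ a b c d) (abs_nonneg _) (by positivity)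
  | weaken _ hd hm h =>
    obtain ⟨C, p, h⟩ := h
    refine ⟨C, p, fun z Θ hΘ a b c d => (h z Θ hΘ a b c (fun i l hl => d i l (hl.trans hm))).trans ?_⟩
    gcongr

end DFlow

end


open Real Filter Topology
open scoped ContDiff

noncomputable section

/-- interpolation inequality for the top order terms -/
lemma young_top (k : ℕ) (hk : 2 ≤ k) (b ε X Y Θ : ℝ) (hε : 0 < ε) (hε1 : ε ≤ 1) (hb : 1 ≤ b)
    (hX : 0 ≤ X) (hXΘ : X ≤ Θ ^ (k - 1)) (hbΘ : b ≤ Θ)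
    (h : Θ = b ∨ Θ ^ (k - 1) = X ∨ Θ ^ k = Y) :
    X * Θ ^ (k + 1) ≤ ε * Y ^ 2 + b ^ (2 * k) + (X ^ 2 / ε) * Θ ^ 2 ∧
    (X * Θ ^ (k + 1) ≤ ε * Y ^ 2 + b ^ (2 * k) ∨
      (Θ ^ (k - 1) ≤ X / ε ∧ X * Θ ^ (k + 1) ≤ (X ^ 2 / ε) * Θ ^ 2)) := by
  obtain ⟨m, rfl⟩ : ∃ m, k = m + 2 := ⟨k - 2, by omega⟩
  simp only [show m + 2 - 1 = m + 1 by omega] at *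
  have hΘ : 0 < Θ := by linarith
  have hb0 : 0 < b := by linarith
  have key : X * Θ ^ (m + 2 + 1) ≤ ε * Y ^ 2 + b ^ (2 * (m + 2)) ∨ Θ ^ (m + 1) ≤ X / ε := by
    rcases h with h | h | h
    · left
      have : X * Θ ^ (m + 2 + 1) ≤ Θ ^ (m + 1) * Θ ^ (m + 2 + 1) := by gcongr
      have e : Θ ^ (m + 1) * Θ ^ (m + 2 + 1) = b ^ (2 * (m + 2)) := by rw [h]; ring
      have : 0 ≤ ε * Y ^ 2 := by positivity
      linarith
    · right
      rw [h, le_div_iff₀ hε]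
      nlinarith
    · by_cases hc : Θ ^ (m + 1) ≤ X / ε
      · right; exact hc
      · left
        push Not at hc
        rw [div_lt_iff₀ hε] at hc
        have : X * Θ ^ (m + 2 + 1) ≤ (Θ ^ (m + 1) * ε) * Θ ^ (m + 2 + 1) := by gcongr
        have e : (Θ ^ (m + 1) * ε) * Θ ^ (m + 2 + 1) = ε * Y ^ 2 := by rw [← h]; ring
        have : 0 ≤ b ^ (2 * (m + 2)) := by positivity
        linarith
  have k2 : Θ ^ (m + 1) ≤ X / ε → X * Θ ^ (m + 2 + 1) ≤ (X ^ 2 / ε) * Θ ^ 2 := by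
    intro hc
    calc X * Θ ^ (m + 2 + 1) = X * Θ ^ (m + 1) * Θ ^ 2 := by ring
      _ ≤ X * (X / ε) * Θ ^ 2 := by gcongr
      _ = _ := by ring
  have p1 : 0 ≤ ε * Y ^ 2 + b ^ (2 * (m + 2)) := by positivity
  have p2 : 0 ≤ (X ^ 2 / ε) * Θ ^ 2 := by positivity
  constructor
  · rcases key with h1 | h1
    · linarith
    · linarith [k2 h1]
  · rcases key with h1 | h1
    · left; exact h1
    · right; exact ⟨h1, k2 h1⟩

lemma young2 (b ε X Y Θ : ℝ) (hε : 0 < ε) (hε1 : ε ≤ 1) (hb : 1 ≤ b)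
    (hX : 0 ≤ X) (hXΘ : X ≤ Θ ^ 1) (hbΘ : b ≤ Θ)
    (h : Θ = b ∨ Θ ^ 1 = X ∨ Θ ^ 2 = Y) :
    X * Θ ^ 3 ≤ ε * Y ^ 2 + (1 / ε ^ 3) * X ^ 4 + b ^ 4 := by
  rcases (young_top 2 le_rfl b ε X Y Θ hε hε1 hb hX hXΘ hbΘ h).2 with h1 | ⟨h1, h2⟩
  · have : 0 ≤ (1 / ε ^ 3) * X ^ 4 := by positivity
    norm_num at h1; linarith
  · have h3 : (X ^ 2 / ε) * Θ ^ 2 ≤ (X ^ 2 / ε) * (X / ε) ^ 2 := by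
      have h1' : Θ ≤ X / ε := by simpa using h1
      have : 0 ≤ Θ := by linarith
      gcongr
    have e : (X ^ 2 / ε) * (X / ε) ^ 2 = (1 / ε ^ 3) * X ^ 4 := by field_simp
    have : 0 ≤ ε * Y ^ 2 := by positivity
    have : 0 ≤ b ^ 4 := by positivity
    norm_num at h2; linarith

lemma young3 (k : ℕ) (hk : 3 ≤ k) (b ε σ X Y Θ : ℝ) (hε : 0 < ε) (hε1 : ε ≤ 1) (hσ : 0 < σ) (hb : 1 ≤ b)
    (hX : 0 ≤ X) (hXΘ : X ≤ Θ ^ (k - 1)) (hbΘ : b ≤ Θ)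
    (h : Θ = b ∨ Θ ^ (k - 1) = X ∨ Θ ^ k = Y) :
    X * Θ ^ (k + 1) ≤ ε * Y ^ 2 + σ * X ^ 4 + (b ^ (2 * k) + (1 / ε ^ 2) ^ 4 / σ ^ 3) := by
  have q1 : 0 ≤ (1 / ε ^ 2) ^ 4 / σ ^ 3 := by positivity
  rcases (young_top k (by omega) b ε X Y Θ hε hε1 hb hX hXΘ hbΘ h).2 with h1 | ⟨h1, h2⟩
  · have : 0 ≤ σ * X ^ 4 := by positivity
    linarith
  · have h4 : Θ ^ 2 ≤ X / ε := le_trans (pow_le_pow_right₀ (by linarith) (by omega)) h1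
    have h3 : (X ^ 2 / ε) * Θ ^ 2 ≤ (X ^ 2 / ε) * (X / ε) := by gcongr
    have e : (X ^ 2 / ε) * (X / ε) = (1 / ε ^ 2) * X ^ 3 := by field_simp
    have : 0 ≤ ε * Y ^ 2 := by positivity
    have : 0 ≤ b ^ (2 * k) := by positivity
    have h5 : (1 / ε ^ 2) * X ^ 3 ≤ σ * X ^ 4 + (1 / ε ^ 2) ^ 4 / σ ^ 3 := by
      generalize 1 / ε ^ 2 = K at *
      by_cases hc : K ≤ σ * X
      · have : K * X ^ 3 ≤ (σ * X) * X ^ 3 := by gcongr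
        linarith [show (σ * X) * X ^ 3 = σ * X ^ 4 by ring]
      · push Not at hc
        have hc' : X ≤ K / σ := by rw [le_div_iff₀ hσ]; linarith
        have hK : 0 < K := lt_of_le_of_lt (by positivity) hc
        have : K * X ^ 3 ≤ K * (K / σ) ^ 3 := by gcongr
        have e2 : K * (K / σ) ^ 3 = K ^ 4 / σ ^ 3 := by field_simp
        have : 0 ≤ σ * X ^ 4 := by positivity
        linarith
    linarith

/-- choice of the scale -/
lemma exists_scale (k : ℕ) (hk : 2 ≤ k) (b X Y : ℝ) (hb : 1 ≤ b) (hX : 0 ≤ X) (hY : 0 ≤ Y) :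
    ∃ Θ, b ≤ Θ ∧ X ≤ Θ ^ (k - 1) ∧ Y ≤ Θ ^ k ∧ (Θ = b ∨ Θ ^ (k - 1) = X ∨ Θ ^ k = Y) := by
  set x := X ^ (((k - 1 : ℕ) : ℝ)⁻¹)
  set y := Y ^ ((k : ℝ)⁻¹)
  have ex : x ^ (k - 1) = X := Real.rpow_inv_natCast_pow hX (by omega)
  have ey : y ^ k = Y := Real.rpow_inv_natCast_pow hY (by omega)
  have px : 0 ≤ x := by positivity
  have py : 0 ≤ y := by positivity
  refine ⟨max b (max x y), le_max_left _ _, ?_, ?_, ?_⟩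
  · conv_lhs => rw [← ex]
    gcongr; simp
  · conv_lhs => rw [← ey]
    gcongr; simp
  · rcases max_choice b (max x y) with h | h
    · left; exact h
    · right
      rw [h]
      rcases max_choice x y with h | h
      · left; rw [h, ex]
      · right; rw [h, ey]

namespace DFlow
variable {Λ : ℝ} (F : DFlow Λ)

/-- energies -/
def EE (k : ℕ) : S UU := ∑ f : Fin k → Fin 3, F.jet (List.ofFn f) ^ 2

lemma sum_cons {M : Type*} [AddCommMonoid M] (k : ℕ) (φ : List (Fin 3) → M) :
    ∑ f : Fin (k + 1) → Fin 3, φ (List.ofFn f) = ∑ f : Fin k → Fin 3, ∑ i, φ (i :: List.ofFn f) := by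
  rw [Finset.sum_comm, ← Fintype.sum_prod_type' (fun i f => φ (i :: List.ofFn f))]
  symm
  refine Fintype.sum_equiv (Fin.consEquiv (fun _ => Fin 3)) _ _ ?_
  rintro ⟨i, f⟩
  simp [Fin.consEquiv, List.ofFn_cons]

lemma ev_EE (k : ℕ) (z : UU) : ev z (F.EE k) = ∑ f : Fin k → Fin 3, ev z (F.jet (List.ofFn f)) ^ 2 := by
  simp [EE]

lemma EE_nonneg (k : ℕ) (z : UU) : 0 ≤ ev z (F.EE k) := by
  rw [ev_EE]; positivity

lemma jet_sq_le (l : List (Fin 3)) (z : UU) : ev z (F.jet l) ^ 2 ≤ ev z (F.EE l.length) := by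
  rw [ev_EE]
  have := Finset.single_le_sum (f := fun f : Fin l.length → Fin 3 => ev z (F.jet (List.ofFn f)) ^ 2)
    (fun _ _ => sq_nonneg _) (Finset.mem_univ l.get)
  simpa [List.ofFn_get] using this

lemma jet_le_sqrt (l : List (Fin 3)) (z : UU) : |ev z (F.jet l)| ≤ √(ev z (F.EE l.length)) := by
  rw [← Real.sqrt_sq_eq_abs]
  exact Real.sqrt_le_sqrt (F.jet_sq_le l z)

lemma EE_one (z : UU) : ev z (F.EE 1) = ev z (qq DD F.τ) := by
  rw [ev_EE, ev_qq]
  rw [sum_cons 0 (fun l => ev z (F.jet l) ^ 2)]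
  simp [jet, del_Fs]

lemma EE_one_le (z : UU) : ev z (F.EE 1) ≤ 1 := by
  rw [EE_one]
  have h1 := F.evWq z
  have := F.vpos z
  by_contra! h
  nlinarith [mul_pos (pow_pos this 2) (sub_pos.2 h)]

/-- the basic constants -/
lemma basic : ∃ B0 c0, 1 ≤ B0 ∧ 0 < c0 ∧ ∀ z : UU, sqd 0 z.1.1 ≤ 1 / 4 → 1 ≤ z.1.2 →
    |ev z F.Fs| ≤ B0 ∧ |ev z F.Fi| ≤ B0 ∧ |ev z F.W| ≤ B0 ∧ c0 ≤ ev z F.Fs ^ 2 := by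
  obtain ⟨C, hC, hup⟩ := F.Fs_upper
  obtain ⟨c, hc, hlow⟩ := F.Fs_lower
  obtain ⟨V, hV1, hV⟩ := F.v_bdd
  refine ⟨C + c⁻¹ + V ^ 2, c ^ 2, ?_, by positivity, fun z hz hs => ?_⟩
  · have : 0 < c⁻¹ := by positivity
    nlinarith
  have h1 := hup z (by linarith) hs
  have h2 := hlow z (by linarith) hs
  have h3 := hV z (by linarith) hs
  have h4 : c ≤ ev z F.Fs := by nlinarith [sq_nonneg (ev z F.τ)]
  have h5 := F.vpos z
  have hci : 0 < c⁻¹ := by positivity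
  have h6 : ev z F.Fi * ev z F.Fs = 1 := by rw [← map_mul, Fi_mul, map_one]
  have h7 : ev z F.Fi = (ev z F.Fs)⁻¹ := eq_inv_of_mul_eq_one_left h6
  have h8 : 0 < ev z F.Fs := by linarith
  refine ⟨?_, ?_, ?_, by gcongr⟩
  · rw [abs_of_pos h8]; nlinarith
  · rw [h7, abs_of_pos (by positivity)]
    have : (ev z F.Fs)⁻¹ ≤ c⁻¹ := by gcongr
    nlinarith
  · rw [evW, abs_of_pos (by positivity)]
    have : ev z F.v ^ 2 ≤ V ^ 2 := by gcongr
    linarith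

/-- pairing lower bound -/
lemma hp_lower (z : UU) (f : S UU) : ev z F.Fs ^ 2 * ∑ i, ev z (del i f) ^ 2 ≤ ev z (F.hp f f) := by
  rw [ev_hp_self, ev_Fs]
  simp only [del_apply, map_mul, ev_eS, mul_pow, ← Finset.mul_sum]
  have e : Real.exp (3 * z.1.2) * Real.exp (-3 * z.1.2) = 1 := by rw [← Real.exp_add]; simp
  have e2 : Real.exp (3 * z.1.2) ^ 2 * Real.exp (-3 * z.1.2) ^ 2 = 1 := by rw [← mul_pow, e, one_pow]
  calc _ = (Real.exp (3 * z.1.2) ^ 2 * Real.exp (-3 * z.1.2) ^ 2) * ev z F.τ ^ 2 * ∑ i, ev z (DD i f) ^ 2 := by ring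
    _ = ev z F.τ ^ 2 * ∑ i, ev z (DD i f) ^ 2 := by rw [e2, one_mul]
    _ ≤ _ := by
      gcongr
      have : 0 ≤ ev z F.v ^ 2 * (∑ i, ev z (DD i F.τ) * ev z (DD i f)) ^ 2 := by positivity
      linarith

lemma sum_hp_lower (k : ℕ) (z : UU) : ev z F.Fs ^ 2 * ev z (F.EE (k + 1)) ≤
    ∑ f : Fin k → Fin 3, ev z (F.hp (F.jet (List.ofFn f)) (F.jet (List.ofFn f))) := by
  rw [ev_EE, sum_cons k (fun l => ev z (F.jet l) ^ 2), Finset.mul_sum]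
  exact Finset.sum_le_sum fun f _ => F.hp_lower z _

/-- total right-hand side -/
def RR (k : ℕ) (z : UU) : ℝ := 2 * ∑ f : Fin k → Fin 3, ev z (F.jet (List.ofFn f)) * ev z (F.Rj (List.ofFn f))

lemma P_EE (k : ℕ) (z : UU) : ev z (F.P (F.EE k)) ≤ F.RR k z - 2 * (ev z F.Fs ^ 2 * ev z (F.EE (k + 1))) := by
  have h := F.sum_hp_lower k z
  rw [EE, P_sum, map_sum, RR]
  have : ∀ f : Fin k → Fin 3, ev z (F.P (F.jet (List.ofFn f) ^ 2)) =
      2 * (ev z (F.jet (List.ofFn f)) * ev z (F.Rj (List.ofFn f)))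
        - 2 * ev z (F.hp (F.jet (List.ofFn f)) (F.jet (List.ofFn f))) := by
    intro f
    rw [pow_two, P_mul, Rj]
    simp only [map_sub, map_add, map_mul, map_ofNat]; ring
  simp only [this, Finset.sum_sub_distrib, ← Finset.mul_sum]
  linarith

/-- bound for the right-hand side in terms of the scale -/
lemma RR_scale (k : ℕ) : ∃ C, 0 ≤ C ∧ ∀ z : UU, sqd 0 z.1.1 ≤ 1 / 4 → 1 ≤ z.1.2 → ∀ Θ, 1 ≤ Θ →
    (∀ i l, l.length ≤ k → |ev z (F.jet (i :: l))| ≤ Θ ^ l.length) →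
    F.RR k z ≤ C * √(ev z (F.EE k)) * Θ ^ (k + 1) := by
  obtain ⟨B0, c0, _, _, hb⟩ := F.basic
  have h : ∀ f : Fin k → Fin 3, ∃ C, 0 ≤ C ∧ ∀ z : UU, ∀ Θ : ℝ, 1 ≤ Θ →
    |ev z F.Fs| ≤ B0 → |ev z F.Fi| ≤ B0 → |ev z F.W| ≤ B0 →
    (∀ i l, l.length + 1 ≤ k + 1 → |ev z (F.jet (i :: l))| ≤ Θ ^ l.length) →
    |ev z (F.Rj (List.ofFn f))| ≤ C * Θ ^ (k + 1) := by
    intro f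
    have := Gen.Rj (F := F) (List.ofFn f)
    rw [List.length_ofFn] at this
    exact this.bound B0
  choose C hC h using h
  refine ⟨2 * ∑ f, C f, mul_nonneg zero_le_two (Finset.sum_nonneg fun f _ => hC f), ?_⟩
  intro z hz hs Θ hΘ hj
  obtain ⟨b1, b2, b3, _⟩ := hb z hz hs
  rw [RR, mul_assoc, mul_assoc, Finset.sum_mul]
  refine mul_le_mul_of_nonneg_left (Finset.sum_le_sum fun f _ => ?_) zero_le_two
  have h1 := h f z Θ hΘ b1 b2 b3 (fun i l hl => hj i l (by omega))
  have h2 := F.jet_le_sqrt (List.ofFn f) z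
  rw [List.length_ofFn] at h2
  calc _ ≤ |ev z (F.jet (List.ofFn f)) * ev z (F.Rj (List.ofFn f))| := le_abs_self _
    _ = |ev z (F.jet (List.ofFn f))| * |ev z (F.Rj (List.ofFn f))| := abs_mul _ _
    _ ≤ √(ev z (F.EE k)) * (C f * Θ ^ (k + 1)) := by gcongr
    _ = _ := by ring

lemma jet_one (i : Fin 3) (z : UU) : |ev z (F.jet [i])| ≤ 1 := by
  have := F.jet_le_sqrt [i] z
  refine this.trans ?_
  rw [Real.sqrt_le_iff]
  exact ⟨zero_le_one, by simpa using F.EE_one_le z⟩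

/-- first order -/
lemma RR_one : ∃ C, 0 ≤ C ∧ ∀ z : UU, sqd 0 z.1.1 ≤ 1 / 4 → 1 ≤ z.1.2 →
    F.RR 1 z ≤ C * √(ev z (F.EE 1)) * (1 + ev z (F.EE 2)) := by
  obtain ⟨C, hC, h⟩ := F.RR_scale 1
  refine ⟨C, hC, fun z hz hs => ?_⟩
  set Y := √(ev z (F.EE 2)) with hY
  have hY0 : 0 ≤ Y := Real.sqrt_nonneg _
  have hYs : Y ^ 2 = ev z (F.EE 2) := Real.sq_sqrt (F.EE_nonneg 2 z)
  refine (h z hz hs (max 1 Y) (le_max_left _ _) ?_).trans ?_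
  · intro i l hl
    match l, hl with
    | [], _ => simpa using F.jet_one i z
    | [j], _ =>
      rw [List.length_singleton, pow_one]
      exact (F.jet_le_sqrt [i, j] z).trans (le_max_right _ _)
  · gcongr
    rw [← hYs]
    rcases max_choice 1 Y with h | h <;> rw [h] <;> norm_num <;> nlinarith

/-- the scale condition under bounds on the lower energies -/
lemma scale_jets (k : ℕ) (b Θ : ℝ) (hb : 1 ≤ b) (hbΘ : b ≤ Θ) (z : UU)
    (hlow : ∀ m, 2 ≤ m → m < k → ev z (F.EE m) ≤ b) (hk : 2 ≤ k)
    (hX : √(ev z (F.EE k)) ≤ Θ ^ (k - 1)) (hY : √(ev z (F.EE (k + 1))) ≤ Θ ^ k) :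
    ∀ i l, l.length ≤ k → |ev z (F.jet (i :: l))| ≤ Θ ^ l.length := by
  intro i l hl
  have h1 := F.jet_le_sqrt (i :: l) z
  rw [List.length_cons] at h1
  have hΘ : 1 ≤ Θ := hb.trans hbΘ
  rcases Nat.lt_or_ge l.length 1 with h | h
  · have : l = [] := by simpa using h
    subst this
    simpa using F.jet_one i z
  rcases Nat.lt_or_ge (l.length + 1) k with h2 | h2
  · refine h1.trans ?_
    have h3 := hlow (l.length + 1) (by omega) h2
    calc √(ev z (F.EE (l.length + 1))) ≤ √b := Real.sqrt_le_sqrt h3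
      _ ≤ b := by rw [Real.sqrt_le_left (by linarith)]; nlinarith
      _ ≤ Θ := hbΘ
      _ ≤ Θ ^ l.length := le_self_pow₀ hΘ (by omega)
  rcases h2.lt_or_eq with h2 | h2
  · have : l.length = k := by omega
    rw [this] at h1 ⊢
    exact h1.trans hY
  · have : l.length = k - 1 := by omega
    rw [this] at h1 ⊢
    rw [show k - 1 + 1 = k by omega] at h1
    exact h1.trans hX

lemma H1_two (c0 : ℝ) (hc0 : 0 < c0) : ∃ η C1, 0 < η ∧ 0 ≤ C1 ∧ ∀ z : UU, sqd 0 z.1.1 ≤ 1 / 4 → 1 ≤ z.1.2 →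
    F.RR 2 z ≤ c0 * ev z (F.EE 3) + η * ev z (F.EE 2) ^ 2 + C1 := by
  obtain ⟨C, hC, h⟩ := F.RR_scale 2
  set ε := min 1 (c0 / (C + 1)) with hε
  have hεp : 0 < ε := by positivity
  have hε1 : ε ≤ 1 := min_le_left _ _
  have hεc : C * ε ≤ c0 := by
    have : ε ≤ c0 / (C + 1) := min_le_right _ _
    rw [le_div_iff₀ (by positivity)] at this
    nlinarith
  refine ⟨(C + 1) * (1 / ε ^ 3), C, by positivity, hC, fun z hz hs => ?_⟩
  set X := √(ev z (F.EE 2)) with hX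
  set Y := √(ev z (F.EE 3)) with hY
  have hXs : X ^ 2 = ev z (F.EE 2) := Real.sq_sqrt (F.EE_nonneg 2 z)
  have hYs : Y ^ 2 = ev z (F.EE 3) := Real.sq_sqrt (F.EE_nonneg 3 z)
  obtain ⟨Θ, t1, t2, t3, t4⟩ := exists_scale 2 le_rfl 1 X Y le_rfl (Real.sqrt_nonneg _) (Real.sqrt_nonneg _)
  have h1 := h z hz hs Θ t1 (F.scale_jets 2 1 Θ le_rfl t1 z (fun m h1 h2 => by omega) le_rfl t2 t3)
  have h2 := young2 1 ε X Y Θ hεp hε1 le_rfl (Real.sqrt_nonneg _) t2 t1 t4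
  rw [← hYs, ← hXs]
  calc F.RR 2 z ≤ C * (X * Θ ^ 3) := by rw [← mul_assoc]; exact h1
    _ ≤ C * (ε * Y ^ 2 + 1 / ε ^ 3 * X ^ 4 + 1 ^ 4) := by gcongr
    _ = (C * ε) * Y ^ 2 + C * (1 / ε ^ 3) * (X ^ 2) ^ 2 + C := by ring
    _ ≤ _ := by
      gcongr
      linarith

lemma H1_ge (k : ℕ) (hk : 3 ≤ k) (c0 η b : ℝ) (hc0 : 0 < c0) (hη : 0 < η) (hb : 1 ≤ b) :
    ∃ C1, 0 ≤ C1 ∧ ∀ z : UU, sqd 0 z.1.1 ≤ 1 / 4 → 1 ≤ z.1.2 →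
    (∀ m, 2 ≤ m → m < k → ev z (F.EE m) ≤ b) →
    F.RR k z ≤ c0 * ev z (F.EE (k + 1)) + η * ev z (F.EE k) ^ 2 + C1 := by
  obtain ⟨C, hC, h⟩ := F.RR_scale k
  set ε := min 1 (c0 / (C + 1)) with hε
  have hεp : 0 < ε := by positivity
  have hε1 : ε ≤ 1 := min_le_left _ _
  have hεc : C * ε ≤ c0 := by
    have : ε ≤ c0 / (C + 1) := min_le_right _ _
    rw [le_div_iff₀ (by positivity)] at this
    nlinarith
  set σ := η / (C + 1) with hσ
  have hσp : 0 < σ := by positivity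
  have hσc : C * σ ≤ η := by
    have : σ * (C + 1) = η := by rw [hσ]; field_simp
    nlinarith
  refine ⟨C * (b ^ (2 * k) + (1 / ε ^ 2) ^ 4 / σ ^ 3), by positivity, fun z hz hs hlow => ?_⟩
  set X := √(ev z (F.EE k)) with hX
  set Y := √(ev z (F.EE (k + 1))) with hY
  have hXs : X ^ 2 = ev z (F.EE k) := Real.sq_sqrt (F.EE_nonneg k z)
  have hYs : Y ^ 2 = ev z (F.EE (k + 1)) := Real.sq_sqrt (F.EE_nonneg (k + 1) z)
  obtain ⟨Θ, t1, t2, t3, t4⟩ := exists_scale k (by omega) b X Y hb (Real.sqrt_nonneg _) (Real.sqrt_nonneg _)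
  have h1 := h z hz hs Θ (hb.trans t1) (F.scale_jets k b Θ hb t1 z hlow (by omega) t2 t3)
  have h2 := young3 k hk b ε σ X Y Θ hεp hε1 hσp hb (Real.sqrt_nonneg _) t2 t1 t4
  rw [← hYs, ← hXs]
  calc F.RR k z ≤ C * (X * Θ ^ (k + 1)) := by rw [← mul_assoc]; exact h1
    _ ≤ C * (ε * Y ^ 2 + σ * X ^ 4 + (b ^ (2 * k) + (1 / ε ^ 2) ^ 4 / σ ^ 3)) := by gcongr
    _ = (C * ε) * Y ^ 2 + (C * σ) * (X ^ 2) ^ 2 + C * (b ^ (2 * k) + (1 / ε ^ 2) ^ 4 / σ ^ 3) := by ring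
    _ ≤ _ := by gcongr

end DFlow

end


open Real Filter Topology
open scoped ContDiff

noncomputable section

namespace DFlow
variable {Λ : ℝ} (F : DFlow Λ)

lemma hp_mul_self (f g : S UU) : F.hp (f * g) (f * g) =
    f ^ 2 * F.hp g g + 2 * f * g * F.hp f g + g ^ 2 * F.hp f f := by
  simp only [hp, _root_.hp, Fin.sum_univ_three, Derivation.leibniz, smul_eq_mul]
  rw [F.hs 1 0, F.hs 2 0, F.hs 2 1]; ring

lemma hp_comb (z : UU) (a b : ℝ) (f g : S UU) : ev z (F.hp (a • f + b • g) (a • f + b • g)) =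
    a ^ 2 * ev z (F.hp f f) + 2 * a * b * ev z (F.hp f g) + b ^ 2 * ev z (F.hp g g) := by
  simp only [ev_hp, Fin.sum_univ_three, map_add, Derivation.map_smul, map_smul, smul_eq_mul]
  rw [F.hs 1 0, F.hs 2 0, F.hs 2 1]; ring

lemma P_cutoff (z : UU) (ρ j : S UU) : ev z (F.P (ρ ^ 2 * j ^ 2)) ≤
    ev z ρ ^ 2 * (2 * (ev z j * ev z (F.P j)) - ev z (F.hp j j)) +
    ev z j ^ 2 * (2 * ev z ρ * ev z (F.P ρ) + 14 * ev z (F.hp ρ ρ)) := by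
  have e : ρ ^ 2 * j ^ 2 = (ρ * j) * (ρ * j) := by ring
  have h := F.hp_nonneg z ((ev z ρ) • j + (4 * ev z j) • ρ)
  rw [hp_comb, F.hp_symm j ρ] at h
  rw [e, P_mul, P_mul, hp_mul_self]
  simp only [map_sub, map_add, map_mul, map_ofNat, map_pow]
  linarith

/-- cutoff -/
def cut (r : ℝ) : S UU := cS r - sqS 0

lemma ev_cut (r : ℝ) (z : UU) : ev z (cut r) = r - sqd 0 z.1.1 := by
  rw [cut, map_sub, ev_cS, ev_sqS]

lemma ev_DD_sqS (i : Fin 3) (z : UU) : ev z (DD i (sqS 0)) = 2 * z.1.1 i := by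
  have : DD i (sqS 0) = 2 * xS i := by
    simp only [sqS, pow_two, Derivation.leibniz, map_add, map_sub, DD_xS, Derivation.map_algebraMap, smul_eq_mul, Fin.sum_univ_three, kA]
    fin_cases i <;> simp <;> ring
  rw [this, map_mul, map_ofNat, ev_xS]

lemma hp_cut (r : ℝ) (z : UU) (hz : sqd 0 z.1.1 ≤ 1 / 4) (B0 : ℝ) (hW : |ev z F.W| ≤ B0) :
    ev z (F.hp (cut r) (cut r)) ≤ 1 + B0 := by
  have e : ∀ i, ev z (DD i (cut r)) = - (2 * z.1.1 i) := by
    intro i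
    rw [cut, map_sub, Derivation.map_algebraMap, zero_sub, map_neg, ev_DD_sqS]
  rw [ev_hp_self]
  simp only [e]
  have h1 : ∑ i, (-(2 * z.1.1 i)) ^ 2 ≤ 1 := by
    rw [sqd_zero] at hz
    have : ∑ i, (-(2 * z.1.1 i)) ^ 2 = 4 * ∑ i, z.1.1 i ^ 2 := by
      rw [Finset.mul_sum]; refine Finset.sum_congr rfl fun i _ => by ring
    linarith
  have h2 := Finset.sum_mul_sq_le_sq_mul_sq Finset.univ (fun i => ev z (DD i F.τ)) (fun i => -(2 * z.1.1 i))
  rw [← ev_qq, ← EE_one] at h2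
  have h3 := F.EE_one_le z
  have h4 := F.EE_nonneg 1 z
  have h5 : 0 ≤ ∑ i, (-(2 * z.1.1 i)) ^ 2 := by positivity
  have h6 : (∑ i, ev z (DD i F.τ) * -(2 * z.1.1 i)) ^ 2 ≤ 1 := h2.trans (mul_le_one₀ h3 h5 h1)
  have h7 : ev z F.v ^ 2 ≤ B0 := by rw [← evW]; exact (le_abs_self _).trans hW
  have h8 : ev z F.τ ^ 2 ≤ 1 := pow_le_one₀ (F.τpos z).le (F.τle z)
  have h9 : ev z F.v ^ 2 * (∑ i, ev z (DD i F.τ) * -(2 * z.1.1 i)) ^ 2 ≤ B0 * 1 :=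
    mul_le_mul h7 h6 (by positivity) ((abs_nonneg _).trans hW)
  have h10 := F.vpos z
  calc _ ≤ 1 * (1 + B0) := by
        apply mul_le_mul h8 (by linarith) (by positivity) zero_le_one
    _ = _ := one_mul _

lemma P_cut (r : ℝ) (z : UU) (B0 : ℝ) (hW : |ev z F.W| ≤ B0) :
    ev z (F.P (cut r)) ≤ 2 * (2 + B0) := by
  rw [cut, P_sub, P_cS, P_sqS]
  simp only [map_sub, map_mul, map_add, map_neg, map_ofNat, map_pow, map_zero]
  have h8 : ev z F.τ ^ 2 ≤ 1 := pow_le_one₀ (F.τpos z).le (F.τle z)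
  have h7 : ev z F.W ≤ B0 := (le_abs_self _).trans hW
  have h9 : 0 ≤ ev z F.W := by rw [evW]; positivity
  have : ev z F.τ ^ 2 * (2 + ev z F.W) ≤ 1 * (2 + B0) := by gcongr
  linarith

lemma P_cut_EE (k : ℕ) (r : ℝ) (hr : r ≤ 1 / 4) (z : UU) (hz : sqd 0 z.1.1 ≤ r) (B0 : ℝ) (hW : |ev z F.W| ≤ B0) :
    ev z (F.P (cut r ^ 2 * F.EE k)) ≤ ev z (cut r) ^ 2 * (F.RR k z - ev z F.Fs ^ 2 * ev z (F.EE (k + 1)))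
      + (22 + 18 * B0) * ev z (F.EE k) := by
  have hB0 : 0 ≤ B0 := (abs_nonneg _).trans hW
  have hρ0 : 0 ≤ ev z (cut r) := by rw [ev_cut]; linarith
  have hρ1 : ev z (cut r) ≤ 1 := by rw [ev_cut]; linarith [sqd_nonneg 0 z.1.1]
  have h1 := F.P_cut r z B0 hW
  have h2 := F.hp_cut r z (hz.trans hr) B0 hW
  have h3 : 2 * ev z (cut r) * ev z (F.P (cut r)) + 14 * ev z (F.hp (cut r) (cut r)) ≤ 22 + 18 * B0 := by
    have : ev z (cut r) * ev z (F.P (cut r)) ≤ 1 * (2 * (2 + B0)) := by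
      calc _ ≤ ev z (cut r) * (2 * (2 + B0)) := by gcongr
        _ ≤ _ := by gcongr
    linarith
  have h4 : ev z (F.P (cut r ^ 2 * F.EE k)) ≤ ∑ f : Fin k → Fin 3,
     (ev z (cut r) ^ 2 * (2 * (ev z (F.jet (List.ofFn f)) * ev z (F.Rj (List.ofFn f)))
        - ev z (F.hp (F.jet (List.ofFn f)) (F.jet (List.ofFn f)))) +
      ev z (F.jet (List.ofFn f)) ^ 2 * (22 + 18 * B0)) := by
    rw [EE, Finset.mul_sum, P_sum, map_sum]
    refine Finset.sum_le_sum fun f _ => ?_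
    refine (F.P_cutoff z (cut r) (F.jet (List.ofFn f))).trans ?_
    rw [Rj]
    gcongr
  refine h4.trans ?_
  rw [Finset.sum_add_distrib, ← Finset.mul_sum, ← Finset.sum_mul, Finset.sum_sub_distrib, ← Finset.mul_sum, ← ev_EE, ← RR, mul_comm (ev z (F.EE k))]
  have := F.sum_hp_lower k z
  gcongr

/-- the Bernstein step -/
lemma bern_step (m : ℕ) (r s0 c0 η C1 C2 B : ℝ) (hr : r ≤ 1 / 4) (hs0 : 1 ≤ s0) (hc0 : 0 < c0)
    (hη : 0 ≤ η) (hC1 : 0 ≤ C1) (hC2 : 0 ≤ C2) (hB : 0 ≤ B) (hηB : η * B ≤ c0 / 8)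
    (hF : ∀ z : UU, sqd 0 z.1.1 ≤ r → s0 ≤ z.1.2 → c0 ≤ ev z F.Fs ^ 2)
    (hE : ∀ z : UU, sqd 0 z.1.1 ≤ r → s0 ≤ z.1.2 → ev z (F.EE m) ≤ B)
    (h1 : ∀ z : UU, sqd 0 z.1.1 ≤ r → s0 ≤ z.1.2 →
      F.RR (m + 1) z ≤ c0 * ev z (F.EE (m + 2)) + η * ev z (F.EE (m + 1)) ^ 2 + C1)
    (h2 : ∀ z : UU, sqd 0 z.1.1 ≤ r → s0 ≤ z.1.2 → F.RR m z ≤ c0 * ev z (F.EE (m + 1)) + C2) :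
    ∃ M, 0 ≤ M ∧ ∀ z : UU, sqd 0 z.1.1 ≤ r → s0 ≤ z.1.2 → (r - sqd 0 z.1.1) ^ 2 * ev z (F.EE (m + 1)) ≤ M := by
  obtain ⟨B0, c1, hB0, _, hbas⟩ := F.basic
  have hcyl : ∀ x s, sqd 0 x ≤ r → s0 ≤ s → ((x, s) : E4) ∈ UU :=
    fun x s hx hs => cyl4 x s (by linarith) (by linarith)
  obtain ⟨Ci, hCi, hinit⟩ := slice_bdd (cut r ^ 2 * F.EE (m + 1)) 0 r s0 (fun x hx => hcyl x s0 hx le_rfl)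
  set C3 := (22 + 18 * B0) + c0 * (C1 + 1) with hC3
  have hC3p : 0 < C3 := by positivity
  set M := 8 * C3 * B / c0 + 4 * (C2 + 1) / c0 + 2 * Ci + 1 with hM
  have hMp : 0 < M := by positivity
  set K := (2 * η * M + 2 * C3) / c0 with hK
  have hKc : K * c0 = 2 * η * M + 2 * C3 := by rw [hK]; field_simp
  have hKp : 0 < K := by positivity
  have hK1 : C1 + 1 ≤ K := by
    by_contra! h
    have : K * c0 < (C1 + 1) * c0 := by gcongr
    have : 0 ≤ η * M := by positivity
    nlinarith
  have hM1 : 8 * C3 * B ≤ M * c0 := by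
    have : M * c0 = 8 * C3 * B + 4 * (C2 + 1) + (2 * Ci + 1) * c0 := by rw [hM]; field_simp; ring
    have : 0 ≤ (2 * Ci + 1) * c0 := by positivity
    linarith
  have hM2 : 4 * (C2 + 1) ≤ M * c0 := by
    have : M * c0 = 8 * C3 * B + 4 * (C2 + 1) + (2 * Ci + 1) * c0 := by rw [hM]; field_simp; ring
    have : 0 ≤ (2 * Ci + 1) * c0 := by positivity
    have : 0 ≤ 8 * C3 * B := by positivity
    linarith
  have hM3 : 2 * Ci < M := by
    have : 0 ≤ 8 * C3 * B / c0 + 4 * (C2 + 1) / c0 := by positivity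
    linarith
  have hKB : K * B ≤ M / 2 := by
    have e : (K * B) * c0 ≤ (M / 2) * c0 := by
      have : (K * B) * c0 = 2 * (η * B) * M + 2 * C3 * B := by linear_combination B * hKc
      have : (η * B) * M ≤ c0 / 8 * M := by gcongr
      linarith
    exact le_of_mul_le_mul_right e hc0
  set g : S UU := cut r ^ 2 * F.EE (m + 1) + K • F.EE m - cS M with hg
  have evg : ∀ z, ev z g = (r - sqd 0 z.1.1) ^ 2 * ev z (F.EE (m + 1)) + K * ev z (F.EE m) - M := by
    intro z; rw [hg, map_sub, map_add, map_mul, map_pow, map_smul, ev_cut, ev_cS, smul_eq_mul]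
  have key := maxP hUU g 0 r s0 hcyl
    (fun z hz hs => by
      have a1 := hinit z hz hs
      rw [map_mul, map_pow, ev_cut] at a1
      have a2 := le_abs_self ((r - sqd 0 z.1.1) ^ 2 * ev z (F.EE (m + 1)))
      have a3 : K * ev z (F.EE m) ≤ K * B := by gcongr; exact hE z hz hs.ge
      rw [evg]; linarith)
    (fun z hz hs => by
      have a3 : K * ev z (F.EE m) ≤ K * B := by gcongr; exact hE z hz.le hs
      rw [evg, hz]
      linarith)
    (fun z hz hs h0 ht => by
      have a0 := F.touch_P g z ht
      rw [hg, P_sub, P_add, P_smul, P_cS, sub_zero, map_add, map_smul, smul_eq_mul] at a0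
      obtain ⟨-, -, b3, -⟩ := hbas z (hz.le.trans hr) (hs0.trans hs.le)
      have a1 := F.P_cut_EE (m + 1) r hr z hz.le B0 b3
      have a2 := F.P_EE m z
      have a3 := h1 z hz.le hs.le
      have a4 := h2 z hz.le hs.le
      have a5 := hF z hz.le hs.le
      have a6 := F.EE_nonneg (m + 1) z
      have a7 := F.EE_nonneg (m + 2) z
      have a8 := F.EE_nonneg m z
      have a9 : K * ev z (F.EE m) ≤ K * B := by gcongr; exact hE z hz.le hs.le
      rw [evg] at h0
      have hρ0 : 0 ≤ r - sqd 0 z.1.1 := by linarith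
      have hρ1 : r - sqd 0 z.1.1 ≤ 1 := by linarith [sqd_nonneg 0 z.1.1]
      rw [ev_cut] at a1
      set ρ := r - sqd 0 z.1.1
      set E := ev z (F.EE (m + 1))
      have hρ2 : ρ ^ 2 ≤ 1 := pow_le_one₀ hρ0 hρ1
      have c1 : ρ ^ 2 * E ≤ M := by
        have : 0 ≤ K * ev z (F.EE m) := by positivity
        linarith
      have c2 : M / 2 ≤ E := by
        have : ρ ^ 2 * E ≤ 1 * E := by gcongr
        linarith
      have c3 : c0 * ev z (F.EE (m + 2)) ≤ ev z F.Fs ^ 2 * ev z (F.EE (m + 1 + 1)) := by gcongr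
      have c4 : c0 * E ≤ ev z F.Fs ^ 2 * E := by gcongr
      have c5 : ρ ^ 2 * (F.RR (m + 1) z - ev z F.Fs ^ 2 * ev z (F.EE (m + 1 + 1))) ≤ η * M * E + C1 := by
        calc _ ≤ ρ ^ 2 * (η * E ^ 2 + C1) := by gcongr; linarith
          _ = η * E * (ρ ^ 2 * E) + ρ ^ 2 * C1 := by ring
          _ ≤ η * E * M + 1 * C1 := by gcongr
          _ = _ := by ring
      have c6 : K * ev z (F.P (F.EE m)) ≤ K * (C2 - c0 * E) := by gcongr; linarith
      have c7 : K * (C2 - c0 * E) = K * C2 - (2 * η * M + 2 * C3) * E := by rw [← hKc]; ring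
      have c8 : (22 + 18 * B0) * E ≤ C3 * E := by
        have : 0 ≤ c0 * (C1 + 1) := by positivity
        gcongr; linarith
      have c9 : 0 ≤ K * C2 + C1 - (η * M + C3) * E := by linarith
      have c10 : (η * M + C3) * E = K * (c0 * E / 2) := by linear_combination -(E / 2) * hKc
      have c11 : C2 + 1 ≤ c0 * E / 2 := by
        have : c0 * (M / 2) ≤ c0 * E := by gcongr
        linarith
      have c12 : K * (C2 + 1) ≤ K * (c0 * E / 2) := by gcongr
      linarith)
  refine ⟨M, hMp.le, fun z hz hs => ?_⟩
  have a1 := key z hz hs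
  rw [evg] at a1
  have : 0 ≤ K * ev z (F.EE m) := mul_nonneg hKp.le (F.EE_nonneg m z)
  linarith

/-- boundedness of the energies -/
def Bdd (k : ℕ) : Prop := ∀ r, r < 1 / 4 → ∃ s0 B, 1 ≤ s0 ∧ 1 ≤ B ∧
  ∀ z : UU, sqd 0 z.1.1 ≤ r → s0 ≤ z.1.2 → ev z (F.EE k) ≤ B

lemma exists_exp_le (B δ : ℝ) (hδ : 0 < δ) : ∃ s0, 1 ≤ s0 ∧ ∀ s, s0 ≤ s → B * Real.exp (-2 * s) ≤ δ := by
  have : Tendsto (fun s : ℝ => B * Real.exp (-2 * s)) atTop (𝓝 (B * 0)) := by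
    refine Tendsto.const_mul _ (Real.tendsto_exp_atBot.comp ?_)
    exact tendsto_id.const_mul_atTop_of_neg (by norm_num)
  rw [mul_zero] at this
  obtain ⟨s1, h⟩ := eventually_atTop.1 (this.eventually_le_const hδ)
  exact ⟨max 1 s1, le_max_left _ _, fun s hs => h s ((le_max_right _ _).trans hs)⟩

lemma EE_one_small (δ : ℝ) (hδ : 0 < δ) : ∃ s0, 1 ≤ s0 ∧
    ∀ z : UU, sqd 0 z.1.1 ≤ 1 / 4 → s0 ≤ z.1.2 → ev z (F.EE 1) ≤ δ := by
  obtain ⟨B, hB, h⟩ := F.v_decay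
  obtain ⟨s0, h1, h2⟩ := exists_exp_le B δ hδ
  refine ⟨s0, h1, fun z hz hs => ?_⟩
  rw [EE_one]
  exact (h z hz (h1.trans hs)).trans (h2 _ hs)

lemma bdd_of_step {k : ℕ} (h : ∀ r, r < 1 / 4 → ∃ s0 M, 1 ≤ s0 ∧ 0 ≤ M ∧
    ∀ z : UU, sqd 0 z.1.1 ≤ r → s0 ≤ z.1.2 → (r - sqd 0 z.1.1) ^ 2 * ev z (F.EE k) ≤ M) : F.Bdd k := by
  intro r hr
  obtain ⟨s0, M, hs0, hM, h⟩ := h ((r + 1 / 4) / 2) (by linarith)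
  set d := ((1 / 4 - r) / 2) ^ 2 with hd
  have hdp : 0 < d := by have : 0 < 1 / 4 - r := by linarith
                         positivity
  refine ⟨s0, M / d + 1, hs0, by have : 0 ≤ M / d := by positivity
                                 linarith, fun z hz hs => ?_⟩
  have h1 := h z (by linarith) hs
  have h2 : d ≤ ((r + 1 / 4) / 2 - sqd 0 z.1.1) ^ 2 := by
    rw [hd]
    apply pow_le_pow_left₀ <;> linarith
  have h3 : ev z (F.EE k) ≤ M / d := by
    rw [le_div_iff₀ hdp]
    have := mul_le_mul_of_nonneg_right h2 (F.EE_nonneg k z)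
    linarith
  linarith

lemma bdd_two : F.Bdd 2 := by
  obtain ⟨B0, c0, hB0, hc0, hbas⟩ := F.basic
  obtain ⟨η, C1, hη, hC1, hH1⟩ := F.H1_two c0 hc0
  obtain ⟨C, hC, hH2⟩ := F.RR_one
  set B := min (c0 / (8 * η)) ((c0 / (C + 1)) ^ 2) with hB
  have hBp : 0 < B := by positivity
  obtain ⟨s0, hs0, hsm⟩ := F.EE_one_small B hBp
  apply F.bdd_of_step
  intro r hr
  obtain ⟨M, hM, h⟩ := F.bern_step 1 r s0 c0 η C1 c0 B hr.le hs0 hc0 hη.le hC1 hc0.le hBp.le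
    (by
      have : B ≤ c0 / (8 * η) := min_le_left _ _
      calc η * B ≤ η * (c0 / (8 * η)) := by gcongr
        _ = c0 / 8 := by field_simp)
    (fun z hz hs => (hbas z (by linarith) (hs0.trans hs)).2.2.2)
    (fun z hz hs => hsm z (by linarith) hs)
    (fun z hz hs => hH1 z (by linarith) (hs0.trans hs))
    (fun z hz hs => by
      have h1 := hH2 z (by linarith) (hs0.trans hs)
      have h2 := hsm z (by linarith) hs
      have h3 : √(ev z (F.EE 1)) ≤ c0 / (C + 1) := by
        rw [Real.sqrt_le_left (by positivity)]
        exact h2.trans (min_le_right _ _)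
      have h4 : C * √(ev z (F.EE 1)) ≤ c0 := by
        have h5 := Real.sqrt_nonneg (ev z (F.EE 1))
        rw [le_div_iff₀ (by positivity)] at h3
        linarith
      have h6 := F.EE_nonneg 2 z
      have : C * √(ev z (F.EE 1)) * (1 + ev z (F.EE 2)) ≤ c0 * (1 + ev z (F.EE 2)) := by gcongr
      linarith)
  exact ⟨s0, M, hs0, hM, h⟩

lemma bdd_unif (k : ℕ) (h : ∀ m, 2 ≤ m → m < k → F.Bdd m) (r : ℝ) (hr : r < 1 / 4) :
    ∃ s0 B, 1 ≤ s0 ∧ 1 ≤ B ∧ ∀ m, 2 ≤ m → m < k →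
      ∀ z : UU, sqd 0 z.1.1 ≤ r → s0 ≤ z.1.2 → ev z (F.EE m) ≤ B := by
  induction k with
  | zero => exact ⟨1, 1, le_rfl, le_rfl, fun m _ h => by omega⟩
  | succ k ih =>
    obtain ⟨s0, B, h1, h2, h3⟩ := ih (fun m a b => h m a (by omega))
    rcases Nat.lt_or_ge k 2 with hk | hk
    · exact ⟨1, 1, le_rfl, le_rfl, fun m _ h => by omega⟩
    obtain ⟨s1, B1, h4, h5, h6⟩ := h k hk (by omega) r hr
    refine ⟨max s0 s1, max B B1, h1.trans (le_max_left _ _), h2.trans (le_max_left _ _), fun m a b z hz hs => ?_⟩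
    rcases Nat.lt_or_ge m k with hm | hm
    · exact (h3 m a hm z hz ((le_max_left _ _).trans hs)).trans (le_max_left _ _)
    · obtain rfl : m = k := by omega
      exact (h6 z hz ((le_max_right _ _).trans hs)).trans (le_max_right _ _)

lemma bdd_ge_two (k : ℕ) (hk : 2 ≤ k) : F.Bdd k := by
  induction k using Nat.strong_induction_on with
  | _ k ih =>
  rcases hk.lt_or_eq with hk3 | rfl
  swap
  · exact F.bdd_two
  obtain ⟨m, rfl⟩ : ∃ m, k = m + 1 := ⟨k - 1, by omega⟩
  apply F.bdd_of_step
  intro r hr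
  obtain ⟨B0, c0, hB0, hc0, hbas⟩ := F.basic
  obtain ⟨s0, B, hs0, hB, hlow⟩ := F.bdd_unif (m + 1) (fun m' a b => ih m' b a) r hr
  set η := c0 / (8 * B) with hη
  have hηp : 0 < η := by positivity
  have hηB : η * B = c0 / 8 := by rw [hη]; field_simp
  obtain ⟨C1, hC1, hH1⟩ := F.H1_ge (m + 1) (by omega) c0 η B hc0 hηp hB
  obtain ⟨C2, hC2, hH2⟩ : ∃ C2, 0 ≤ C2 ∧ ∀ z : UU, sqd 0 z.1.1 ≤ r → s0 ≤ z.1.2 →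
      F.RR m z ≤ c0 * ev z (F.EE (m + 1)) + C2 := by
    have hm : ∀ z : UU, sqd 0 z.1.1 ≤ r → s0 ≤ z.1.2 → ev z (F.EE m) ^ 2 ≤ B ^ 2 := fun z hz hs => by
      have := F.EE_nonneg m z
      have := hlow m (by omega) (by omega) z hz hs
      gcongr
    rcases Nat.lt_or_ge m 3 with h | h
    · obtain rfl : m = 2 := by omega
      obtain ⟨η', C, hη', hC, hH⟩ := F.H1_two c0 hc0
      refine ⟨η' * B ^ 2 + C, by positivity, fun z hz hs => ?_⟩
      have := hH z (by linarith) (hs0.trans hs)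
      have := mul_le_mul_of_nonneg_left (hm z hz hs) hη'.le
      linarith
    · obtain ⟨C, hC, hH⟩ := F.H1_ge m h c0 1 B hc0 one_pos hB
      refine ⟨B ^ 2 + C, by positivity, fun z hz hs => ?_⟩
      have := hH z (by linarith) (hs0.trans hs) (fun m' a b => hlow m' a (by omega) z hz hs)
      have := hm z hz hs
      linarith
  obtain ⟨M, hM, h⟩ := F.bern_step m r s0 c0 η C1 C2 B hr.le hs0 hc0 hηp.le hC1 hC2 (by linarith) hηB.le
    (fun z hz hs => (hbas z (by linarith) (hs0.trans hs)).2.2.2)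
    (fun z hz hs => hlow m (by omega) (by omega) z hz hs)
    (fun z hz hs => hH1 z (by linarith) (hs0.trans hs) (fun m' a b => hlow m' a b z hz hs))
    hH2
  exact ⟨s0, M, hs0, hM, h⟩

end DFlow

end


open Real Filter Topology
open scoped ContDiff

noncomputable section

lemma interp (φ φ1 φ2 : ℝ → ℝ) (κ ε B : ℝ) (hκ : 0 < κ)
    (h1 : ∀ t ∈ Set.Icc 0 κ, HasDerivAt φ (φ1 t) t) (h2 : ∀ t ∈ Set.Icc 0 κ, HasDerivAt φ1 (φ2 t) t)
    (hB : ∀ t ∈ Set.Icc 0 κ, |φ2 t| ≤ B) (h0 : |φ 0| ≤ ε) (hk : |φ κ| ≤ ε) :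
    |φ1 0| ≤ 2 * ε / κ + B * κ := by
  have hB0 : 0 ≤ B := (abs_nonneg _).trans (hB 0 ⟨le_rfl, hκ.le⟩)
  obtain ⟨c, hc, hc'⟩ := exists_hasDerivAt_eq_slope φ φ1 hκ
    (fun t ht => (h1 t ht).continuousAt.continuousWithinAt) (fun t ht => h1 t ⟨ht.1.le, ht.2.le⟩)
  obtain ⟨d, hd, hd'⟩ := exists_hasDerivAt_eq_slope φ1 φ2 hc.1
    (fun t ht => (h2 t ⟨ht.1, ht.2.trans hc.2.le⟩).continuousAt.continuousWithinAt)
    (fun t ht => h2 t ⟨ht.1.le, ht.2.le.trans hc.2.le⟩)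
  have e1 : |φ1 c| ≤ 2 * ε / κ := by
    rw [hc', sub_zero, abs_div, abs_of_pos hκ]
    gcongr
    have := abs_sub (φ κ) (φ 0)
    linarith
  have e2 : |φ1 c - φ1 0| ≤ B * κ := by
    have := hB d ⟨hd.1.le, hd.2.le.trans hc.2.le⟩
    rw [hd', sub_zero, abs_div, abs_of_pos hc.1, div_le_iff₀ hc.1] at this
    exact this.trans (mul_le_mul_of_nonneg_left hc.2.le hB0)
  have := abs_sub_abs_le_abs_sub (φ1 0) (φ1 c)
  rw [abs_sub_comm] at this
  linarith

/-- curve in a coordinate direction -/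
def cur (x : V3) (s : ℝ) (i : Fin 3) (t : ℝ) : E4 := (x, s) + (t * Real.exp (-3 * s)) • bx i

lemma cur_snd (x : V3) (s : ℝ) (i : Fin 3) (t : ℝ) : (cur x s i t).2 = s := by
  simp [cur, bx]

lemma cur_zero (x : V3) (s : ℝ) (i : Fin 3) : cur x s i 0 = (x, s) := by
  simp [cur]

lemma cur_sqd (x : V3) (s : ℝ) (i : Fin 3) (t : ℝ) (hs : 0 ≤ s) (hx : sqd 0 x ≤ 1 / 4) (ht : 0 ≤ t) (ht1 : t ≤ 1) :
    sqd 0 (cur x s i t).1 ≤ sqd 0 x + 2 * t := by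
  set a := t * Real.exp (-3 * s) with ha
  have he : Real.exp (-3 * s) ≤ 1 := Real.exp_le_one_iff.2 (by linarith)
  have ha0 : 0 ≤ a := by positivity
  have hat : a ≤ t := mul_le_of_le_one_right ht he
  have e : sqd 0 (cur x s i t).1 = sqd 0 x + 2 * a * x i + a ^ 2 := by
    rw [cur, ← ha]
    clear_value a
    fin_cases i <;> simp [sqd, bx, Fin.sum_univ_three] <;> ring
  have hxi : x i ^ 2 ≤ 1 / 4 := by
    refine le_trans ?_ hx
    have := Finset.single_le_sum (f := fun i => (x i - (0 : V3) i) ^ 2) (fun j _ => sq_nonneg _) (Finset.mem_univ i)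
    simpa [sqd] using this
  have hxi' : x i ≤ 1 / 2 := by nlinarith
  rw [e]
  nlinarith

lemma cur_mem (x : V3) (s : ℝ) (i : Fin 3) (t : ℝ) (hs : 0 < s) (h : sqd 0 (cur x s i t).1 ≤ 25) :
    cur x s i t ∈ UU := by
  have := sqd_mem (y := 0) (x := (cur x s i t).1) (s := s) (by simp) h hs
  have e : cur x s i t = ((cur x s i t).1, s) := Prod.ext rfl (cur_snd x s i t)
  rw [e]; exact this

lemma cur_deriv (f : S UU) (x : V3) (s : ℝ) (i : Fin 3) (t : ℝ) (h : cur x s i t ∈ UU) :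
    HasDerivAt (fun t => fx f (cur x s i t)) (fx (del i f) (cur x s i t)) t := by
  have h1 : HasDerivAt (fun t => cur x s i t) (Real.exp (-3 * s) • bx i) t := by
    have : HasDerivAt (fun t : ℝ => t * Real.exp (-3 * s)) (Real.exp (-3 * s)) t := by
      simpa using (hasDerivAt_id t).mul_const (Real.exp (-3 * s))
    exact (this.smul_const (bx i)).const_add _
  have h2 := (fx_diff hUU f ⟨_, h⟩).hasFDerivAt.comp_hasDerivAt t h1
  have e : fx (del i f) (cur x s i t) = fderiv ℝ (fx f) (cur x s i t) (Real.exp (-3 * s) • bx i) := by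
    rw [fx_apply' _ _ h, del_apply, map_mul, ev_eS, ev_dS, map_smul, smul_eq_mul, cur_snd]
  rw [e]
  exact h2

namespace DFlow
variable {Λ : ℝ} (F : DFlow Λ)

/-- decay of the jets -/
def Dec (k : ℕ) : Prop := ∀ r, r < 1 / 4 → ∀ ε, 0 < ε → ∃ s0, 1 ≤ s0 ∧ ∀ l : List (Fin 3), l.length = k →
  ∀ z : UU, sqd 0 z.1.1 ≤ r → s0 ≤ z.1.2 → |ev z (F.jet l)| ≤ ε

lemma dec_one : F.Dec 1 := by
  intro r hr ε hε
  obtain ⟨s0, h0, h⟩ := F.EE_one_small (ε ^ 2) (by positivity)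
  refine ⟨s0, h0, fun l hl z hz hs => ?_⟩
  have h1 := F.jet_le_sqrt l z
  rw [hl] at h1
  refine h1.trans ?_
  rw [Real.sqrt_le_left hε.le]
  exact h z (by linarith) hs

lemma dec_succ (k : ℕ) (h : F.Dec k) : F.Dec (k + 1) := by
  intro r hr ε hε
  set r' := (r + 1 / 4) / 2 with hr'
  obtain ⟨s1, B, hs1, hB, hb⟩ := F.bdd_ge_two (k + 2) (by omega) r' (by linarith)
  have hsB : 0 ≤ √B := Real.sqrt_nonneg _
  set κ := min (min 1 ((1 / 4 - r) / 4)) (ε / (2 * (√B + 1))) with hκ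
  have hκ0 : 0 < κ := by
    have : 0 < 1 / 4 - r := by linarith
    positivity
  have hκ1 : κ ≤ 1 := (min_le_left _ _).trans (min_le_left _ _)
  have hκ2 : κ ≤ (1 / 4 - r) / 4 := (min_le_left _ _).trans (min_le_right _ _)
  have hκ3 : √B * κ ≤ ε / 2 := by
    have : κ ≤ ε / (2 * (√B + 1)) := min_le_right _ _
    rw [le_div_iff₀ (by positivity)] at this
    nlinarith
  obtain ⟨s2, hs2, hd⟩ := h r' (by linarith) (ε * κ / 4) (by positivity)
  refine ⟨max s1 s2, hs1.trans (le_max_left _ _), fun l hl z hz hs => ?_⟩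
  obtain ⟨⟨x, s⟩, hzU⟩ := z
  simp only at hz hs
  have hss1 : s1 ≤ s := (le_max_left _ _).trans hs
  have hss2 : s2 ≤ s := (le_max_right _ _).trans hs
  match l, hl with
  | i :: l, hl =>
    simp only [List.length_cons, add_left_inj] at hl
    have hsq : ∀ t ∈ Set.Icc 0 κ, sqd 0 (cur x s i t).1 ≤ r' := fun t ht => by
      have := cur_sqd x s i t (by linarith) (by linarith) ht.1 (ht.2.trans hκ1)
      have := ht.2
      linarith
    have hmem : ∀ t ∈ Set.Icc 0 κ, cur x s i t ∈ UU := fun t ht =>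
      cur_mem x s i t (by linarith) (by have := hsq t ht; linarith)
    have key := interp (fun t => fx (F.jet l) (cur x s i t)) (fun t => fx (F.jet (i :: l)) (cur x s i t))
      (fun t => fx (F.jet (i :: i :: l)) (cur x s i t)) κ (ε * κ / 4) (√B) hκ0
      (fun t ht => cur_deriv _ x s i t (hmem t ht)) (fun t ht => cur_deriv _ x s i t (hmem t ht))
      (fun t ht => by
        rw [fx_apply' _ _ (hmem t ht)]
        refine (F.jet_le_sqrt _ _).trans (Real.sqrt_le_sqrt ?_)
        have := hb ⟨_, hmem t ht⟩ (hsq t ht) (by simpa [cur_snd] using hss1)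
        simpa [hl] using this)
      (by
        have ht : (0 : ℝ) ∈ Set.Icc 0 κ := ⟨le_rfl, hκ0.le⟩
        rw [fx_apply' _ _ (hmem 0 ht)]
        exact hd l hl ⟨_, hmem 0 ht⟩ (hsq 0 ht) (by simpa [cur_snd] using hss2))
      (by
        have ht : κ ∈ Set.Icc 0 κ := ⟨hκ0.le, le_rfl⟩
        rw [fx_apply' _ _ (hmem κ ht)]
        exact hd l hl ⟨_, hmem κ ht⟩ (hsq κ ht) (by simpa [cur_snd] using hss2))
    simp only [cur_zero] at key
    rw [fx_apply' _ _ hzU] at key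
    refine key.trans ?_
    have : 2 * (ε * κ / 4) / κ = ε / 2 := by field_simp; ring
    linarith

lemma dec (k : ℕ) (hk : 1 ≤ k) : F.Dec k := by
  induction k, hk using Nat.le_induction with
  | base => exact F.dec_one
  | succ k _ ih => exact F.dec_succ k ih

end DFlow

end


open Real Filter Topology
open scoped ContDiff

noncomputable section

namespace DFlow
variable {Λ : ℝ} (F : DFlow Λ)

/-- elements generated by jets, without weights -/
def GE (f : S UU) : Prop := ∃ d m, F.Gen d m f

variable {F}

lemma Gen.ge {d m f} (h : F.Gen d m f) : F.GE f := ⟨d, m, h⟩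

lemma GE.add {f g : S UU} (hf : F.GE f) (hg : F.GE g) : F.GE (f + g) := by
  obtain ⟨d, m, hf⟩ := hf
  obtain ⟨d', m', hg⟩ := hg
  exact ((hf.weaken (le_max_left d d') (le_max_left m m')).add
    (hg.weaken (le_max_right d d') (le_max_right m m'))).ge

lemma GE.mul {f g : S UU} (hf : F.GE f) (hg : F.GE g) : F.GE (f * g) := by
  obtain ⟨d, m, hf⟩ := hf
  obtain ⟨d', m', hg⟩ := hg
  exact ((hf.weaken le_rfl (le_max_left m m')).mul (hg.weaken le_rfl (le_max_right m m'))).ge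

lemma GE.zero : F.GE 0 := (Gen.zero 0 1 le_rfl).ge

lemma GE.sum {ι : Type*} (s : Finset ι) (f : ι → S UU) (h : ∀ i, F.GE (f i)) : F.GE (∑ i ∈ s, f i) := by
  classical
  induction s using Finset.induction_on with
  | empty => simpa using GE.zero
  | insert a s ha ih => rw [Finset.sum_insert ha]; exact (h a).add ih

lemma GE.del {f : S UU} (h : F.GE f) (i : Fin 3) : F.GE (_root_.del i f) := by
  obtain ⟨d, m, h⟩ := h
  exact (h.del i).ge

lemma DT_jet (l : List (Fin 3)) : DT (F.jet l) = F.Rj l + ∑ i, ∑ j, F.AA i j * F.jet (i :: j :: l) := by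
  rw [Rj, P_AA]
  simp only [jet]
  ring

lemma GE.DT_jet (l : List (Fin 3)) : F.GE (DT (F.jet l)) := by
  rw [DFlow.DT_jet]
  exact (Gen.Rj l).ge.add (GE.sum _ _ fun i => GE.sum _ _ fun j => (Gen.AA i j).ge.mul (Gen.jet i (j :: l)).ge)

lemma GE.DT {f : S UU} (h : F.GE f) : F.GE (_root_.DT f) := by
  obtain ⟨d, m, h⟩ := h
  induction h with
  | const c => rw [Derivation.map_algebraMap]; exact GE.zero
  | F => exact GE.DT_jet []
  | Fi =>
    rw [d_Fi, pow_two]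
    exact ((Gen.Fi.mul Gen.Fi).neg.ge).mul (GE.DT_jet [])
  | W =>
    rw [d_W, pow_two]
    exact (((Gen.W.mul Gen.W).ofNat_mul 2).ge).mul
      (GE.sum _ _ fun k => (Gen.jet k []).ge.mul (GE.DT_jet [k]))
  | jet k l => exact GE.DT_jet _
  | add _ _ h1 h2 => rw [map_add]; exact h1.add h2
  | mul hf hg h1 h2 =>
    rw [Derivation.leibniz, smul_eq_mul, smul_eq_mul]
    exact (hf.ge.mul h2).add (hg.ge.mul h1)
  | weaken _ h1 h2 h3 => exact h3

variable (F)

/-- small elements -/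
inductive Sml : S UU → Prop
  | zero : Sml 0
  | jet (i : Fin 3) (l : List (Fin 3)) : Sml (F.jet (i :: l))
  | add {f g} : Sml f → Sml g → Sml (f + g)
  | mul {f g} : F.GE f → Sml g → Sml (f * g)

variable {F}

lemma Sml.sum {ι : Type*} (s : Finset ι) (f : ι → S UU) (h : ∀ i, F.Sml (f i)) : F.Sml (∑ i ∈ s, f i) := by
  classical
  induction s using Finset.induction_on with
  | empty => simpa using Sml.zero
  | insert a s ha ih => rw [Finset.sum_insert ha]; exact (h a).add ih

lemma Sml.del {f : S UU} (h : F.Sml f) (i : Fin 3) : F.Sml (_root_.del i f) := by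
  induction h with
  | zero => rw [map_zero]; exact Sml.zero
  | jet k l => exact Sml.jet i (k :: l)
  | add _ _ h1 h2 => rw [map_add]; exact h1.add h2
  | @mul f g hf hg h =>
    rw [Derivation.leibniz, smul_eq_mul, smul_eq_mul, mul_comm g]
    exact (Sml.mul hf h).add (Sml.mul (hf.del i) hg)

lemma Sml.cmul {f : S UU} (c : ℝ) (h : F.Sml f) : F.Sml (cS c * f) := Sml.mul (Gen.const c).ge h

lemma Sml.smul {f : S UU} (c : ℝ) (h : F.Sml f) : F.Sml (c • f) := by
  rw [Algebra.smul_def]; exact h.cmul c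

lemma Sml.Rj (l : List (Fin 3)) : F.Sml (F.Rj l) := by
  induction l with
  | nil => rw [Rj_nil]; exact Sml.zero
  | cons i l ih =>
    have e : F.Rj (i :: l) = _root_.del i (F.Rj l)
      + (∑ j, ∑ k, _root_.del i (F.AA j k) * F.jet (j :: k :: l)) + (-3 : ℝ) • F.jet (i :: l) := by
      rw [Rj_cons, Algebra.smul_def, map_neg, map_ofNat]; ring
    rw [e]
    exact ((ih.del i).add (Sml.sum _ _ fun j => Sml.sum _ _ fun k =>
      Sml.mul ((Gen.AA j k).del i).ge (Sml.jet _ _))).add ((Sml.jet _ _).smul _)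

lemma Sml.DT_jet (l : List (Fin 3)) : F.Sml (DT (F.jet l)) := by
  rw [DFlow.DT_jet]
  exact (Sml.Rj l).add (Sml.sum _ _ fun i => Sml.sum _ _ fun j => Sml.mul (Gen.AA i j).ge (Sml.jet _ _))

lemma Sml.DT {f : S UU} (h : F.Sml f) : F.Sml (_root_.DT f) := by
  induction h with
  | zero => rw [map_zero]; exact Sml.zero
  | jet k l => exact Sml.DT_jet _
  | add _ _ h1 h2 => rw [map_add]; exact h1.add h2
  | @mul f g hf hg h =>
    rw [Derivation.leibniz, smul_eq_mul, smul_eq_mul, mul_comm g]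
    exact (Sml.mul hf h).add (Sml.mul hf.DT hg)

variable (F)

lemma dec_unif (m : ℕ) (r : ℝ) (hr : r < 1 / 4) : ∃ s0, 1 ≤ s0 ∧ ∀ i (l : List (Fin 3)), l.length + 1 ≤ m →
    ∀ z : UU, sqd 0 z.1.1 ≤ r → s0 ≤ z.1.2 → |ev z (F.jet (i :: l))| ≤ 1 := by
  induction m with
  | zero => exact ⟨1, le_rfl, fun i l h => by omega⟩
  | succ m ih =>
    obtain ⟨s0, h0, h⟩ := ih
    obtain ⟨s1, h1, h'⟩ := F.dec (m + 1) (by omega) r hr 1 one_pos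
    refine ⟨max s0 s1, h0.trans (le_max_left _ _), fun i l hl z hz hs => ?_⟩
    rcases Nat.lt_or_ge l.length m with hm | hm
    · exact h i l hm z hz ((le_max_left _ _).trans hs)
    · exact h' (i :: l) (by simp; omega) z hz ((le_max_right _ _).trans hs)

variable {F}

lemma GE.bdd {f : S UU} (h : F.GE f) (r : ℝ) (hr : r < 1 / 4) : ∃ s0 C, 1 ≤ s0 ∧ 0 ≤ C ∧
    ∀ z : UU, sqd 0 z.1.1 ≤ r → s0 ≤ z.1.2 → |ev z f| ≤ C := by
  obtain ⟨d, m, h⟩ := h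
  obtain ⟨B0, c0, hB0, _, hbas⟩ := F.basic
  obtain ⟨s0, hs0, hj⟩ := F.dec_unif m r hr
  obtain ⟨C, hC, hb⟩ := h.bound B0
  refine ⟨s0, C, hs0, hC, fun z hz hs => ?_⟩
  obtain ⟨b1, b2, b3, -⟩ := hbas z (by linarith) (hs0.trans hs)
  have := hb z 1 le_rfl b1 b2 b3 (fun i l hl => by simpa using hj i l hl z hz hs)
  simpa using this

lemma Sml.small {f : S UU} (h : F.Sml f) (r : ℝ) (hr : r < 1 / 4) : ∀ ε, 0 < ε → ∃ s0, 1 ≤ s0 ∧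
    ∀ z : UU, sqd 0 z.1.1 ≤ r → s0 ≤ z.1.2 → |ev z f| ≤ ε := by
  induction h with
  | zero => exact fun ε hε => ⟨1, le_rfl, fun z _ _ => by simpa using hε.le⟩
  | jet i l =>
    intro ε hε
    obtain ⟨s0, h0, h⟩ := F.dec (l.length + 1) (by omega) r hr ε hε
    exact ⟨s0, h0, fun z hz hs => h (i :: l) rfl z hz hs⟩
  | add _ _ h1 h2 =>
    intro ε hε
    obtain ⟨s1, a1, h1⟩ := h1 (ε / 2) (by positivity)
    obtain ⟨s2, a2, h2⟩ := h2 (ε / 2) (by positivity)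
    refine ⟨max s1 s2, a1.trans (le_max_left _ _), fun z hz hs => ?_⟩
    rw [map_add]
    have := h1 z hz ((le_max_left _ _).trans hs)
    have := h2 z hz ((le_max_right _ _).trans hs)
    exact (abs_add_le _ _).trans (by linarith)
  | mul hf _ h =>
    intro ε hε
    obtain ⟨s1, C, a1, hC, hb⟩ := hf.bdd r hr
    obtain ⟨s2, a2, h2⟩ := h (ε / (C + 1)) (by positivity)
    refine ⟨max s1 s2, a1.trans (le_max_left _ _), fun z hz hs => ?_⟩
    rw [map_mul, abs_mul]
    have e1 := hb z hz ((le_max_left _ _).trans hs)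
    have e2 := h2 z hz ((le_max_right _ _).trans hs)
    calc _ ≤ C * (ε / (C + 1)) := mul_le_mul e1 e2 (abs_nonneg _) hC
      _ ≤ (C + 1) * (ε / (C + 1)) := by gcongr; linarith
      _ = ε := by field_simp

variable (F)

/-- logarithm of `Fs` -/
def lf : S UU := F.lt + (3 : ℝ) • sS

lemma ev_lf (z : UU) : ev z F.lf = Real.log (ev z F.τ) + 3 * z.1.2 := by
  rw [lf, map_add, ev_lt, map_smul, ev_sS, smul_eq_mul]

lemma expS_lf : expS F.lf = F.Fs := by
  rw [lf, expS_add, expS_lt, Fs, eS, mul_comm]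

lemma d_lf (a : E4) : dS hUU a F.lf = F.Fi * dS hUU a F.Fs := by
  conv_rhs => rw [← expS_lf, dS_expS, expS_lf]
  linear_combination - dS hUU a F.lf * F.Fi_mul

lemma sml_del_lf (i : Fin 3) : F.Sml (del i F.lf) := by
  have : del i F.lf = F.Fi * F.jet [i] := by
    rw [del_apply, d_lf]
    simp only [jet, del_apply]; ring
  rw [this]
  exact Sml.mul Gen.Fi.ge (Sml.jet _ _)

lemma sml_DT_lf : F.Sml (DT F.lf) := by
  rw [d_lf]
  exact Sml.mul Gen.Fi.ge (Sml.DT_jet [])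

end DFlow

/-- scaled directional derivatives -/
def wD (μ : ℝ) : Option (Fin 3) → S UU → S UU
  | some i, f => μ • DD i f
  | none, f => DT f

/-- iterated -/
def DL (μ : ℝ) : List (Option (Fin 3)) → S UU → S UU
  | [], f => f
  | a :: L, f => DL μ L (wD μ a f)

lemma eS_add (a b : ℝ) : eS (a + b) = eS a * eS b := by
  apply S_ext; intro z
  rw [map_mul, ev_eS, ev_eS, ev_eS, ← Real.exp_add, add_mul]

lemma DD_del (i : Fin 3) (f : S UU) : DD i f = eS 3 * del i f := by
  rw [del_apply]
  linear_combination - DD i f * eS_neg_mul 3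

namespace DFlow
variable {Λ : ℝ} (F : DFlow Λ)

/-- normal form -/
def NF (g : ℝ → S UU) : Prop := ∃ (n : ℕ) (f : S UU), F.Sml f ∧ ∀ μ, g μ = μ ^ n • (eS (3 * n) * f)

variable {F}

lemma NF.wD {g : ℝ → S UU} (h : F.NF g) (a : Option (Fin 3)) : F.NF (fun μ => wD μ a (g μ)) := by
  obtain ⟨n, f, hf, hg⟩ := h
  match a with
  | some i =>
    refine ⟨n + 1, _root_.del i f, hf.del i, fun μ => ?_⟩
    simp only [_root_.wD]
    rw [hg, Derivation.map_smul, Derivation.leibniz, DD_eS, DD_del]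
    have : (3 * ((n + 1 : ℕ) : ℝ)) = 3 * n + 3 := by push_cast; ring
    rw [this, eS_add, smul_zero, add_zero, smul_smul, smul_eq_mul, pow_succ', mul_assoc]
  | none =>
    refine ⟨n, (3 * n : ℝ) • f + _root_.DT f, (hf.smul _).add hf.DT, fun μ => ?_⟩
    simp only [_root_.wD]
    rw [hg, Derivation.map_smul, Derivation.leibniz, DT_eS]
    congr 1
    simp only [smul_eq_mul, Algebra.smul_def]
    ring

lemma NF.DL (L : List (Option (Fin 3))) : ∀ {g : ℝ → S UU}, F.NF g → F.NF (fun μ => DL μ L (g μ)) := by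
  induction L with
  | nil => exact fun h => h
  | cons a L ih => exact fun h => ih (h.wD a)

lemma NF.lf (L : List (Option (Fin 3))) (hL : L ≠ []) : F.NF (fun μ => _root_.DL μ L F.lf) := by
  match L, hL with
  | a :: L, _ =>
    refine NF.DL L (g := fun μ => _root_.wD μ a F.lf) ?_
    match a with
    | some i =>
      refine ⟨1, _root_.del i F.lf, F.sml_del_lf i, fun μ => ?_⟩
      simp only [_root_.wD]
      rw [DD_del]; simp
    | none =>
      refine ⟨0, _root_.DT F.lf, F.sml_DT_lf, fun μ => ?_⟩
      simp only [_root_.wD]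
      have : eS 0 = 1 := by apply S_ext; intro z; simp [ev_eS]
      simp [this]

end DFlow

end


open Real Filter Topology
open scoped ContDiff

noncomputable section

/-- linear part of the rescaling -/
def Ml (μ : ℝ) : E4 →L[ℝ] E4 := (μ • ContinuousLinearMap.fst ℝ V3 ℝ).prod (ContinuousLinearMap.snd ℝ V3 ℝ)

/-- the rescaling -/
def Ph (μ lam : ℝ) (q : E4) : E4 := (fun i => μ * q.1 i, q.2 + lam)

lemma Ph_eq (μ lam : ℝ) (q : E4) : Ph μ lam q = Ml μ q + (0, lam) := by
  ext i <;> simp [Ph, Ml]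

lemma Ph_deriv (μ lam : ℝ) (q : E4) : HasFDerivAt (Ph μ lam) (Ml μ) q := by
  have : Ph μ lam = fun q => Ml μ q + (0, lam) := funext (Ph_eq μ lam)
  rw [this]
  exact (Ml μ).hasFDerivAt.add_const _

lemma Ph_smooth (μ lam : ℝ) : ContDiff ℝ ∞ (Ph μ lam) := by
  have : Ph μ lam = fun q => Ml μ q + (0, lam) := funext (Ph_eq μ lam)
  rw [this]
  exact (Ml μ).contDiff.add contDiff_const

/-- coordinate functionals -/
def ell : Option (Fin 3) → E4 →L[ℝ] ℝ
  | some i => (ContinuousLinearMap.proj (R := ℝ) (φ := fun _ : Fin 3 => ℝ) i).comp (ContinuousLinearMap.fst ℝ V3 ℝ)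
  | none => ContinuousLinearMap.snd ℝ V3 ℝ

lemma ell_norm (a : Option (Fin 3)) : ‖ell a‖ ≤ 1 := by
  apply ContinuousLinearMap.opNorm_le_bound _ zero_le_one
  intro q
  rw [one_mul]
  match a with
  | some i => exact (norm_le_pi_norm q.1 i).trans (norm_fst_le q)
  | none => exact norm_snd_le q

/-- scalars to functionals -/
def ellS (a : Option (Fin 3)) : ℝ →L[ℝ] (E4 →L[ℝ] ℝ) := ContinuousLinearMap.toSpanSingleton ℝ (ell a)

lemma ellS_norm (a : Option (Fin 3)) : ‖ellS a‖ ≤ 1 := by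
  rw [ellS, ContinuousLinearMap.norm_toSpanSingleton]; exact ell_norm a

lemma fderiv_Ph (μ lam : ℝ) (f : S UU) (q : E4) (hq : Ph μ lam q ∈ UU) :
    fderiv ℝ (fun q => fx f (Ph μ lam q)) q = ∑ a, ellS a (fx (wD μ a f) (Ph μ lam q)) := by
  have h := (fx_diff hUU f ⟨_, hq⟩).hasFDerivAt.comp q (Ph_deriv μ lam q)
  have h' : fderiv ℝ (fun q => fx f (Ph μ lam q)) q = (fderiv ℝ (fx f) (Ph μ lam q)).comp (Ml μ) := h.fderiv
  rw [h']
  apply ContinuousLinearMap.ext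
  intro y
  have e : Ml μ y = (∑ i, (μ * y.1 i) • bx i) + y.2 • bt := by
    rw [← bx_sum (fun i => μ * y.1 i)]
    ext i <;> simp [Ml, bt]
  rw [ContinuousLinearMap.comp_apply, e, map_add, map_sum, Fintype.sum_option]
  simp only [add_apply, sum_apply, ellS,
    ContinuousLinearMap.toSpanSingleton_apply, smul_apply, map_smul, smul_eq_mul,
    fx_apply' _ _ hq, wD, ell, ev_dS]
  rw [add_comm]
  congr 1
  · simp [mul_comm]
  · refine Finset.sum_congr rfl fun i _ => ?_
    simp
    ring

lemma Ph_nhds (μ lam : ℝ) (q : E4) (hq : Ph μ lam q ∈ UU) : ∀ᶠ q' in 𝓝 q, Ph μ lam q' ∈ UU :=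
  (Ph_smooth μ lam).continuous.continuousAt.eventually (hUU.mem_nhds hq)

lemma Ph_cda (μ lam : ℝ) (f : S UU) (q : E4) (hq : Ph μ lam q ∈ UU) :
    ContDiffAt ℝ ∞ (fun q => fx f (Ph μ lam q)) q :=
  (fx_cda hUU f ⟨_, hq⟩).comp q (Ph_smooth μ lam).contDiffAt

lemma norm_iter_sum {ι G : Type*} [NormedAddCommGroup G] [NormedSpace ℝ G] (s : Finset ι) (n : ℕ) (f : ι → E4 → G)
    (p : E4) (h : ∀ a, ContDiffAt ℝ ∞ (f a) p) :
    ‖iteratedFDeriv ℝ n (fun q => ∑ a ∈ s, f a q) p‖ ≤ ∑ a ∈ s, ‖iteratedFDeriv ℝ n (f a) p‖ := by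
  classical
  induction s using Finset.induction_on with
  | empty =>
    simp
  | insert a s ha ih =>
    simp only [Finset.sum_insert ha]
    have e : (fun q => f a q + ∑ b ∈ s, f b q) = f a + fun q => ∑ b ∈ s, f b q := rfl
    have hn : ((n : ℕ) : WithTop ℕ∞) ≤ ∞ := by exact_mod_cast le_top
    rw [e, iteratedFDeriv_add_apply ((h a).of_le hn)
      ((ContDiffAt.sum fun b _ => h b).of_le hn)]
    exact (norm_add_le _ _).trans (by gcongr)

lemma iter_bound (μ lam : ℝ) (p : E4) (hp : Ph μ lam p ∈ UU) (ε : ℝ) (n : ℕ) : ∀ f : S UU,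
    (∀ L : List (Option (Fin 3)), L.length = n → |ev ⟨_, hp⟩ (DL μ L f)| ≤ ε) →
    ‖iteratedFDeriv ℝ n (fun q => fx f (Ph μ lam q)) p‖ ≤ 4 ^ n * ε := by
  induction n with
  | zero =>
    intro f h
    rw [norm_iteratedFDeriv_zero, fx_apply' _ _ hp, pow_zero, one_mul]
    exact h [] rfl
  | succ n ih =>
    intro f h
    rw [← norm_iteratedFDeriv_fderiv]
    have e : fderiv ℝ (fun q => fx f (Ph μ lam q)) =ᶠ[𝓝 p]
        fun q => ∑ a, (ellS a ∘ fun q => fx (wD μ a f) (Ph μ lam q)) q := by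
      filter_upwards [Ph_nhds μ lam p hp] with q hq
      exact fderiv_Ph μ lam f q hq
    rw [(e.iteratedFDeriv ℝ n).eq_of_nhds]
    refine (norm_iter_sum _ n _ p fun a => (ellS a).contDiff.contDiffAt.comp p (Ph_cda μ lam _ p hp)).trans ?_
    have hn : ((n : ℕ) : WithTop ℕ∞) ≤ ∞ := by exact_mod_cast le_top
    have hb : ∀ a : Option (Fin 3), ‖iteratedFDeriv ℝ n (ellS a ∘ fun q => fx (wD μ a f) (Ph μ lam q)) p‖ ≤ 4 ^ n * ε := by
      intro a
      refine ((ellS a).norm_iteratedFDeriv_comp_left (Ph_cda μ lam (wD μ a f) p hp) hn).trans ?_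
      have h1 := ih (wD μ a f) (fun L hL => h (a :: L) (by simp [hL]))
      calc _ ≤ 1 * ‖iteratedFDeriv ℝ n (fun q => fx (wD μ a f) (Ph μ lam q)) p‖ := by
            gcongr; exact ellS_norm a
        _ ≤ _ := by rw [one_mul]; exact h1
    refine (Finset.sum_le_sum fun a _ => hb a).trans ?_
    rw [Finset.sum_const, Finset.card_univ]
    simp [pow_succ]
    linarith

namespace DFlow
variable {Λ : ℝ} (F : DFlow Λ)

/-- the scale -/
def msc (lam : ℝ) : ℝ := fx F.τ (0, lam)

lemma zero_mem (lam : ℝ) (h : 0 < lam) : ((0, lam) : E4) ∈ UU := by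
  refine ⟨?_, h⟩
  simp

lemma msc_bound : ∃ C, 0 < C ∧ ∀ lam, 1 ≤ lam → 0 < F.msc lam ∧ F.msc lam ≤ C * Real.exp (-3 * lam) := by
  obtain ⟨C, hC, h⟩ := F.upper2
  refine ⟨C, hC, fun lam hl => ?_⟩
  rw [msc, fx_apply' _ _ (zero_mem lam (by linarith))]
  exact ⟨F.τpos _, h ⟨_, zero_mem lam (by linarith)⟩ (by simp [sqd]) hl⟩

lemma msc_tendsto : Tendsto F.msc atTop (𝓝 0) := by
  obtain ⟨C, hC, h⟩ := F.msc_bound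
  have : Tendsto (fun s : ℝ => C * Real.exp (-3 * s)) atTop (𝓝 (C * 0)) := by
    refine Tendsto.const_mul _ (Real.tendsto_exp_atBot.comp ?_)
    exact tendsto_id.const_mul_atTop_of_neg (by norm_num)
  rw [mul_zero] at this
  refine squeeze_zero' ?_ ?_ this
  · filter_upwards [eventually_ge_atTop 1] with lam hl using (h lam hl).1.le
  · filter_upwards [eventually_ge_atTop 1] with lam hl using (h lam hl).2

lemma Ph_good (ρ s0 : ℝ) : ∀ᶠ lam in atTop, ∀ q ∈ Metric.closedBall (0 : E4) ρ,
    Ph (F.msc lam) lam q ∈ UU ∧ sqd 0 (Ph (F.msc lam) lam q).1 ≤ 1 / 8 ∧ s0 ≤ (Ph (F.msc lam) lam q).2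
      ∧ q.2 ≤ ρ := by
  have h1 : Tendsto (fun lam => F.msc lam ^ 2 * (3 * ρ ^ 2)) atTop (𝓝 (0 ^ 2 * (3 * ρ ^ 2))) :=
    (F.msc_tendsto.pow 2).mul_const _
  rw [zero_pow two_ne_zero, zero_mul] at h1
  filter_upwards [h1.eventually_le_const (show (0 : ℝ) < 1 / 8 by norm_num), eventually_ge_atTop (s0 + ρ),
    eventually_gt_atTop ρ] with lam ha hb hc q hq
  rw [mem_closedBall_zero_iff] at hq
  have hq2 : |q.2| ≤ ρ := (norm_snd_le q).trans hq
  have hq1 : ∀ i, q.1 i ^ 2 ≤ ρ ^ 2 := fun i =>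
    sq_le_sq' (by have := abs_le.1 (((norm_le_pi_norm q.1 i).trans (norm_fst_le q)).trans hq); linarith)
      (by have := abs_le.1 (((norm_le_pi_norm q.1 i).trans (norm_fst_le q)).trans hq); linarith)
  have hs : sqd 0 (Ph (F.msc lam) lam q).1 ≤ 1 / 8 := by
    refine le_trans ?_ ha
    simp only [sqd, Ph, Fin.sum_univ_three, Pi.zero_apply, sub_zero]
    have := hq1 0
    have := hq1 1
    have := hq1 2
    nlinarith [sq_nonneg (F.msc lam)]
  have h2 := abs_le.1 hq2
  have h3 : (Ph (F.msc lam) lam q).2 = q.2 + lam := rfl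
  refine ⟨?_, hs, by rw [h3]; linarith, h2.2⟩
  exact sqd_mem (y := 0) (x := (Ph (F.msc lam) lam q).1) (s := (Ph (F.msc lam) lam q).2) (by simp) (by linarith)
    (by rw [h3]; linarith)

lemma DL_small (ρ ε : ℝ) (hε : 0 < ε) (L : List (Option (Fin 3))) (hL : L ≠ []) :
    ∀ᶠ lam in atTop, ∀ q ∈ Metric.closedBall (0 : E4) ρ, ∀ h : Ph (F.msc lam) lam q ∈ UU,
      |ev ⟨_, h⟩ (DL (F.msc lam) L F.lf)| ≤ ε := by
  obtain ⟨n, f, hf, hn⟩ := NF.lf (F := F) L hL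
  obtain ⟨C, hC, hmu⟩ := F.msc_bound
  set A := (C * Real.exp (3 * ρ)) ^ n with hA
  have hAp : 0 < A := by positivity
  obtain ⟨s0, _, hs⟩ := hf.small (1 / 8) (by norm_num) (ε / A) (by positivity)
  filter_upwards [F.Ph_good ρ s0, eventually_ge_atTop 1] with lam h1 h2 q hq h
  obtain ⟨-, h4, h5, h6⟩ := h1 q hq
  obtain ⟨m1, m2⟩ := hmu lam h2
  have e1 := hs ⟨_, h⟩ h4 h5
  simp only at hn
  rw [hn, map_smul, map_mul, ev_eS, smul_eq_mul, ← mul_assoc, abs_mul]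
  have e2 : |F.msc lam ^ n * Real.exp (3 * n * (Ph (F.msc lam) lam q).2)| ≤ A := by
    rw [abs_of_pos (by positivity)]
    have : Real.exp (3 * n * (Ph (F.msc lam) lam q).2) = Real.exp (3 * (q.2 + lam)) ^ n := by
      rw [← Real.exp_nat_mul]; congr 1; simp only [Ph]; ring
    rw [this, ← mul_pow, hA]
    apply pow_le_pow_left₀ (by positivity)
    calc F.msc lam * Real.exp (3 * (q.2 + lam)) ≤ C * Real.exp (-3 * lam) * Real.exp (3 * (q.2 + lam)) := by gcongr
      _ = C * Real.exp (3 * q.2) := by rw [mul_assoc, ← Real.exp_add]; congr 2; ring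
      _ ≤ _ := by gcongr
  calc _ ≤ A * (ε / A) := mul_le_mul e2 e1 (abs_nonneg _) hAp.le
    _ = ε := by field_simp

lemma iter_small (ρ ε : ℝ) (hε : 0 < ε) (n : ℕ) (hn : 1 ≤ n) :
    ∀ᶠ lam in atTop, ∀ q ∈ Metric.closedBall (0 : E4) ρ,
      ‖iteratedFDeriv ℝ n (fun q => fx F.lf (Ph (F.msc lam) lam q)) q‖ ≤ ε := by
  have h := (Filter.eventually_all_finite (List.finite_length_eq (Option (Fin 3)) n)
    (l := (atTop : Filter ℝ)) (p := fun L lam => ∀ q ∈ Metric.closedBall (0 : E4) ρ,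
      ∀ h : Ph (F.msc lam) lam q ∈ UU, |ev ⟨_, h⟩ (DL (F.msc lam) L F.lf)| ≤ ε / 4 ^ n)).2
    (fun L hL => F.DL_small ρ (ε / 4 ^ n) (by positivity) L (by
      rintro rfl
      simp only [Set.mem_ofPred_eq, List.length_nil] at hL
      omega))
  filter_upwards [h, F.Ph_good ρ 1] with lam h1 h2 q hq
  have h3 := (h2 q hq).1
  refine (iter_bound _ lam q h3 (ε / 4 ^ n) n F.lf (fun L hL => h1 L hL q hq h3)).trans ?_
  rw [mul_div_cancel₀ _ (by positivity)]

lemma iter_small_zero (ρ ε : ℝ) (hρ : 0 < ρ) (hε : 0 < ε) :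
    ∀ᶠ lam in atTop, ∀ q ∈ Metric.closedBall (0 : E4) ρ,
      |fx F.lf (0, lam) - fx F.lf (Ph (F.msc lam) lam q)| ≤ ε := by
  filter_upwards [F.iter_small ρ (ε / ρ) (by positivity) 1 le_rfl, F.Ph_good ρ 1] with lam h1 h2 q hq
  have key := Convex.norm_image_sub_le_of_norm_fderiv_le (𝕜 := ℝ) (f := fun q => fx F.lf (Ph (F.msc lam) lam q))
    (C := ε / ρ) (s := Metric.closedBall (0 : E4) ρ) (x := q) (y := 0)
    (fun y hy => (Ph_cda _ lam F.lf y (h2 y hy).1).differentiableAt (by simp))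
    (fun y hy => by
      have := h1 y hy
      rwa [← norm_iteratedFDeriv_fderiv (n := 0), norm_iteratedFDeriv_zero] at this)
    (convex_closedBall _ _) hq (Metric.mem_closedBall_self hρ.le)
  have e : Ph (F.msc lam) lam 0 = (0, lam) := by
    rw [Ph_eq]; simp
  simp only [e, zero_sub, norm_neg] at key
  rw [Real.norm_eq_abs] at key
  refine key.trans ?_
  rw [mem_closedBall_zero_iff] at hq
  calc ε / ρ * ‖q‖ ≤ ε / ρ * ρ := by gcongr
    _ = ε := by field_simp

theorem conv (K : Set E4) (hK : IsCompact K) (k : ℕ) (ε : ℝ) (hε : 0 < ε) :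
    ∀ᶠ lam in atTop, ∀ p ∈ K, Ph (F.msc lam) lam p ∈ UU ∧ ∀ j ≤ k,
      ‖iteratedFDeriv ℝ j (fun q => fx F.lf (0, lam) - fx F.lf (Ph (F.msc lam) lam q)) p‖ ≤ ε := by
  obtain ⟨ρ, hρ, hKρ⟩ : ∃ ρ, 0 < ρ ∧ K ⊆ Metric.closedBall 0 ρ := by
    obtain ⟨ρ, h⟩ := hK.isBounded.subset_closedBall (0 : E4)
    exact ⟨max ρ 1, by positivity, h.trans (Metric.closedBall_subset_closedBall (le_max_left _ _))⟩
  have hall : ∀ᶠ lam in atTop, ∀ n ∈ Set.Iic k, 1 ≤ n → ∀ q ∈ Metric.closedBall (0 : E4) ρ,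
      ‖iteratedFDeriv ℝ n (fun q => fx F.lf (Ph (F.msc lam) lam q)) q‖ ≤ ε := by
    rw [Filter.eventually_all_finite (Set.finite_Iic k)]
    intro n _
    by_cases hn : 1 ≤ n
    · filter_upwards [F.iter_small ρ ε hε n hn] with lam h _ using h
    · exact Eventually.of_forall fun _ h => absurd h hn
  filter_upwards [hall, F.iter_small_zero ρ ε hρ hε, F.Ph_good ρ 1] with lam h1 h2 h3 p hp
  have hp' := hKρ hp
  refine ⟨(h3 p hp').1, fun j hj => ?_⟩
  rcases Nat.eq_zero_or_pos j with rfl | hj0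
  · rw [norm_iteratedFDeriv_zero]
    exact h2 p hp'
  · have h4 := h1 j hj hj0 p hp'
    obtain ⟨m, rfl⟩ : ∃ m, j = m + 1 := ⟨j - 1, by omega⟩
    rw [← norm_iteratedFDeriv_fderiv] at h4 ⊢
    have e : fderiv ℝ (fun q => fx F.lf (0, lam) - fx F.lf (Ph (F.msc lam) lam q))
        = - fderiv ℝ (fun q => fx F.lf (Ph (F.msc lam) lam q)) := by
      funext q
      rw [fderiv_const_sub]; rfl
    rw [e, iteratedFDeriv_neg_apply, norm_neg]
    exact h4

end DFlow

end


open Real Filter Topology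
open scoped ContDiff

noncomputable section

lemma flow_alg (t E W : ℝ) (p : Fin 3 → ℝ) (Q : Fin 3 → Fin 3 → ℝ) (hE : E * t ^ 2 = 1)
    (hW : W * (1 - t ^ 2 * ∑ i, p i ^ 2) = 1) :
    ∑ i, ∑ j, t ^ 2 * (kd i j + t ^ 2 * p i * p j * W) * (Q i j + E * kd i j - 2 * p i * p j) =
    3 - t * ∑ i, ∑ j, (kd i j + W * (-(t * p i)) * (-(t * p j))) * (t * (p i * p j - Q i j)) := by
  simp only [Fin.sum_univ_three, kd] at hW ⊢
  simp
  linear_combination (3 + W * (t ^ 2 * (p 0 ^ 2 + p 1 ^ 2 + p 2 ^ 2))) * hE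
    + (t ^ 2 * (p 0 ^ 2 + p 1 ^ 2 + p 2 ^ 2)) * hW

lemma slice_pd (f : S UU) (g : V3 → ℝ) (s : ℝ) (hg : ∀ y, (h : ((y, s) : E4) ∈ UU) → g y = ev ⟨_, h⟩ f)
    (x : V3) (h : ((x, s) : E4) ∈ UU) (i : Fin 3) : pd g x i = ev ⟨_, h⟩ (DD i f) := by
  have h1 : HasFDerivAt (fun y : V3 => ((y, s) : E4)) (ContinuousLinearMap.inl ℝ V3 ℝ) x :=
    hasFDerivAt_prodMk_left x s
  have h2 := (fx_diff hUU f ⟨_, h⟩).hasFDerivAt.comp x h1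
  have h3 : g =ᶠ[𝓝 x] (fx f ∘ fun y : V3 => ((y, s) : E4)) := by
    filter_upwards [h1.continuousAt.eventually (hUU.mem_nhds h)] with y hy
    rw [hg y hy, Function.comp_apply, fx_apply' _ _ hy]
  rw [pd, (h2.congr_of_eventuallyEq h3).fderiv, ev_dS]
  rfl

lemma slice_dt (f : S UU) (g : ℝ → ℝ) (x : V3) (hg : ∀ s, (h : ((x, s) : E4) ∈ UU) → g s = ev ⟨_, h⟩ f)
    (s : ℝ) (h : ((x, s) : E4) ∈ UU) : deriv g s = ev ⟨_, h⟩ (DT f) := by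
  have h1 : HasFDerivAt (fun r : ℝ => ((x, r) : E4)) (ContinuousLinearMap.inr ℝ V3 ℝ) s :=
    hasFDerivAt_prodMk_right x s
  have h2 := (fx_diff hUU f ⟨_, h⟩).hasFDerivAt.comp s h1
  have h3 : g =ᶠ[𝓝 s] (fx f ∘ fun r : ℝ => ((x, r) : E4)) := by
    filter_upwards [h1.continuousAt.eventually (hUU.mem_nhds h)] with y hy
    rw [hg y hy, Function.comp_apply, fx_apply' _ _ hy]
  rw [(h2.congr_of_eventuallyEq h3).hasDerivAt.deriv, ev_dS]
  rfl

lemma exists_flow (Λ : ℝ) (u : V3 → ℝ → ℝ)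
    (hu : ContDiffOn ℝ ∞ (fun p : V3 × ℝ => u p.1 p.2) {p : V3 × ℝ | (∑ i, p.1 i ^ 2) < (10:ℝ) ^ 2 ∧ 0 ≤ p.2})
    (h0 : ∀ x s, (∑ i, x i ^ 2) < (10:ℝ) ^ 2 → 0 ≤ s → 0 ≤ u x s)
    (hsp : ∀ x s, (∑ i, x i ^ 2) < (10:ℝ) ^ 2 → 0 ≤ s → Spacelike (tslice u s) x)
    (hfl : ∀ x s, (∑ i, x i ^ 2) < (10:ℝ) ^ 2 → 0 ≤ s → FlowEq u x s)
    (hH : ∀ x s, (∑ i, x i ^ 2) < (10:ℝ) ^ 2 → 0 ≤ s →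
          0 ≤ mcH (tslice u s) x ∧ mcH (tslice u s) x ≤ Λ) :
    ∃ F : DFlow Λ, ∀ z : UU, ev z F.τ = Real.exp (-u z.1.1 z.1.2) := by
  have hsub : ∀ z : UU, (∑ i, z.1.1 i ^ 2) < (10:ℝ) ^ 2 ∧ 0 ≤ z.1.2 := fun z =>
    ⟨by have := z.2.1; norm_num; exact this, z.2.2.le⟩
  set a : S UU := mkS (fun p => u p.1 p.2) (hu.mono fun z hz => hsub ⟨z, hz⟩) with ha
  have eva : ∀ z : UU, ev z a = u z.1.1 z.1.2 := fun z => rfl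
  have p1 : ∀ (z : UU) i, pd (tslice u z.1.2) z.1.1 i = ev z (DD i a) := fun z i =>
    slice_pd a _ _ (fun y h => rfl) _ z.2 i
  have p2 : ∀ (z : UU) i j, pd2 (tslice u z.1.2) z.1.1 i j = ev z (DD i (DD j a)) := fun z i j =>
    slice_pd (DD j a) _ _ (fun y h => p1 ⟨_, h⟩ j) _ z.2 i
  have p3 : ∀ z : UU, deriv (fun r => u z.1.1 r) z.1.2 = ev z (DT a) := fun z =>
    slice_dt a _ _ (fun y h => rfl) _ z.2
  set τ : S UU := expS (-a) with hτ
  have evτ : ∀ z, ev z τ = Real.exp (-u z.1.1 z.1.2) := fun z => by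
    rw [hτ, ev_expS, map_neg, eva]
  have dτ : ∀ i, DD i τ = -(τ * DD i a) := fun i => by
    rw [hτ, dS_expS, map_neg]; ring
  have ddτ : ∀ i j, DD i (DD j τ) = τ * (DD i a * DD j a - DD i (DD j a)) := fun i j => by
    rw [dτ, map_neg, Derivation.leibniz, dτ]
    simp only [smul_eq_mul]; ring
  have dtτ : DT τ = -(τ * DT a) := by
    rw [hτ, dS_expS, map_neg]; ring
  have ex1 : ∀ z : UU, Real.exp (-2 * u z.1.1 z.1.2) = ev z τ ^ 2 := fun z => by
    rw [evτ, ← Real.exp_nat_mul]; congr 1; push_cast; ring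
  have evq : ∀ z, ev z (qq DD τ) = ev z τ ^ 2 * ∑ i, ev z (DD i a) ^ 2 := fun z => by
    simp only [qq, dτ, map_sum, map_pow, map_neg, map_mul, Finset.mul_sum]
    exact Finset.sum_congr rfl fun i _ => by ring
  have hwf : ∀ z : UU, wfun (tslice u z.1.2) z.1.1 = ev z (1 - qq DD τ) := fun z => by
    rw [wfun, map_sub, map_one, evq, ← ex1]
    simp only [p1]; rfl
  have hw : ∀ z, 0 < ev z (1 - qq DD τ) := fun z => by
    rw [← hwf, wfun]
    have := hsp z.1.1 z.1.2 (hsub z).1 (hsub z).2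
    rw [Spacelike] at this
    linarith
  set lw : S UU := logS (1 - qq DD τ) hw with hlw
  set l : S UU := (-(1 / 2) : ℝ) • lw with hl
  have hW : expS l ^ 2 * (1 - qq DD τ) = 1 := by
    rw [← expS_logS (1 - qq DD τ) hw, ← hlw, pow_two, ← expS_add, ← expS_add]
    have : l + l + lw = 0 := by rw [hl, ← add_smul]; norm_num
    rw [this, expS_zero]
  have hWz : ∀ z, ev z (expS l ^ 2) * ev z (1 - qq DD τ) = 1 := fun z => by
    rw [← map_mul, hW, map_one]
  have hgr : ∀ z : UU, gradFun (tslice u z.1.2) z.1.1 = ev z (expS l) := fun z => by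
    rw [gradFun, hwf, ev_expS, hl, map_smul, hlw, ev_logS, Real.sqrt_eq_rpow, Real.rpow_def_of_pos (hw z),
      ← Real.exp_neg]
    congr 1; simp only [smul_eq_mul]; ring
  have hinv : ∀ (z : UU) i j, hInv (tslice u z.1.2) z.1.1 i j =
      ev z τ ^ 2 * (kd i j + ev z τ ^ 2 * ev z (DD i a) * ev z (DD j a) * ev z (expS l ^ 2)) := fun z i j => by
    rw [hInv, hwf, p1, p1, div_eq_mul_inv, ← eq_inv_of_mul_eq_one_left (hWz z)]
    have : tslice u z.1.2 z.1.1 = u z.1.1 z.1.2 := rfl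
    rw [this, ex1]
  have hkd : ∀ (z : UU) i j, ev z (kA (S UU) i j) = kd i j := fun z i j => by
    unfold kA kd; split <;> simp
  have evtr : ∀ z, ev z (3 - τ * trA DD τ (expS l ^ 2)) = 3 - ev z τ * ∑ i, ∑ j,
      (kd i j + ev z (expS l ^ 2) * (-(ev z τ * ev z (DD i a))) * (-(ev z τ * ev z (DD j a)))) *
      (ev z τ * (ev z (DD i a) * ev z (DD j a) - ev z (DD i (DD j a)))) := fun z => by
    simp only [trA, aa, ddτ]
    simp only [dτ, map_sub, map_ofNat, map_mul, map_sum, map_add, map_neg, hkd]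
  have key : ∀ z, ev z (DT a) = ev z (3 - τ * trA DD τ (expS l ^ 2)) := fun z => by
    have h1 := hfl z.1.1 z.1.2 (hsub z).1 (hsub z).2
    rw [FlowEq, p3] at h1
    rw [h1, evtr]
    have hE : Real.exp (2 * u z.1.1 z.1.2) * ev z τ ^ 2 = 1 := by
      rw [← ex1, ← Real.exp_add]; simp
    have h2 := hWz z
    rw [map_sub, map_one, evq] at h2
    rw [← flow_alg (ev z τ) _ (ev z (expS l ^ 2)) (fun i => ev z (DD i a)) (fun i j => ev z (DD i (DD j a))) hE h2]
    simp only [hinv, p1, p2]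
  have hmc : ∀ z : UU, mcH (tslice u z.1.2) z.1.1 = ev z (expS l) * ev z (3 - τ * trA DD τ (expS l ^ 2)) := fun z => by
    have h1 := hfl z.1.1 z.1.2 (hsub z).1 (hsub z).2
    rw [FlowEq, p3] at h1
    rw [← key, h1, mcH, Finset.mul_sum]
    refine Finset.sum_congr rfl fun i _ => ?_
    rw [Finset.mul_sum]
    refine Finset.sum_congr rfl fun j _ => ?_
    rw [sff, hgr]
    have : tslice u z.1.2 z.1.1 = u z.1.1 z.1.2 := rfl
    rw [this]; ring
  have hP : PP DD DT (hh DD τ (expS l ^ 2)) τ = -3 * τ := by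
    have e : PP DD DT (hh DD τ (expS l ^ 2)) τ = DT τ - τ ^ 2 * trA DD τ (expS l ^ 2) := by
      simp only [PP, hh, trA, Finset.mul_sum, mul_assoc]
    have k : DT a = 3 - τ * trA DD τ (expS l ^ 2) := S_ext key
    rw [e, dtτ, k]; ring
  refine ⟨⟨τ, l, fun z => ?_, fun z => ?_, hW, hP, fun z => ?_, fun z => ?_⟩, evτ⟩
  · rw [evτ]; positivity
  · rw [evτ, Real.exp_le_one_iff]
    have := h0 z.1.1 z.1.2 (hsub z).1 (hsub z).2
    linarith
  · have h1 := (hH z.1.1 z.1.2 (hsub z).1 (hsub z).2).1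
    rw [hmc, ev_expS] at h1
    exact nonneg_of_mul_nonneg_right h1 (Real.exp_pos _)
  · have h1 := (hH z.1.1 z.1.2 (hsub z).1 (hsub z).2).2
    rwa [hmc] at h1

end


open Real Filter in
/-- Main theorem: there is a universal radius `R` such that any nonnegative, spacelike,
graphical mean curvature flow `u : B_R × [0,∞) → ℝ` in de Sitter space with
`0 ≤ H ≤ Λ` satisfies `u(0,λ) → ∞`, and the rescalings
`u^λ(x,s) = u(e^{−u(0,λ)}x, s+λ) − u(0,λ)` converge to `(x,s) ↦ 3s` in `C^∞_loc(ℝ³×ℝ)`. -/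
theorem deSitter_MCF_main :
    ∃ R : ℝ, 0 < R ∧
      ∀ (Λ : ℝ) (u : V3 → ℝ → ℝ),
        ContDiffOn ℝ (⊤ : ℕ∞) (fun p : V3 × ℝ => u p.1 p.2)
          {p : V3 × ℝ | (∑ i, p.1 i ^ 2) < R ^ 2 ∧ 0 ≤ p.2} →
        (∀ x s, (∑ i, x i ^ 2) < R ^ 2 → 0 ≤ s → 0 ≤ u x s) →
        (∀ x s, (∑ i, x i ^ 2) < R ^ 2 → 0 ≤ s → Spacelike (tslice u s) x) →
        (∀ x s, (∑ i, x i ^ 2) < R ^ 2 → 0 ≤ s → FlowEq u x s) →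
        (∀ x s, (∑ i, x i ^ 2) < R ^ 2 → 0 ≤ s →
          0 ≤ mcH (tslice u s) x ∧ mcH (tslice u s) x ≤ Λ) →
        Tendsto (fun lam => u 0 lam) atTop atTop ∧
        ∀ K : Set (V3 × ℝ), IsCompact K → ∀ k : ℕ, ∀ ε : ℝ, 0 < ε →
          ∀ᶠ lam in atTop, ∀ p ∈ K,
            ((∑ i, (exp (-u 0 lam) * p.1 i) ^ 2) < R ^ 2 ∧ 0 ≤ p.2 + lam) ∧
            ∀ j ≤ k,
              ‖iteratedFDeriv ℝ j
                (fun q : V3 × ℝ =>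
                  u (fun i => exp (-u 0 lam) * q.1 i) (q.2 + lam) - u 0 lam - 3 * q.2) p‖
                ≤ ε := by
  refine ⟨10, by norm_num, fun Λ u hu h0 hsp hfl hH => ?_⟩
  obtain ⟨F, hF⟩ := exists_flow Λ u hu h0 hsp hfl hH
  have hms : ∀ lam, 0 < lam → F.msc lam = exp (-u 0 lam) := fun lam hl => by
    rw [DFlow.msc, fx_apply' _ _ (DFlow.zero_mem lam hl), hF]
  constructor
  · have h1 : Tendsto (fun lam => -u 0 lam) atTop atBot := by
      rw [← Real.tendsto_exp_comp_nhds_zero]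
      refine F.msc_tendsto.congr' ?_
      filter_upwards [eventually_gt_atTop 0] with lam hl using hms lam hl
    simpa [Function.comp_def] using tendsto_neg_atBot_atTop.comp h1
  · intro K hK k ε hε
    filter_upwards [F.conv K hK k ε hε, eventually_gt_atTop 0] with lam h hl p hp
    obtain ⟨h1, h2⟩ := h p hp
    rw [hms lam hl] at h1 h2
    refine ⟨⟨?_, h1.2.le⟩, fun j hj => ?_⟩
    · have := h1.1
      norm_num
      exact this
    · have e : (fun q : V3 × ℝ => u (fun i => exp (-u 0 lam) * q.1 i) (q.2 + lam) - u 0 lam - 3 * q.2)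
          =ᶠ[nhds p] fun q => fx F.lf (0, lam) - fx F.lf (Ph (exp (-u 0 lam)) lam q) := by
        filter_upwards [Ph_nhds _ lam p h1] with q hq
        rw [fx_apply' _ _ (DFlow.zero_mem lam hl), fx_apply' _ _ hq, F.ev_lf, F.ev_lf, hF, hF,
          Real.log_exp, Real.log_exp]
        simp only [Ph]
        ring
      rw [(e.iteratedFDeriv ℝ j).eq_of_nhds]
      exact h2 j hj
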